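/- Fix w > √3 and let r_w > 1 be the unique solution of r³ − (w/(1+w))r² − w/(3+w) = 0. Then there exists δ₀ > 0 such that whenever δ := 1/L + |L/W − 1/w| < δ₀, any solution Q ∈ H_∞ of the Euler–Lagrange equation L ΔQ = −aQ − b(Q² − (|Q|²/3)I) + c|Q|²Q in Ω with weak anchoring (L/W) ∂Q/∂ν = Q_s − Q on |x| = 1 admits a uniaxial ring: there exist functions ρ_u(θ), z_u(θ) of the azimuthal angle θ such that Q(x) has a repeated eigenvalue at every point x = (ρ_u(θ)cos θ, ρ_u(θ)sin θ, z_u(θ)), and |ρ_u(θ) − r_w| + |z_u(θ)| ≤ ε(δ) for all θ, where ε(δ) → 0 as δ → 0. -/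

import Mathlib

open MeasureTheory Filter Metric Real Set
open scoped ENNReal NNReal
noncomputable section

abbrev E3 : Type := EuclideanSpace ℝ (Fin 3)
abbrev Mat3 : Type := Matrix (Fin 3) (Fin 3) ℝ

def isS0 (Q : Mat3) : Prop := Q.IsSymm ∧ Q.trace = 0
def minner (A B : Mat3) : ℝ := (A * B).trace
def mnormSq (A : Mat3) : ℝ := (A * A).trace
def mnorm (A : Mat3) : ℝ := Real.sqrt (mnormSq A)
def outer (u v : E3) : Mat3 := Matrix.of fun i j => u i * v j
def ez : E3 := EuclideanSpace.single 2 1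
def er (x : E3) : E3 := ‖x‖⁻¹ • x
def sstar (a b c : ℝ) : ℝ := (b + Real.sqrt (b ^ 2 + 24 * a * c)) / (4 * c)
def Qinf (a b c : ℝ) : Mat3 := sstar a b c • (outer ez ez - (1 / 3 : ℝ) • (1 : Mat3))
def Qsurf (a b c : ℝ) (x : E3) : Mat3 :=
  sstar a b c • (outer (er x) (er x) - (1 / 3 : ℝ) • (1 : Mat3))
def Omega : Set E3 := {x | 1 < ‖x‖}
def OmegaBar : Set E3 := {x | 1 ≤ ‖x‖}

def pd (g : E3 → ℝ) (k : Fin 3) : E3 → ℝ :=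
  fun x => fderivWithin ℝ g OmegaBar x (EuclideanSpace.single k 1)
def lap3 (g : E3 → ℝ) (x : E3) : ℝ := ∑ k, pd (pd g k) k x
def matLap (Q : E3 → Mat3) (x : E3) : Mat3 := Matrix.of fun i j => lap3 (fun y => Q y i j) x
def gradSq (Q : E3 → Mat3) (x : E3) : ℝ := ∑ i, ∑ j, ∑ k, (pd (fun y => Q y i j) k x) ^ 2
def nuDeriv (Q : E3 → Mat3) (x : E3) : Mat3 :=
  Matrix.of fun i j => fderivWithin ℝ (fun y => Q y i j) OmegaBar x (-(er x))

def gradf (a b c : ℝ) (Q : Mat3) : Mat3 :=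
  (-a) • Q - b • (Q * Q - (mnormSq Q / 3) • (1 : Mat3)) + (c * mnormSq Q) • Q

def gpot (a b c : ℝ) (Q : Mat3) : ℝ :=
  -(a / 2) * (Q * Q).trace - (b / 3) * (Q * Q * Q).trace + (c / 4) * ((Q * Q).trace) ^ 2
def Cconst (a b c : ℝ) : ℝ := -sInf (gpot a b c '' {Q | isS0 Q})
def fpot (a b c : ℝ) (Q : Mat3) : ℝ := gpot a b c Q + Cconst a b c

def RegC (m : ℕ) (Q : E3 → Mat3) : Prop :=
  ∀ i j, ContDiffOn ℝ m (fun x => Q x i j) OmegaBar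

def memH (a b c : ℝ) (Q : E3 → Mat3) : Prop :=
  (∀ x ∈ OmegaBar, isS0 (Q x)) ∧
  IntegrableOn (fun x => gradSq Q x) Omega volume ∧
  IntegrableOn (fun x => mnormSq (Q x - Qinf a b c) / ‖x‖ ^ 2) Omega volume

def isEL (a b c L : ℝ) (Q : E3 → Mat3) : Prop :=
  ∀ x ∈ Omega, L • matLap Q x = gradf a b c (Q x)

def weakAnchor (a b c L W : ℝ) (Q : E3 → Mat3) : Prop :=
  ∀ x : E3, ‖x‖ = 1 → (L / W) • nuDeriv Q x = Qsurf a b c x - Q x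

def coef1 (w : ℝ≥0∞) : ℝ := if w = ⊤ then 1 else w.toReal / (1 + w.toReal)
def coef3 (w : ℝ≥0∞) : ℝ := if w = ⊤ then 1 else w.toReal / (3 + w.toReal)

def Q0 (a b c : ℝ) (w : ℝ≥0∞) (x : E3) : Mat3 :=
  (sstar a b c * coef3 w / ‖x‖ ^ 3) • (outer (er x) (er x) - (1 / 3 : ℝ) • (1 : Mat3))
  + (sstar a b c * (1 - coef1 w / ‖x‖)) • (outer ez ez - (1 / 3 : ℝ) • (1 : Mat3))

def repeatedEig (Q : Mat3) : Prop := ∃ t : ℝ, 2 ≤ Polynomial.rootMultiplicity t (Matrix.charpoly Q)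

def vec3 (p q r : ℝ) : E3 := (WithLp.equiv 2 (Fin 3 → ℝ)).symm ![p, q, r]

/-- The derivative of `f` along the `k`-th coordinate direction at `x` is `d`. -/
abbrev HasPartial (f : E3 → ℝ) (d : ℝ) (x : E3) (k : Fin 3) : Prop :=
  HasLineDerivAt ℝ f d x (EuclideanSpace.single k 1)

namespace HasPartial

variable {f g : E3 → ℝ} {d e : ℝ} {x : E3} {k : Fin 3}

lemma mk (h : HasDerivAt (fun t : ℝ => f (x + t • EuclideanSpace.single k 1)) d 0) :
    HasPartial f d x k := h

lemma add (hf : HasPartial f d x k) (hg : HasPartial g e x k) :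
    HasPartial (fun y => f y + g y) (d + e) x k :=
  HasDerivAt.add hf hg

lemma sub (hf : HasPartial f d x k) (hg : HasPartial g e x k) :
    HasPartial (fun y => f y - g y) (d - e) x k :=
  HasDerivAt.sub hf hg

lemma mul (hf : HasPartial f d x k) (hg : HasPartial g e x k) :
    HasPartial (fun y => f y * g y) (d * g x + f x * e) x k := by
  have h := HasDerivAt.mul hf hg
  simp only [zero_smul, add_zero] at h
  exact h

lemma const (c : ℝ) : HasPartial (fun _ => c) 0 x k := hasDerivAt_const _ _

lemma coord (i : Fin 3) : HasPartial (fun y : E3 => y i) (if i = k then 1 else 0) x k := by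
  refine mk ?_
  have : (fun t : ℝ => (x + t • (EuclideanSpace.single k 1 : E3)) i)
      = fun t : ℝ => x i + t * (if i = k then 1 else 0) := by
    ext t; simp
  rw [this]
  simpa using ((hasDerivAt_id (0 : ℝ)).mul_const (if i = k then (1 : ℝ) else 0)).const_add (x i)

lemma comp {m : ℝ → ℝ} {m' : ℝ} (hm : HasDerivAt m m' (f x)) (hf : HasPartial f d x k) :
    HasPartial (fun y => m (f y)) (m' * d) x k := by
  have h : HasDerivAt m m' (f (x + (0 : ℝ) • EuclideanSpace.single k 1)) := by simpa using hm
  exact HasDerivAt.comp (0 : ℝ) h hf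

lemma sum {ι : Type*} (s : Finset ι) {f : ι → E3 → ℝ} {d : ι → ℝ}
    (hf : ∀ i ∈ s, HasPartial (f i) (d i) x k) :
    HasPartial (fun y => ∑ i ∈ s, f i y) (∑ i ∈ s, d i) x k :=
  HasDerivAt.fun_sum hf

lemma congr_nhds (hf : HasPartial f d x k) (h : g =ᶠ[nhds x] f) : HasPartial g d x k :=
  HasLineDerivAt.congr_of_eventuallyEq hf h

lemma congr_deriv (hf : HasPartial f d x k) (h : d = e) : HasPartial f e x k := h ▸ hf

lemma of_hasFDerivAt {f' : E3 →L[ℝ] ℝ} (h : HasFDerivAt f f' x) :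
    HasPartial f (f' (EuclideanSpace.single k 1)) x k := h.hasLineDerivAt _

lemma hasDerivAt_line {t : ℝ} (h : HasPartial f d (x + t • EuclideanSpace.single k 1) k) :
    HasDerivAt (fun u : ℝ => f (x + u • EuclideanSpace.single k 1)) d t := by
  have h' : HasDerivAt
      (fun u : ℝ => f (x + t • EuclideanSpace.single k 1 + u • EuclideanSpace.single k 1)) d
      (t - t) := by
    rw [sub_self]
    exact h
  have h2 := h'.comp_sub_const (x := t) (a := t)
  refine h2.congr_of_eventuallyEq (Filter.Eventually.of_forall fun u => ?_)
  simp only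
  congr 1
  module

end HasPartial

lemma norm_sq_eq_sum (x : E3) : ‖x‖ ^ 2 = x 0 ^ 2 + x 1 ^ 2 + x 2 ^ 2 := by
  rw [EuclideanSpace.real_norm_sq_eq, Fin.sum_univ_three]

lemma hasPartial_norm_sq (x : E3) (k : Fin 3) :
    HasPartial (fun y => ‖y‖ ^ 2) (2 * x k) x k := by
  have h : (fun y : E3 => ‖y‖ ^ 2) = fun y : E3 => y 0 * y 0 + y 1 * y 1 + y 2 * y 2 := by
    ext y; rw [norm_sq_eq_sum]; ring
  rw [h]
  refine ((((HasPartial.coord 0).mul (HasPartial.coord 0)).add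
    ((HasPartial.coord 1).mul (HasPartial.coord 1))).add
    ((HasPartial.coord 2).mul (HasPartial.coord 2))).congr_deriv ?_
  fin_cases k <;> simp <;> ring

lemma isOpen_Omega : IsOpen Omega := isOpen_lt continuous_const continuous_norm

lemma isClosed_OmegaBar : IsClosed OmegaBar := isClosed_le continuous_const continuous_norm

lemma Omega_subset_OmegaBar : Omega ⊆ OmegaBar := fun x hx => le_of_lt (show 1 < ‖x‖ from hx)

lemma measurableSet_Omega : MeasurableSet Omega := isOpen_Omega.measurableSet

lemma one_lt_norm_sq {x : E3} (hx : x ∈ Omega) : 1 < ‖x‖ ^ 2 := by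
  have : 1 < ‖x‖ := hx
  nlinarith

lemma one_le_norm_sq {x : E3} (hx : x ∈ OmegaBar) : 1 ≤ ‖x‖ ^ 2 := by
  have : 1 ≤ ‖x‖ := hx
  nlinarith

/-- `f` is continuous up to the unit sphere and has the partial derivatives `g` in the exterior
domain, which are also continuous up to the unit sphere. -/
structure HasGrad (f : E3 → ℝ) (g : Fin 3 → E3 → ℝ) : Prop where
  cont : ContinuousOn f OmegaBar
  cont_grad : ∀ k, ContinuousOn (g k) OmegaBar
  partials : ∀ x ∈ Omega, ∀ k, HasPartial f (g k x) x k

namespace HasGrad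

variable {f f₂ : E3 → ℝ} {g g₂ : Fin 3 → E3 → ℝ}

lemma add (h : HasGrad f g) (h₂ : HasGrad f₂ g₂) :
    HasGrad (fun x => f x + f₂ x) (fun k x => g k x + g₂ k x) :=
  ⟨h.cont.add h₂.cont, fun k => (h.cont_grad k).add (h₂.cont_grad k),
    fun x hx k => (h.partials x hx k).add (h₂.partials x hx k)⟩

lemma sub (h : HasGrad f g) (h₂ : HasGrad f₂ g₂) :
    HasGrad (fun x => f x - f₂ x) (fun k x => g k x - g₂ k x) :=
  ⟨h.cont.sub h₂.cont, fun k => (h.cont_grad k).sub (h₂.cont_grad k),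
    fun x hx k => (h.partials x hx k).sub (h₂.partials x hx k)⟩

lemma mul (h : HasGrad f g) (h₂ : HasGrad f₂ g₂) :
    HasGrad (fun x => f x * f₂ x) (fun k x => g k x * f₂ x + f x * g₂ k x) :=
  ⟨h.cont.mul h₂.cont, fun k => ((h.cont_grad k).mul h₂.cont).add (h.cont.mul (h₂.cont_grad k)),
    fun x hx k => (h.partials x hx k).mul (h₂.partials x hx k)⟩

lemma const (c : ℝ) : HasGrad (fun _ => c) (fun _ _ => 0) :=
  ⟨continuousOn_const, fun _ => continuousOn_const, fun _ _ _ => HasPartial.const c⟩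

lemma const_mul (c : ℝ) (h : HasGrad f g) :
    HasGrad (fun x => c * f x) (fun k x => c * g k x) := by
  simpa using (const c).mul h

lemma coord (i : Fin 3) : HasGrad (fun x => x i) (fun k _ => if i = k then 1 else 0) :=
  ⟨by fun_prop, fun _ => continuousOn_const, fun _ _ _ => HasPartial.coord i⟩

lemma sum {ι : Type*} (s : Finset ι) {f : ι → E3 → ℝ} {g : ι → Fin 3 → E3 → ℝ}
    (h : ∀ i ∈ s, HasGrad (f i) (g i)) :
    HasGrad (fun x => ∑ i ∈ s, f i x) (fun k x => ∑ i ∈ s, g i k x) :=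
  ⟨continuousOn_finsetSum s fun i hi => (h i hi).cont,
    fun k => continuousOn_finsetSum s fun i hi => (h i hi).cont_grad k,
    fun x hx _ => HasPartial.sum s fun i hi => (h i hi).partials x hx _⟩

lemma congr_grad {g' : Fin 3 → E3 → ℝ} (h : HasGrad f g)
    (hg : ∀ k, ∀ x ∈ OmegaBar, g' k x = g k x) :
    HasGrad f g' :=
  ⟨h.cont, fun k => (h.cont_grad k).congr (hg k),
    fun x hx k => (h.partials x hx k).congr_deriv (hg k x (Omega_subset_OmegaBar hx)).symm⟩

lemma radial {m m' : ℝ → ℝ} (hm : ∀ s, 1 ≤ s → HasDerivAt m (m' s) s)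
    (hm' : ContinuousOn m' (Ici 1)) :
    HasGrad (fun x => m (‖x‖ ^ 2)) (fun k x => 2 * x k * m' (‖x‖ ^ 2)) := by
  have hmaps : MapsTo (fun x : E3 => ‖x‖ ^ 2) OmegaBar (Ici 1) := fun x hx => one_le_norm_sq hx
  have hc : ContinuousOn (fun x : E3 => ‖x‖ ^ 2) OmegaBar := by fun_prop
  refine ⟨?_, fun k => ?_, fun x hx k => ?_⟩
  · exact ContinuousOn.comp (fun s hs => (hm s hs).continuousAt.continuousWithinAt) hc hmaps
  · exact ContinuousOn.mul (by fun_prop) (hm'.comp hc hmaps)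
  · refine (HasPartial.comp (hm _ (one_lt_norm_sq hx).le) (hasPartial_norm_sq x k)).congr_deriv ?_
    ring

end HasGrad

/-- A `C¹` monotone step, equal to `0` on `(-∞, 1]` and to `1` on `[2, ∞)`. -/
def step (y : ℝ) : ℝ :=
  2 * max (y - 1) 0 ^ 2 - 4 * max (y - 3 / 2) 0 ^ 2 + 2 * max (y - 2) 0 ^ 2

/-- The derivative of `step`. -/
def stepDeriv (y : ℝ) : ℝ :=
  4 * max (y - 1) 0 - 8 * max (y - 3 / 2) 0 + 4 * max (y - 2) 0

lemma hasDerivAt_max_zero_sq (y : ℝ) : HasDerivAt (fun z : ℝ => max z 0 ^ 2) (2 * max y 0) y := by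
  rcases lt_trichotomy y 0 with h | h | h
  · rw [max_eq_right h.le, mul_zero]
    refine (hasDerivAt_const y (0 : ℝ)).congr_of_eventuallyEq ?_
    filter_upwards [eventually_lt_nhds h] with z hz
    simp [max_eq_right hz.le]
  · subst h
    simp only [max_self, mul_zero]
    rw [hasDerivAt_iff_isLittleO_nhds_zero]
    simp only [zero_add, max_self, smul_zero, sub_zero, ne_eq, OfNat.ofNat_ne_zero,
      not_false_eq_true, zero_pow]
    refine Asymptotics.IsBigO.trans_isLittleO (g := fun z : ℝ => z ^ 2) ?_ ?_
    · refine Asymptotics.IsBigO.of_bound 1 (Eventually.of_forall fun z => ?_)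
      simp only [Real.norm_eq_abs, one_mul, abs_pow]
      refine pow_le_pow_left₀ (abs_nonneg _) ?_ 2
      rcases le_total z 0 with h | h
      · simp [max_eq_right h]
      · simp [max_eq_left h]
    · exact Asymptotics.isLittleO_pow_id one_lt_two
  · rw [max_eq_left h.le]
    refine (by simpa using hasDerivAt_pow 2 y : HasDerivAt (fun z : ℝ => z ^ 2) (2 * y) y)
      |>.congr_of_eventuallyEq ?_
    filter_upwards [eventually_gt_nhds h] with z hz
    simp [max_eq_left hz.le]

lemma hasDerivAt_step (y : ℝ) : HasDerivAt step (stepDeriv y) y := by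
  have h (c : ℝ) : HasDerivAt (fun z : ℝ => max (z - c) 0 ^ 2) (2 * max (y - c) 0) y :=
    (hasDerivAt_max_zero_sq (y - c)).comp_sub_const y c
  exact ((((h 1).const_mul 2).sub ((h (3 / 2)).const_mul 4)).add ((h 2).const_mul 2)).congr_deriv
    (by unfold stepDeriv; ring)

lemma continuous_step : Continuous step := by unfold step; fun_prop

lemma continuous_stepDeriv : Continuous stepDeriv := by unfold stepDeriv; fun_prop

lemma step_of_le {y : ℝ} (h : y ≤ 1) : step y = 0 := by
  simp [step, max_eq_right (sub_nonpos.2 h), max_eq_right (by linarith : y - 3 / 2 ≤ 0),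
    max_eq_right (by linarith : y - 2 ≤ 0)]

lemma stepDeriv_of_le {y : ℝ} (h : y ≤ 1) : stepDeriv y = 0 := by
  simp [stepDeriv, max_eq_right (sub_nonpos.2 h), max_eq_right (by linarith : y - 3 / 2 ≤ 0),
    max_eq_right (by linarith : y - 2 ≤ 0)]

lemma step_of_ge {y : ℝ} (h : 2 ≤ y) : step y = 1 := by
  rw [step, max_eq_left (by linarith : 0 ≤ y - 1), max_eq_left (by linarith : 0 ≤ y - 3 / 2),
    max_eq_left (by linarith : 0 ≤ y - 2)]
  ring

lemma stepDeriv_of_ge {y : ℝ} (h : 2 ≤ y) : stepDeriv y = 0 := by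
  rw [stepDeriv, max_eq_left (by linarith : 0 ≤ y - 1), max_eq_left (by linarith : 0 ≤ y - 3 / 2),
    max_eq_left (by linarith : 0 ≤ y - 2)]
  ring

lemma stepDeriv_nonneg (y : ℝ) : 0 ≤ stepDeriv y := by
  unfold stepDeriv
  rcases max_cases (y - 1) 0 with h | h <;> rcases max_cases (y - 3 / 2) 0 with h' | h' <;>
    rcases max_cases (y - 2) 0 with h'' | h'' <;> linarith

lemma stepDeriv_le (y : ℝ) : stepDeriv y ≤ 2 := by
  unfold stepDeriv
  rcases max_cases (y - 1) 0 with h | h <;> rcases max_cases (y - 3 / 2) 0 with h' | h' <;>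
    rcases max_cases (y - 2) 0 with h'' | h'' <;> linarith

lemma step_monotone : Monotone step :=
  monotone_of_hasDerivAt_nonneg (f' := stepDeriv) hasDerivAt_step stepDeriv_nonneg

lemma step_nonneg (y : ℝ) : 0 ≤ step y := by
  rcases le_total y 1 with h | h
  · rw [step_of_le h]
  · rw [← step_of_le le_rfl]
    exact step_monotone h

lemma step_le_one (y : ℝ) : step y ≤ 1 := by
  rcases le_total y 2 with h | h
  · rw [← step_of_ge le_rfl]
    exact step_monotone h
  · rw [step_of_ge h]

/-- A `C¹` function on the whole space with compact support has partial derivatives of integral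
zero. -/
lemma integral_partial_eq_zero {F D : E3 → ℝ} {k : Fin 3} (hF : Continuous F) (hD : Continuous D)
    (hFs : HasCompactSupport F) (hDs : HasCompactSupport D) (h : ∀ x, HasPartial F (D x) x k) :
    ∫ x, D x = 0 := by
  have := integral_bilinear_hasLineDerivAt_right_eq_neg_left_of_integrable (μ := volume)
    (f := fun _ : E3 => (1 : ℝ)) (f' := fun _ => (0 : ℝ)) (g := F) (g' := D)
    (v := EuclideanSpace.single k 1) (B := ContinuousLinearMap.mul ℝ ℝ) (by simp)
    (by simpa using hD.integrable_of_hasCompactSupport hDs)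
    (by simpa using hF.integrable_of_hasCompactSupport hFs)
    (fun x _ => HasPartial.const 1) (fun x _ => h x)
  simpa using this

lemma continuous_cutoff_mul {η g : E3 → ℝ} {ε : ℝ} (hε : 0 < ε) (hη : Continuous η)
    (hz : ∀ x, ‖x‖ ^ 2 ≤ 1 + ε → η x = 0) (hg : ContinuousOn g OmegaBar) :
    Continuous fun x => η x * g x := by
  refine continuous_iff_continuousAt.2 fun x => ?_
  by_cases hx : x ∈ Omega
  · exact hη.continuousAt.mul (hg.continuousAt
      (Filter.mem_of_superset (isOpen_Omega.mem_nhds hx) Omega_subset_OmegaBar))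
  · have hx1 : ‖x‖ ^ 2 < 1 + ε := by
      have : ‖x‖ ≤ 1 := not_lt.1 hx
      nlinarith [norm_nonneg x]
    have : (fun _ => (0 : ℝ)) =ᶠ[nhds x] fun x => η x * g x := by
      filter_upwards [(isOpen_lt (by fun_prop) continuous_const).mem_nhds
        (show x ∈ {y : E3 | ‖y‖ ^ 2 < 1 + ε} from hx1)] with y hy
      rw [hz y (le_of_lt hy), zero_mul]
    exact continuousAt_const.congr this

lemma hasCompactSupport_of_norm {f : E3 → ℝ} {R : ℝ} (h : ∀ x, R < ‖x‖ → f x = 0) :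
    HasCompactSupport f :=
  HasCompactSupport.intro (isCompact_closedBall (0 : E3) R) fun x hx => h x (by simpa using hx)

lemma integrableOn_of_norm {g : E3 → ℝ} {R : ℝ} (hg : ContinuousOn g OmegaBar)
    (h : ∀ x, R < ‖x‖ → g x = 0) : IntegrableOn g Omega := by
  have h1 : IntegrableOn g (OmegaBar ∩ closedBall 0 R) :=
    (hg.mono inter_subset_left).integrableOn_compact
      ((isCompact_closedBall (0 : E3) R).inter_left isClosed_OmegaBar)
  refine h1.of_forall_sdiff_eq_zero measurableSet_Omega fun x hx => h x ?_
  by_contra hc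
  exact hx.2 ⟨Omega_subset_OmegaBar hx.1, by simpa using hc⟩

/-- A strict lower bound on the unit sphere persists on a thin shell. -/
lemma exists_shell_lt {g : E3 → ℝ} {c : ℝ} (hg : ContinuousOn g OmegaBar)
    (h : ∀ x : E3, ‖x‖ = 1 → c < g x) :
    ∃ τ > 0, ∀ x ∈ OmegaBar, ‖x‖ ^ 2 ≤ 1 + τ → c < g x := by
  have hK : IsCompact ((OmegaBar ∩ g ⁻¹' Iic c) ∩ closedBall 0 2) :=
    (isCompact_closedBall (0 : E3) 2).inter_left
      (hg.preimage_isClosed_of_isClosed isClosed_OmegaBar isClosed_Iic)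
  rcases ((OmegaBar ∩ g ⁻¹' Iic c) ∩ closedBall 0 2).eq_empty_or_nonempty with he | hne
  · refine ⟨1, one_pos, fun x hx hx2 => ?_⟩
    by_contra hc
    have : x ∈ (OmegaBar ∩ g ⁻¹' Iic c) ∩ closedBall 0 2 :=
      ⟨⟨hx, not_lt.1 hc⟩, by rw [mem_closedBall_zero_iff]; nlinarith [norm_nonneg x]⟩
    simp [he] at this
  · obtain ⟨y, hy, hmin⟩ := hK.exists_isMinOn hne (f := fun x => ‖x‖ ^ 2) (by fun_prop)
    have hy1 : 1 < ‖y‖ := by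
      refine lt_of_le_of_ne hy.1.1 fun h1 => ?_
      exact absurd (h y h1.symm) (not_lt.2 hy.1.2)
    refine ⟨min 1 ((‖y‖ ^ 2 - 1) / 2), lt_min one_pos (by nlinarith), fun x hx hx2 => ?_⟩
    by_contra hc
    have hx1 : ‖x‖ ^ 2 ≤ 1 + 1 := hx2.trans (by gcongr; exact min_le_left _ _)
    have hxm : x ∈ (OmegaBar ∩ g ⁻¹' Iic c) ∩ closedBall 0 2 :=
      ⟨⟨hx, not_lt.1 hc⟩, by rw [mem_closedBall_zero_iff]; nlinarith [norm_nonneg x]⟩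
    have h3 : ‖y‖ ^ 2 ≤ ‖x‖ ^ 2 := hmin hxm
    have h4 : ‖x‖ ^ 2 ≤ 1 + (‖y‖ ^ 2 - 1) / 2 := hx2.trans (by gcongr; exact min_le_right _ _)
    nlinarith

section Gauss

variable {V : Fin 3 → E3 → ℝ} {dV : Fin 3 → Fin 3 → E3 → ℝ} {R ε κ : ℝ}

lemma integral_cutoff_div (hV : ∀ k, HasGrad (V k) (dV k))
    (hR : ∀ x, R < ‖x‖ → ∀ k, V k x = 0) (hR' : ∀ x, R < ‖x‖ → ∀ k, dV k k x = 0) (hε : 0 < ε) :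
    ∫ x in Omega, (step ((‖x‖ ^ 2 - 1) / ε) * ∑ k, dV k k x
      + 2 / ε * stepDeriv ((‖x‖ ^ 2 - 1) / ε) * ∑ k, x k * V k x) = 0 := by
  have hy (x : E3) (hx : ‖x‖ ^ 2 ≤ 1 + ε) : (‖x‖ ^ 2 - 1) / ε ≤ 1 := by
    rw [div_le_one hε]; linarith
  have hη : Continuous fun x : E3 => step ((‖x‖ ^ 2 - 1) / ε) :=
    continuous_step.comp (by fun_prop)
  have hη' : Continuous fun x : E3 => stepDeriv ((‖x‖ ^ 2 - 1) / ε) :=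
    continuous_stepDeriv.comp (by fun_prop)
  have hF (k : Fin 3) : Continuous fun x => step ((‖x‖ ^ 2 - 1) / ε) * V k x :=
    continuous_cutoff_mul hε hη (fun x hx => step_of_le (hy x hx)) (hV k).cont
  have hD (k : Fin 3) : Continuous fun x => step ((‖x‖ ^ 2 - 1) / ε) * dV k k x
      + stepDeriv ((‖x‖ ^ 2 - 1) / ε) * (2 / ε * (x k * V k x)) := by
    refine (continuous_cutoff_mul hε hη (fun x hx => step_of_le (hy x hx))
      ((hV k).cont_grad k)).add (continuous_cutoff_mul hε hη'
        (fun x hx => stepDeriv_of_le (hy x hx)) ?_)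
    exact ContinuousOn.mul continuousOn_const (ContinuousOn.mul (by fun_prop) (hV k).cont)
  have hFs (k : Fin 3) : HasCompactSupport fun x => step ((‖x‖ ^ 2 - 1) / ε) * V k x :=
    hasCompactSupport_of_norm (R := R) fun x hx => by simp [hR x hx k]
  have hDs (k : Fin 3) : HasCompactSupport fun x => step ((‖x‖ ^ 2 - 1) / ε) * dV k k x
      + stepDeriv ((‖x‖ ^ 2 - 1) / ε) * (2 / ε * (x k * V k x)) :=
    hasCompactSupport_of_norm (R := R) fun x hx => by simp [hR x hx k, hR' x hx k]
  have hP (k : Fin 3) (x : E3) : HasPartial (fun x => step ((‖x‖ ^ 2 - 1) / ε) * V k x)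
      (step ((‖x‖ ^ 2 - 1) / ε) * dV k k x
      + stepDeriv ((‖x‖ ^ 2 - 1) / ε) * (2 / ε * (x k * V k x))) x k := by
    by_cases hx : x ∈ Omega
    · have h1 : HasPartial (fun x => step ((‖x‖ ^ 2 - 1) / ε))
          (stepDeriv ((‖x‖ ^ 2 - 1) / ε) * (1 / ε * (2 * x k))) x k := by
        refine HasPartial.comp (f := fun x => (‖x‖ ^ 2 - 1) / ε) (hasDerivAt_step _) ?_
        have h2 : HasDerivAt (fun y : ℝ => (y - 1) / ε) (1 / ε) (‖x‖ ^ 2) :=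
          ((hasDerivAt_id _).sub_const 1).div_const ε
        exact HasPartial.comp h2 (hasPartial_norm_sq x k)
      refine (h1.mul ((hV k).partials x hx k)).congr_deriv ?_
      ring
    · have hx1 : ‖x‖ ^ 2 < 1 + ε := by
        have : ‖x‖ ≤ 1 := not_lt.1 hx
        nlinarith [norm_nonneg x]
      rw [step_of_le (hy x hx1.le), stepDeriv_of_le (hy x hx1.le), zero_mul, zero_mul, add_zero]
      refine (HasPartial.const 0).congr_nhds ?_
      filter_upwards [(isOpen_lt (by fun_prop) continuous_const).mem_nhds
        (show x ∈ {y : E3 | ‖y‖ ^ 2 < 1 + ε} from hx1)] with y hy'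
      rw [step_of_le (hy y (le_of_lt hy')), zero_mul]
  rw [setIntegral_eq_integral_of_forall_compl_eq_zero]
  · have h0 : ∑ k : Fin 3, ∫ x, (step ((‖x‖ ^ 2 - 1) / ε) * dV k k x
        + stepDeriv ((‖x‖ ^ 2 - 1) / ε) * (2 / ε * (x k * V k x))) = 0 :=
      Finset.sum_eq_zero fun k _ =>
        integral_partial_eq_zero (hF k) (hD k) (hFs k) (hDs k) (hP k)
    rw [← integral_finsetSum _ fun k _ => (hD k).integrable_of_hasCompactSupport (hDs k)] at h0
    rw [← h0]
    congr 1
    ext x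
    simp only [Fin.sum_univ_three]
    ring
  · intro x hx
    have hx1 : ‖x‖ ^ 2 ≤ 1 + ε := by
      have : ‖x‖ ≤ 1 := not_lt.1 hx
      nlinarith [norm_nonneg x]
    rw [step_of_le (hy x hx1), stepDeriv_of_le (hy x hx1)]
    ring

lemma continuousOn_divergence (hV : ∀ k, HasGrad (V k) (dV k)) :
    ContinuousOn (fun x => ∑ k, dV k k x) OmegaBar :=
  continuousOn_finsetSum _ fun k _ => (hV k).cont_grad k

lemma continuousOn_flux (hV : ∀ k, HasGrad (V k) (dV k)) :
    ContinuousOn (fun x => ∑ k, x k * V k x) OmegaBar :=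
  continuousOn_finsetSum _ fun k _ => ContinuousOn.mul (by fun_prop) (hV k).cont

lemma tendsto_integral_cutoff {g : E3 → ℝ} (hg : IntegrableOn g Omega) :
    Tendsto (fun n : ℕ => ∫ x in Omega, step ((‖x‖ ^ 2 - 1) / (1 / ((n : ℝ) + 1))) * g x) atTop
      (nhds (∫ x in Omega, g x)) := by
  refine tendsto_integral_of_dominated_convergence (fun x => |g x|) (fun n => ?_) hg.abs
    (fun n => Eventually.of_forall fun x => ?_) ?_
  · exact ((continuous_step.comp (by fun_prop)).aestronglyMeasurable).mul hg.aestronglyMeasurable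
  · rw [Real.norm_eq_abs, abs_mul, abs_of_nonneg (step_nonneg _)]
    exact mul_le_of_le_one_left (abs_nonneg _) (step_le_one _)
  · refine (ae_restrict_iff' measurableSet_Omega).2 (Eventually.of_forall fun x hx => ?_)
    have hx1 : 0 < ‖x‖ ^ 2 - 1 := by linarith [one_lt_norm_sq hx]
    refine tendsto_const_nhds.congr' ?_
    obtain ⟨N, hN⟩ := exists_nat_gt (2 / (‖x‖ ^ 2 - 1))
    filter_upwards [eventually_ge_atTop N] with n hn
    rw [step_of_ge, one_mul]
    have hn' : (N : ℝ) ≤ n := by exact_mod_cast hn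
    rw [div_lt_iff₀ hx1] at hN
    rw [div_div_eq_mul_div, div_one]
    nlinarith

/-- Integral of a divergence over the exterior domain when the flux through the unit sphere is
bounded from below, for compactly supported fields. -/
theorem exists_integral_div_le_of_compact :
    ∃ C > 0, ∀ (V : Fin 3 → E3 → ℝ) (dV : Fin 3 → Fin 3 → E3 → ℝ) (R κ : ℝ),
      (∀ k, HasGrad (V k) (dV k)) → (∀ x, R < ‖x‖ → ∀ k, V k x = 0) →
      (∀ x, R < ‖x‖ → ∀ k, dV k k x = 0) → 0 ≤ κ →
      (∀ x : E3, ‖x‖ = 1 → -κ ≤ ∑ k, x k * V k x) →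
      ∫ x in Omega, ∑ k, dV k k x ≤ C * κ := by
  have hχ : HasGrad (fun x => 1 - step (‖x‖ ^ 2 - 1))
      (fun k x => 0 - 2 * x k * stepDeriv (‖x‖ ^ 2 - 1)) :=
    (HasGrad.const 1).sub (HasGrad.radial (m := fun s => step (s - 1))
      (m' := fun s => stepDeriv (s - 1)) (fun s _ => (hasDerivAt_step _).comp_sub_const s 1)
      (continuous_stepDeriv.comp (by fun_prop)).continuousOn)
  have hU (k : Fin 3) := hχ.mul (HasGrad.coord k)
  have hge (x : E3) (hx : 2 < ‖x‖) : 2 ≤ ‖x‖ ^ 2 - 1 := by nlinarith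
  have hU0 (x : E3) (hx : 2 < ‖x‖) (k : Fin 3) : (1 - step (‖x‖ ^ 2 - 1)) * x k = 0 := by
    rw [step_of_ge (hge x hx)]; ring
  have hU0' (x : E3) (hx : 2 < ‖x‖) (k : Fin 3) :
      (0 - 2 * x k * stepDeriv (‖x‖ ^ 2 - 1)) * x k
        + (1 - step (‖x‖ ^ 2 - 1)) * (if k = k then 1 else 0) = 0 := by
    rw [step_of_ge (hge x hx), stepDeriv_of_ge (hge x hx)]; ring
  set D : E3 → ℝ := fun x => ∑ k : Fin 3, ((0 - 2 * x k * stepDeriv (‖x‖ ^ 2 - 1)) * x k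
        + (1 - step (‖x‖ ^ 2 - 1)) * (if k = k then 1 else 0)) with hDdef
  have hDint : IntegrableOn D Omega :=
    integrableOn_of_norm (R := 2) (continuousOn_divergence hU) fun x hx =>
      Finset.sum_eq_zero fun k _ => hU0' x hx k
  refine ⟨(∫ x in Omega, |D x|) + 1,
    add_pos_of_nonneg_of_pos (integral_nonneg fun x => abs_nonneg _) one_pos, ?_⟩
  intro V dV R κ hV hR hR' hκ hb
  have hdint : IntegrableOn (fun x => ∑ k, dV k k x) Omega :=
    integrableOn_of_norm (R := R) (continuousOn_divergence hV) fun x hx =>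
      Finset.sum_eq_zero fun k _ => hR' x hx k
  suffices hmain : ∀ κ' > κ, ∫ x in Omega, ∑ k, dV k k x ≤ κ' * ((∫ x in Omega, |D x|) + 1) by
    rw [mul_comm]
    have : Tendsto (fun κ' : ℝ => κ' * ((∫ x in Omega, |D x|) + 1)) (nhdsWithin κ (Ioi κ))
        (nhds (κ * ((∫ x in Omega, |D x|) + 1))) :=
      ((continuous_id.mul continuous_const).tendsto κ).mono_left nhdsWithin_le_nhds
    exact ge_of_tendsto this (eventually_nhdsWithin_of_forall fun κ' hκ' => hmain κ' hκ')
  intro κ' hκ'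
  obtain ⟨τ, hτ, hshell⟩ := exists_shell_lt (c := -κ') (continuousOn_flux hV)
    (fun x hx => lt_of_lt_of_le (by linarith) (hb x hx))
  refine le_of_tendsto (tendsto_integral_cutoff hdint) ?_
  obtain ⟨N, hN⟩ := exists_nat_gt (2 / τ + 2)
  filter_upwards [eventually_ge_atTop N] with n hn
  set ε : ℝ := 1 / ((n : ℝ) + 1) with hεdef
  have hn' : 2 / τ + 2 < n := hN.trans_le (by exact_mod_cast hn)
  have hε : 0 < ε := by positivity
  have hε1 : 2 * ε ≤ 1 := by
    have : 0 < 2 / τ := by positivity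
    rw [hεdef, mul_one_div, div_le_one (by positivity)]; linarith
  have hετ : 2 * ε ≤ τ := by
    rw [hεdef, mul_one_div, div_le_iff₀ (by positivity)]
    have : 2 / τ < n + 1 := by linarith
    rw [div_lt_iff₀ hτ] at this
    linarith
  have hcS : Continuous fun x : E3 => step ((‖x‖ ^ 2 - 1) / ε) :=
    continuous_step.comp (by fun_prop)
  have hcS' : Continuous fun x : E3 => 2 / ε * stepDeriv ((‖x‖ ^ 2 - 1) / ε) :=
    continuous_const.mul (continuous_stepDeriv.comp (by fun_prop))
  have i1 : IntegrableOn (fun x => step ((‖x‖ ^ 2 - 1) / ε) * ∑ k, dV k k x) Omega :=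
    integrableOn_of_norm (R := R) (hcS.continuousOn.mul (continuousOn_divergence hV)) fun x hx => by
      simp [hR' x hx]
  have i2 : IntegrableOn (fun x => 2 / ε * stepDeriv ((‖x‖ ^ 2 - 1) / ε) * ∑ k, x k * V k x)
      Omega :=
    integrableOn_of_norm (R := R) (hcS'.continuousOn.mul (continuousOn_flux hV)) fun x hx => by
      simp [hR x hx]
  have i3 : IntegrableOn (fun x => step ((‖x‖ ^ 2 - 1) / ε) * D x) Omega :=
    integrableOn_of_norm (R := 2) (hcS.continuousOn.mul (continuousOn_divergence hU)) fun x hx => by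
      rw [hDdef]
      exact mul_eq_zero_of_right _ (Finset.sum_eq_zero fun k _ => hU0' x hx k)
  have i4 : IntegrableOn (fun x => 2 / ε * stepDeriv ((‖x‖ ^ 2 - 1) / ε) *
      ∑ k, x k * ((1 - step (‖x‖ ^ 2 - 1)) * x k)) Omega :=
    integrableOn_of_norm (R := 2) (hcS'.continuousOn.mul (continuousOn_flux hU)) fun x hx => by
      simp only [hU0 x hx, mul_zero, Finset.sum_const_zero]
  have e1 := integral_cutoff_div hV hR hR' hε
  rw [integral_add i1 i2] at e1
  have e2 := integral_cutoff_div hU hU0 hU0' hε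
  rw [integral_add i3 i4] at e2
  have hDle : -∫ x in Omega, step ((‖x‖ ^ 2 - 1) / ε) * D x ≤ ∫ x in Omega, |D x| := by
    rw [← integral_neg]
    refine integral_mono i3.neg hDint.abs fun x => ?_
    have h1 : |step ((‖x‖ ^ 2 - 1) / ε) * D x| ≤ |D x| := by
      rw [abs_mul, abs_of_nonneg (step_nonneg _)]
      exact mul_le_of_le_one_left (abs_nonneg _) (step_le_one _)
    exact (neg_le_abs _).trans h1
  have key : -κ' * ∫ x in Omega, 2 / ε * stepDeriv ((‖x‖ ^ 2 - 1) / ε) *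
        ∑ k, x k * ((1 - step (‖x‖ ^ 2 - 1)) * x k)
      ≤ ∫ x in Omega, 2 / ε * stepDeriv ((‖x‖ ^ 2 - 1) / ε) * ∑ k, x k * V k x := by
    rw [← integral_const_mul]
    refine setIntegral_mono_on (i4.const_mul _) i2 measurableSet_Omega fun x hx => ?_
    by_cases h2 : 2 ≤ (‖x‖ ^ 2 - 1) / ε
    · rw [stepDeriv_of_ge h2]; simp
    · have hx2 : ‖x‖ ^ 2 < 1 + 2 * ε := by
        rw [not_le, div_lt_iff₀ hε] at h2; linarith
      have hV1 := hshell x (Omega_subset_OmegaBar hx) (by linarith)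
      rw [step_of_le (by linarith : ‖x‖ ^ 2 - 1 ≤ 1)]
      have h3 : ∑ k, x k * ((1 - 0) * x k) = ‖x‖ ^ 2 := by
        rw [norm_sq_eq_sum, Fin.sum_univ_three]; ring
      rw [h3]
      have hs : 0 ≤ 2 / ε * stepDeriv ((‖x‖ ^ 2 - 1) / ε) :=
        mul_nonneg (by positivity) (stepDeriv_nonneg _)
      have h4 : -κ' * ‖x‖ ^ 2 ≤ ∑ k, x k * V k x := by
        nlinarith [one_lt_norm_sq hx]
      calc -κ' * (2 / ε * stepDeriv ((‖x‖ ^ 2 - 1) / ε) * ‖x‖ ^ 2)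
          = 2 / ε * stepDeriv ((‖x‖ ^ 2 - 1) / ε) * (-κ' * ‖x‖ ^ 2) := by ring
        _ ≤ _ := mul_le_mul_of_nonneg_left h4 hs
  have hκ'0 : 0 < κ' := by linarith
  nlinarith

end Gauss

lemma stepDeriv_mul_le {y : ℝ} (hy : 0 ≤ y) : stepDeriv y * y ≤ 4 := by
  rcases le_total y 2 with h | h
  · nlinarith [stepDeriv_le y, stepDeriv_nonneg y]
  · rw [stepDeriv_of_ge h]; norm_num

/-- Integral of a divergence over the exterior domain when the flux through the unit sphere is
bounded from below and the flux at infinity is negligible. -/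
theorem exists_integral_div_le :
    ∃ C > 0, ∀ (V : Fin 3 → E3 → ℝ) (dV : Fin 3 → Fin 3 → E3 → ℝ) (κ : ℝ),
      (∀ k, HasGrad (V k) (dV k)) → IntegrableOn (fun x => ∑ k, dV k k x) Omega →
      IntegrableOn (fun x => (∑ k, x k * V k x) / ‖x‖ ^ 2) Omega → 0 ≤ κ →
      (∀ x : E3, ‖x‖ = 1 → -κ ≤ ∑ k, x k * V k x) →
      ∫ x in Omega, ∑ k, dV k k x ≤ C * κ := by
  obtain ⟨C, hC, hmain⟩ := exists_integral_div_le_of_compact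
  refine ⟨C, hC, fun V dV κ hV hd hf hκ hb => ?_⟩
  set c : ℕ → ℝ := fun n => 1 / ((n : ℝ) + 1) ^ 2 with hc
  have hcpos (n : ℕ) : 0 < c n := by simp only [hc]; positivity
  have hc0 : Tendsto c atTop (nhds 0) := by
    have h := (tendsto_one_div_add_atTop_nhds_zero_nat (𝕜 := ℝ)).pow 2
    simp only [one_div, inv_pow, ne_eq, OfNat.ofNat_ne_zero, not_false_eq_true, zero_pow] at h
    simpa [hc] using h
  have hχ (n : ℕ) : HasGrad (fun x => 1 - step (c n * ‖x‖ ^ 2))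
      (fun k x => 0 - 2 * x k * (stepDeriv (c n * ‖x‖ ^ 2) * c n)) :=
    (HasGrad.const 1).sub (HasGrad.radial (m := fun s => step (c n * s))
      (m' := fun s => stepDeriv (c n * s) * c n)
      (fun s _ => (hasDerivAt_step _).comp s (by simpa using (hasDerivAt_id s).const_mul (c n)))
      ((continuous_stepDeriv.comp (by fun_prop)).mul continuous_const).continuousOn)
  have hχV (n : ℕ) (k : Fin 3) := (hχ n).mul (hV k)
  have hge (n : ℕ) (x : E3) (hx : 2 * ((n : ℝ) + 1) < ‖x‖) : 2 ≤ c n * ‖x‖ ^ 2 := by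
    simp only [hc]
    rw [one_div, inv_mul_eq_div, le_div_iff₀ (by positivity)]
    have : 0 < (n : ℝ) + 1 := by positivity
    nlinarith
  have hle (n : ℕ) := hmain (fun k x => (1 - step (c n * ‖x‖ ^ 2)) * V k x) _
    (2 * ((n : ℝ) + 1)) κ (hχV n)
    (fun x hx k => by rw [step_of_ge (hge n x hx)]; ring)
    (fun x hx k => by
      rw [step_of_ge (hge n x hx), stepDeriv_of_ge (hge n x hx)]; ring) hκ
    (fun x hx => by
      have h1 : ∑ k, x k * ((1 - step (c n * ‖x‖ ^ 2)) * V k x)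
          = (1 - step (c n * ‖x‖ ^ 2)) * ∑ k, x k * V k x := by
        rw [Finset.mul_sum]; exact Finset.sum_congr rfl fun k _ => by ring
      rw [h1]
      have h2 := step_le_one (c n * ‖x‖ ^ 2)
      have h3 := step_nonneg (c n * ‖x‖ ^ 2)
      have h4 := hb x hx
      nlinarith)
  suffices hlim : Tendsto (fun n : ℕ => ∫ x in Omega,
      ∑ k, ((0 - 2 * x k * (stepDeriv (c n * ‖x‖ ^ 2) * c n)) * V k x
        + (1 - step (c n * ‖x‖ ^ 2)) * dV k k x)) atTop
      (nhds (∫ x in Omega, ∑ k, dV k k x)) from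
    le_of_tendsto hlim (Eventually.of_forall hle)
  have hform (n : ℕ) (x : E3) (hx : x ∈ Omega) :
      ∑ k, ((0 - 2 * x k * (stepDeriv (c n * ‖x‖ ^ 2) * c n)) * V k x
        + (1 - step (c n * ‖x‖ ^ 2)) * dV k k x)
      = (1 - step (c n * ‖x‖ ^ 2)) * ∑ k, dV k k x
        - 2 * (stepDeriv (c n * ‖x‖ ^ 2) * (c n * ‖x‖ ^ 2)) *
          ((∑ k, x k * V k x) / ‖x‖ ^ 2) := by
    have : ‖x‖ ^ 2 ≠ 0 := by linarith [one_lt_norm_sq hx]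
    have h1 (y F : ℝ) : 2 * (y * (c n * ‖x‖ ^ 2)) * (F / ‖x‖ ^ 2) = 2 * (y * c n) * F := by
      have h2 : ‖x‖ ^ 2 * (F / ‖x‖ ^ 2) = F := mul_div_cancel₀ F this
      linear_combination 2 * y * c n * h2
    rw [h1]
    simp only [Fin.sum_univ_three]
    ring
  refine tendsto_integral_of_dominated_convergence
    (fun x => |∑ k, dV k k x| + 8 * |(∑ k, x k * V k x) / ‖x‖ ^ 2|) (fun n => ?_)
    (hd.abs.add (hf.abs.const_mul 8)) (fun n => ?_) ?_
  · exact ((continuousOn_divergence (hχV n)).mono Omega_subset_OmegaBar).aestronglyMeasurable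
      measurableSet_Omega
  · refine (ae_restrict_iff' measurableSet_Omega).2 (Eventually.of_forall fun x hx => ?_)
    rw [hform n x hx, Real.norm_eq_abs]
    refine (abs_sub _ _).trans (add_le_add ?_ ?_)
    · rw [abs_mul, abs_of_nonneg (by linarith [step_le_one (c n * ‖x‖ ^ 2)])]
      exact mul_le_of_le_one_left (abs_nonneg _) (by linarith [step_nonneg (c n * ‖x‖ ^ 2)])
    · rw [abs_mul]
      refine mul_le_mul_of_nonneg_right ?_ (abs_nonneg _)
      have h1 : 0 ≤ c n * ‖x‖ ^ 2 := mul_nonneg (hcpos n).le (sq_nonneg _)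
      have h2 := mul_nonneg (stepDeriv_nonneg (c n * ‖x‖ ^ 2)) h1
      rw [abs_of_nonneg (by linarith)]
      linarith [stepDeriv_mul_le h1]
  · refine (ae_restrict_iff' measurableSet_Omega).2 (Eventually.of_forall fun x hx => ?_)
    refine tendsto_const_nhds.congr' ?_
    have h0 : Tendsto (fun n => c n * ‖x‖ ^ 2) atTop (nhds 0) := by
      simpa using hc0.mul_const (‖x‖ ^ 2)
    filter_upwards [h0.eventually (gt_mem_nhds one_pos)] with n hn
    rw [hform n x hx, step_of_le hn.le, stepDeriv_of_le hn.le]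
    ring

lemma sum_smul_single (v : E3) : ∑ k, v k • (EuclideanSpace.single k 1 : E3) = v := by
  ext i
  simp [Fin.sum_univ_three]
  fin_cases i <;> simp

lemma uniqueDiffOn_OmegaBar : UniqueDiffOn ℝ OmegaBar := by
  intro x hx
  rcases eq_or_lt_of_le (show 1 ≤ ‖x‖ from hx) with h | h
  · have hsub : {y : E3 | 1 ≤ inner ℝ x y} ⊆ OmegaBar := fun y hy => by
      have h1 := real_inner_le_norm x y
      rw [← h, one_mul] at h1
      exact le_trans (show (1 : ℝ) ≤ inner ℝ x y from hy) h1
    refine UniqueDiffWithinAt.mono (uniqueDiffWithinAt_convex ?_ ?_ ?_) hsub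
    · exact convex_halfSpace_ge (f := fun y => inner ℝ x y)
        ⟨fun y z => inner_add_right _ _ _, fun r y => real_inner_smul_right _ _ _⟩ 1
    · refine ⟨(2 : ℝ) • x, mem_interior.2 ⟨{y : E3 | 1 < inner ℝ x y}, fun y hy => ?_, ?_, ?_⟩⟩
      · exact le_of_lt (show (1 : ℝ) < inner ℝ x y from hy)
      · exact isOpen_lt continuous_const (by fun_prop)
      · simp only [mem_ofPred_eq, real_inner_smul_right, real_inner_self_eq_norm_sq, ← h]
        norm_num
    · refine subset_closure ?_
      simp only [mem_ofPred_eq, real_inner_self_eq_norm_sq, ← h]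
      norm_num
  · exact (isOpen_Omega.uniqueDiffWithinAt (show x ∈ Omega from h)).mono Omega_subset_OmegaBar

lemma OmegaBar_mem_nhds {x : E3} (hx : x ∈ Omega) : OmegaBar ∈ nhds x :=
  mem_of_superset (isOpen_Omega.mem_nhds hx) Omega_subset_OmegaBar

lemma contDiffOn_pd {q : E3 → ℝ} {m n : WithTop ℕ∞} (hq : ContDiffOn ℝ n q OmegaBar)
    (hmn : m + 1 ≤ n) (k : Fin 3) : ContDiffOn ℝ m (pd q k) OmegaBar :=
  (hq.fderivWithin uniqueDiffOn_OmegaBar hmn).clm_apply contDiffOn_const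

lemma hasGrad_pd {q : E3 → ℝ} (hq : ContDiffOn ℝ 1 q OmegaBar) : HasGrad q (pd q) := by
  refine ⟨hq.continuousOn, fun k => (contDiffOn_pd (m := 0) hq (by simp) k).continuousOn,
    fun x hx k => ?_⟩
  have h := ((hq.differentiableOn (by simp)).hasFDerivAt (OmegaBar_mem_nhds hx))
  rw [pd, fderivWithin_of_mem_nhds (OmegaBar_mem_nhds hx)]
  exact HasPartial.of_hasFDerivAt h

lemma fderivWithin_eq_sum_pd (q : E3 → ℝ) (x v : E3) :
    fderivWithin ℝ q OmegaBar x v = ∑ k, v k * pd q k x := by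
  conv_lhs => rw [← sum_smul_single v]
  rw [map_sum]
  exact Finset.sum_congr rfl fun k _ => by rw [map_smul, smul_eq_mul, pd]

lemma pd_comm {q : E3 → ℝ} (hq : ContDiffOn ℝ 2 q OmegaBar) {x : E3} (hx : x ∈ Omega)
    (k l : Fin 3) : pd (pd q k) l x = pd (pd q l) k x := by
  have hC : ContDiffAt ℝ 2 q x := hq.contDiffAt (OmegaBar_mem_nhds hx)
  have key (k l : Fin 3) : pd (pd q k) l x
      = fderiv ℝ (fderiv ℝ q) x (EuclideanSpace.single l 1) (EuclideanSpace.single k 1) := by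
    have h1 : pd q k =ᶠ[nhds x] fun y => fderiv ℝ q y (EuclideanSpace.single k 1) := by
      filter_upwards [isOpen_Omega.mem_nhds hx] with y hy
      rw [pd, fderivWithin_of_mem_nhds (OmegaBar_mem_nhds hy)]
    rw [pd, fderivWithin_of_mem_nhds (OmegaBar_mem_nhds hx), h1.fderiv_eq]
    have h2 : DifferentiableAt ℝ (fderiv ℝ q) x :=
      (hC.fderiv_right (m := 1) (by norm_num)).differentiableAt (by simp)
    rw [fderiv_clm_apply h2 (differentiableAt_const _)]
    simp
  rw [key, key]
  exact (hC.isSymmSndFDerivAt (by simp)) _ _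

/-- `g` and `h` are the first and second partial derivatives of `f` on the exterior domain, all
continuous up to the unit sphere. -/
structure HasHess (f : E3 → ℝ) (g : Fin 3 → E3 → ℝ) (h : Fin 3 → Fin 3 → E3 → ℝ) : Prop where
  grad : HasGrad f g
  hess : ∀ k, HasGrad (g k) (h k)

lemma hasHess_pd {q : E3 → ℝ} (hq : ContDiffOn ℝ 2 q OmegaBar) :
    HasHess q (pd q) (fun k => pd (pd q k)) :=
  ⟨hasGrad_pd (hq.of_le (by norm_num)),
    fun k => hasGrad_pd (contDiffOn_pd hq (by norm_num) k)⟩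

lemma HasHess.sub {f f₂ : E3 → ℝ} {g g₂ : Fin 3 → E3 → ℝ} {h h₂ : Fin 3 → Fin 3 → E3 → ℝ}
    (H : HasHess f g h) (H₂ : HasHess f₂ g₂ h₂) :
    HasHess (fun x => f x - f₂ x) (fun k x => g k x - g₂ k x)
      (fun k l x => h k l x - h₂ k l x) :=
  ⟨H.grad.sub H₂.grad, fun k => (H.hess k).sub (H₂.hess k)⟩

lemma er_of_norm_one {x : E3} (hx : ‖x‖ = 1) : er x = x := by simp [er, hx]

lemma weakAnchor_radial {a b c L W : ℝ} {Q : E3 → Mat3} (hL : 0 < L) (hW : 0 < W)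
    (h : weakAnchor a b c L W Q) {x : E3} (hx : ‖x‖ = 1) (i j : Fin 3) :
    ∑ k, x k * pd (fun y => Q y i j) k x = W / L * (Q x i j - Qsurf a b c x i j) := by
  have h1 := congrFun (congrFun (h x hx) i) j
  simp only [nuDeriv, Matrix.smul_apply, Matrix.of_apply, Matrix.sub_apply, smul_eq_mul,
    er_of_norm_one hx, map_neg, fderivWithin_eq_sum_pd] at h1
  rw [← neg_sub, ← h1]
  field_simp

lemma hasDerivWithinAt_ray {q : E3 → ℝ} (hq : ContDiffOn ℝ 1 q OmegaBar) {x : E3}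
    (hx : ‖x‖ = 1) :
    HasDerivWithinAt (fun t : ℝ => q (t • x)) (∑ k, x k * pd q k x) (Ici 1) 1 := by
  have hm : x ∈ OmegaBar := le_of_eq hx.symm
  have h1 : HasFDerivWithinAt q (fderivWithin ℝ q OmegaBar x) OmegaBar ((1 : ℝ) • x) := by
    rw [one_smul]
    exact (hq.differentiableOn (by simp) x hm).hasFDerivWithinAt
  have h2 : HasDerivWithinAt (fun t : ℝ => t • x) x (Ici 1) 1 := by
    simpa using ((hasDerivAt_id (1 : ℝ)).smul_const x).hasDerivWithinAt
  have h3 := h1.comp_hasDerivWithinAt (1 : ℝ) h2 (fun t ht => ?_)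
  · rwa [fderivWithin_eq_sum_pd] at h3
  · have ht' : (1 : ℝ) ≤ t := ht
    show 1 ≤ ‖t • x‖
    rw [norm_smul, hx, mul_one, Real.norm_eq_abs, abs_of_nonneg (by linarith)]
    exact ht'

lemma OmegaBar_subset_closure : OmegaBar ⊆ closure Omega := by
  intro x hx
  have h1 : Tendsto (fun n : ℕ => (1 + 1 / ((n : ℝ) + 1)) • x) atTop (nhds ((1 + 0 : ℝ) • x)) :=
    (tendsto_const_nhds.add tendsto_one_div_add_atTop_nhds_zero_nat).smul_const x
  rw [add_zero, one_smul] at h1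
  refine mem_closure_of_tendsto h1 (Eventually.of_forall fun n => ?_)
  have hx' : 1 ≤ ‖x‖ := hx
  have h2 : 0 < 1 / ((n : ℝ) + 1) := by positivity
  show 1 < ‖(1 + 1 / ((n : ℝ) + 1)) • x‖
  rw [norm_smul, Real.norm_eq_abs, abs_of_pos (by linarith)]
  nlinarith

lemma HasGrad.unique {f f₂ : E3 → ℝ} {g g₂ : Fin 3 → E3 → ℝ} (h : HasGrad f g)
    (h₂ : HasGrad f₂ g₂) (he : ∀ x ∈ OmegaBar, f x = f₂ x) (k : Fin 3) :
    ∀ x ∈ OmegaBar, g k x = g₂ k x := by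
  have key : EqOn (g k) (g₂ k) Omega := fun x hx => by
    refine HasLineDerivAt.unique (h.partials x hx k) ((h₂.partials x hx k).congr_nhds ?_)
    filter_upwards [OmegaBar_mem_nhds hx] with y hy using he y hy
  exact key.of_subset_closure (h.cont_grad k) (h₂.cont_grad k) Omega_subset_OmegaBar
    OmegaBar_subset_closure

/-- Entrywise gradient of a matrix field. -/
def MatGrad (Q : E3 → Mat3) (D : Fin 3 → E3 → Mat3) : Prop :=
  ∀ i j, HasGrad (fun x => Q x i j) (fun k x => D k x i j)

lemma MatGrad.mul {A B : E3 → Mat3} {A' B' : Fin 3 → E3 → Mat3} (hA : MatGrad A A')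
    (hB : MatGrad B B') :
    MatGrad (fun x => A x * B x) (fun k x => A' k x * B x + A x * B' k x) := by
  intro i j
  simp only [Matrix.mul_apply, Matrix.add_apply, ← Finset.sum_add_distrib]
  exact HasGrad.sum _ fun l _ => (hA i l).mul (hB l j)

lemma MatGrad.trace {A : E3 → Mat3} {A' : Fin 3 → E3 → Mat3} (hA : MatGrad A A') :
    HasGrad (fun x => (A x).trace) (fun k x => (A' k x).trace) := by
  simp only [Matrix.trace, Matrix.diag_apply]
  exact HasGrad.sum _ fun i _ => hA i i

lemma MatGrad.isS0 {Q : E3 → Mat3} {D : Fin 3 → E3 → Mat3} (hQ : MatGrad Q D)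
    (h : ∀ x ∈ OmegaBar, isS0 (Q x)) (k : Fin 3) : ∀ x ∈ OmegaBar, isS0 (D k x) := by
  intro x hx
  refine ⟨Matrix.IsSymm.ext fun i j => ?_, ?_⟩
  · exact (hQ j i).unique (hQ i j) (fun y hy => (h y hy).1.apply i j) k x hx
  · exact hQ.trace.unique (HasGrad.const 0) (fun y hy => (h y hy).2) k x hx

lemma trace_gradf_mul (a b c : ℝ) (Q : Mat3) {D : Mat3} (hD : D.trace = 0) :
    (gradf a b c Q * D).trace
      = -a * (Q * D).trace - b * (Q * Q * D).trace + c * mnormSq Q * (Q * D).trace := by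
  simp [gradf, Matrix.add_mul, Matrix.sub_mul, hD]

lemma trace_mul_eq_sum {A B : Mat3} (hB : B.IsSymm) :
    (A * B).trace = ∑ i, ∑ j, A i j * B i j := by
  simp only [Matrix.trace, Matrix.diag_apply, Matrix.mul_apply]
  exact Finset.sum_congr rfl fun i _ => Finset.sum_congr rfl fun j _ => by rw [hB.apply i j]

lemma hasGrad_gpot {Q : E3 → Mat3} {D : Fin 3 → E3 → Mat3} (a b c : ℝ) (hQ : MatGrad Q D)
    (h : ∀ x ∈ OmegaBar, isS0 (Q x)) :
    HasGrad (fun x => gpot a b c (Q x))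
      (fun k x => ∑ i, ∑ j, gradf a b c (Q x) i j * D k x i j) := by
  have h2 := (hQ.mul hQ).trace
  have h3 := ((hQ.mul hQ).mul hQ).trace
  have H := (((h2.const_mul (-(a / 2))).sub (h3.const_mul (b / 3))).add
    ((h2.mul h2).const_mul (c / 4))).congr_grad
    (g' := fun k x => ∑ i, ∑ j, gradf a b c (Q x) i j * D k x i j) ?_
  rotate_left
  · intro k x hx
    have hD := hQ.isS0 h k x hx
    rw [← trace_mul_eq_sum hD.1, trace_gradf_mul _ _ _ _ hD.2]
    have e1 : (D k x * Q x).trace = (Q x * D k x).trace := Matrix.trace_mul_comm _ _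
    have e2 : (D k x * Q x * Q x).trace = (Q x * Q x * D k x).trace := by
      rw [Matrix.mul_assoc, Matrix.trace_mul_comm]
    have e3 : (Q x * D k x * Q x).trace = (Q x * Q x * D k x).trace := by
      rw [Matrix.trace_mul_comm, Matrix.mul_assoc]
    simp only [Matrix.trace_add, Matrix.add_mul, e1, e2, e3, mnormSq]
    ring
  · simpa only [gpot, pow_two] using H

/-- Sum of the squares of the entries. -/
def frobSq (A : Mat3) : ℝ := ∑ i, ∑ j, A i j ^ 2

lemma frobSq_nonneg (A : Mat3) : 0 ≤ frobSq A :=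
  Finset.sum_nonneg fun _ _ => Finset.sum_nonneg fun _ _ => sq_nonneg _

lemma mnormSq_eq_frobSq {A : Mat3} (hA : A.IsSymm) : mnormSq A = frobSq A := by
  rw [mnormSq, trace_mul_eq_sum hA]
  simp only [frobSq, pow_two]

lemma trace_mul_sq_le (A B : Mat3) : (A * B).trace ^ 2 ≤ frobSq A * frobSq B := by
  have h := Finset.sum_mul_sq_le_sq_mul_sq (Finset.univ : Finset (Fin 3 × Fin 3))
    (fun p => A p.1 p.2) (fun p => B p.2 p.1)
  simp only [Fintype.sum_prod_type] at h
  rw [Finset.sum_comm (f := fun i j => B j i ^ 2)] at h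
  simpa only [Matrix.trace, Matrix.diag_apply, Matrix.mul_apply, frobSq] using h

lemma frobSq_mul_le (A B : Mat3) : frobSq (A * B) ≤ frobSq A * frobSq B := by
  have h (i j : Fin 3) : (A * B) i j ^ 2 ≤ (∑ l, A i l ^ 2) * ∑ l, B l j ^ 2 := by
    rw [Matrix.mul_apply]
    exact Finset.sum_mul_sq_le_sq_mul_sq _ _ _
  calc frobSq (A * B) ≤ ∑ i, ∑ j, (∑ l, A i l ^ 2) * ∑ l, B l j ^ 2 :=
        Finset.sum_le_sum fun i _ => Finset.sum_le_sum fun j _ => h i j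
    _ = frobSq A * frobSq B := by
        rw [frobSq, frobSq, Finset.sum_comm (f := fun i j => B i j ^ 2), Finset.sum_mul_sum]

lemma abs_trace_mul_le (A B : Mat3) : |(A * B).trace| ≤ √(frobSq A) * √(frobSq B) := by
  rw [← Real.sqrt_mul (frobSq_nonneg A)]
  exact Real.abs_le_sqrt (trace_mul_sq_le A B)

lemma sqrt_frobSq_mul_le (A B : Mat3) : √(frobSq (A * B)) ≤ √(frobSq A) * √(frobSq B) := by
  rw [← Real.sqrt_mul (frobSq_nonneg A)]
  exact Real.sqrt_le_sqrt (frobSq_mul_le A B)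

/-- Uniform second-order Taylor bound for the potential on bounded sets. -/
lemma exists_gpot_add_le (a b c M M' : ℝ) (ha : 0 ≤ a) (hb : 0 < b) (hc : 0 < c) (hM : 0 ≤ M)
    (hM' : 0 ≤ M') :
    ∃ K > 0, ∀ Q H : Mat3, isS0 Q → isS0 H → frobSq Q ≤ M ^ 2 → frobSq H ≤ M' ^ 2 →
      gpot a b c (Q + H) ≤ gpot a b c Q + (gradf a b c Q * H).trace + K * frobSq H := by
  refine ⟨b * (M + M') + c * (M ^ 2 + M ^ 2 + M * M' + M' ^ 2) + 1, by positivity,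
    fun Q H hQ hH hQM hHM => ?_⟩
  set X := √(frobSq Q) with hX
  set Y := √(frobSq H) with hY
  have hX0 : 0 ≤ X := Real.sqrt_nonneg _
  have hY0 : 0 ≤ Y := Real.sqrt_nonneg _
  have hX2 : frobSq Q = X ^ 2 := (Real.sq_sqrt (frobSq_nonneg Q)).symm
  have hY2 : frobSq H = Y ^ 2 := (Real.sq_sqrt (frobSq_nonneg H)).symm
  have hXM : X ≤ M := by rw [hX2] at hQM; nlinarith
  have hYM : Y ≤ M' := by rw [hY2] at hHM; nlinarith
  have t1 : |(Q * H).trace| ≤ X * Y := abs_trace_mul_le Q H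
  have t2 : |(Q * (H * H)).trace| ≤ X * Y ^ 2 := by
    refine (abs_trace_mul_le _ _).trans (mul_le_mul_of_nonneg_left ?_ hX0)
    rw [pow_two]; exact sqrt_frobSq_mul_le H H
  have t3 : |(H * (H * H)).trace| ≤ Y * Y ^ 2 := by
    refine (abs_trace_mul_le _ _).trans (mul_le_mul_of_nonneg_left ?_ hY0)
    rw [pow_two]; exact sqrt_frobSq_mul_le H H
  have hTQ : (Q * Q).trace = X ^ 2 := by rw [← hX2, ← mnormSq_eq_frobSq hQ.1, mnormSq]
  have hTH : (H * H).trace = Y ^ 2 := by rw [← hY2, ← mnormSq_eq_frobSq hH.1, mnormSq]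
  rw [trace_gradf_mul _ _ _ _ hH.2]
  have e1 : (H * Q).trace = (Q * H).trace := Matrix.trace_mul_comm _ _
  have e2 : (H * Q * Q).trace = (Q * Q * H).trace := by
    rw [Matrix.mul_assoc, Matrix.trace_mul_comm]
  have e3 : (Q * H * Q).trace = (Q * Q * H).trace := by
    rw [Matrix.trace_mul_comm, Matrix.mul_assoc]
  have e4 : (H * H * Q).trace = (Q * (H * H)).trace := Matrix.trace_mul_comm _ _
  have e5 : (H * Q * H).trace = (Q * (H * H)).trace := by
    rw [Matrix.trace_mul_comm, ← Matrix.mul_assoc, e4]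
  have e6 : (Q * H * H).trace = (Q * (H * H)).trace := by rw [Matrix.mul_assoc]
  have e7 : (H * H * H).trace = (H * (H * H)).trace := by rw [Matrix.mul_assoc]
  have s1 : ((Q + H) * (Q + H)).trace = X ^ 2 + 2 * (Q * H).trace + Y ^ 2 := by
    simp only [Matrix.add_mul, Matrix.mul_add, Matrix.trace_add, e1, hTQ, hTH]; ring
  have s2 : ((Q + H) * (Q + H) * (Q + H)).trace = (Q * Q * Q).trace + 3 * (Q * Q * H).trace
      + 3 * (Q * (H * H)).trace + (H * (H * H)).trace := by
    simp only [Matrix.add_mul, Matrix.mul_add, Matrix.trace_add, e2, e3, e4, e5, e6, e7]; ring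
  simp only [gpot, s1, s2, hTQ, mnormSq]
  rw [hY2]
  set p := (Q * H).trace
  set q := (Q * (H * H)).trace
  set r := (H * (H * H)).trace
  have b1 : b * -q ≤ b * (M * Y ^ 2) := mul_le_mul_of_nonneg_left
    ((neg_le_abs q).trans (t2.trans (mul_le_mul_of_nonneg_right hXM (sq_nonneg Y)))) hb.le
  have b2 : b * -r ≤ b * (M' * Y ^ 2) := mul_le_mul_of_nonneg_left
    ((neg_le_abs r).trans (t3.trans (mul_le_mul_of_nonneg_right hYM (sq_nonneg Y)))) hb.le
  have b2' : 0 ≤ b * (M' * Y ^ 2) := by positivity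
  have b3 : p ^ 2 ≤ M ^ 2 * Y ^ 2 := by
    rw [← sq_abs p, ← mul_pow]
    have : X * Y ≤ M * Y := mul_le_mul_of_nonneg_right hXM hY0
    exact pow_le_pow_left₀ (abs_nonneg _) (t1.trans this) 2
  have b4 : p * Y ^ 2 ≤ M * M' * Y ^ 2 := by
    have h1 : p ≤ M * M' := (le_abs_self p).trans
      (t1.trans (mul_le_mul hXM hYM hY0 hM))
    exact mul_le_mul_of_nonneg_right h1 (sq_nonneg _)
  have b5 : X ^ 2 * Y ^ 2 ≤ M ^ 2 * Y ^ 2 :=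
    mul_le_mul_of_nonneg_right (pow_le_pow_left₀ hX0 hXM 2) (sq_nonneg _)
  have b6 : Y ^ 2 * Y ^ 2 ≤ M' ^ 2 * Y ^ 2 :=
    mul_le_mul_of_nonneg_right (pow_le_pow_left₀ hY0 hYM 2) (sq_nonneg _)
  have b7 : 0 ≤ a * Y ^ 2 := by positivity
  have c3 := mul_le_mul_of_nonneg_left b3 hc.le
  have c4 := mul_le_mul_of_nonneg_left b4 hc.le
  have c5 := mul_le_mul_of_nonneg_left b5 hc.le
  have c6 := mul_le_mul_of_nonneg_left b6 hc.le
  have c8 : 0 ≤ c * (M' ^ 2 * Y ^ 2) := by positivity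
  have c9 : 0 ≤ c * (M ^ 2 * Y ^ 2) := by positivity
  have c10 := sq_nonneg Y
  linarith

lemma exists_trace_eq_eigenvalues {Q : Mat3} (hQ : Q.IsSymm) :
    ∃ l : Fin 3 → ℝ, Q.trace = ∑ i, l i ∧ (Q * Q).trace = ∑ i, l i ^ 2 ∧
      (Q * Q * Q).trace = ∑ i, l i ^ 3 := by
  have hH : Q.IsHermitian := by
    rw [Matrix.IsHermitian, Matrix.conjTranspose_eq_transpose_of_trivial]; exact hQ
  set U : Mat3 := hH.eigenvectorUnitary.1 with hU
  set D : Mat3 := Matrix.diagonal hH.eigenvalues with hD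
  have hUU : star U * U = 1 := Unitary.coe_star_mul_self hH.eigenvectorUnitary
  have hs : Q = U * D * star U := by
    have h := hH.spectral_theorem
    simpa [Unitary.conjStarAlgAut_apply, ← hU, ← hD, Function.comp_def] using h
  have h2 : Q * Q = U * (D * D) * star U := by
    calc Q * Q = U * D * (star U * U) * D * star U := by rw [hs]; simp only [Matrix.mul_assoc]
      _ = _ := by rw [hUU]; simp only [Matrix.mul_assoc, Matrix.mul_one]
  have h3 : Q * Q * Q = U * (D * D * D) * star U := by
    calc Q * Q * Q = U * (D * D) * (star U * U) * D * star U := by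
          rw [h2]; conv_lhs => rw [hs]
          simp only [Matrix.mul_assoc]
      _ = _ := by rw [hUU]; simp only [Matrix.mul_assoc, Matrix.mul_one]
  have ht (A : Mat3) : (U * A * star U).trace = A.trace := by
    rw [Matrix.trace_mul_comm, ← Matrix.mul_assoc, hUU, Matrix.one_mul]
  refine ⟨hH.eigenvalues, ?_, ?_, ?_⟩
  · rw [congrArg Matrix.trace hs, ht, hD, Matrix.trace_diagonal]
  · rw [h2, ht, hD, Matrix.diagonal_mul_diagonal, Matrix.trace_diagonal]
    simp only [pow_two]
  · rw [h3, ht, hD, Matrix.diagonal_mul_diagonal, Matrix.diagonal_mul_diagonal,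
      Matrix.trace_diagonal]
    simp only [pow_succ, pow_zero, one_mul]

lemma six_trace_cube_sq_le {Q : Mat3} (hQ : isS0 Q) :
    6 * (Q * Q * Q).trace ^ 2 ≤ (Q * Q).trace ^ 3 := by
  obtain ⟨l, h1, h2, h3⟩ := exists_trace_eq_eigenvalues hQ.1
  rw [hQ.2, Fin.sum_univ_three] at h1
  rw [h2, h3, Fin.sum_univ_three, Fin.sum_univ_three]
  have : l 2 = -l 0 - l 1 := by linarith
  rw [this]
  have := sq_nonneg ((l 0 - l 1) * (2 * l 0 + l 1) * (l 0 + 2 * l 1))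
  nlinarith

section

variable {a b c : ℝ}

lemma sstar_pos (ha : 0 ≤ a) (hb : 0 < b) (hc : 0 < c) : 0 < sstar a b c := by
  unfold sstar; positivity

lemma sstar_eq (ha : 0 ≤ a) (hc : 0 < c) :
    2 * c * sstar a b c ^ 2 = b * sstar a b c + 3 * a := by
  have h := Real.sq_sqrt (show 0 ≤ b ^ 2 + 24 * a * c by positivity)
  unfold sstar
  set y := √(b ^ 2 + 24 * a * c)
  field_simp
  linear_combination 2 * h

lemma outer_apply (u v : E3) (i j : Fin 3) : outer u v i j = u i * v j := rfl

lemma isS0_smul {Q : Mat3} (r : ℝ) (h : isS0 Q) : isS0 (r • Q) :=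
  ⟨h.1.smul r, by rw [Matrix.trace_smul, h.2, smul_zero]⟩

lemma isS0_add {Q P : Mat3} (h : isS0 Q) (h' : isS0 P) : isS0 (Q + P) :=
  ⟨h.1.add h'.1, by rw [Matrix.trace_add, h.2, h'.2, add_zero]⟩

lemma isS0_sub {Q P : Mat3} (h : isS0 Q) (h' : isS0 P) : isS0 (Q - P) :=
  ⟨h.1.sub h'.1, by rw [Matrix.trace_sub, h.2, h'.2, sub_zero]⟩

lemma isS0_outer {u : E3} (hu : ‖u‖ = 1) : isS0 (outer u u - (1 / 3 : ℝ) • (1 : Mat3)) := by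
  constructor
  · refine Matrix.IsSymm.sub (Matrix.IsSymm.ext fun i j => ?_) (Matrix.isSymm_one.smul _)
    rw [outer_apply, outer_apply, mul_comm]
  · have h := norm_sq_eq_sum u
    rw [hu] at h
    simp [Matrix.trace_fin_three, outer_apply]
    linarith

lemma norm_ez : ‖ez‖ = 1 := by simp [ez]

lemma isS0_Qinf : isS0 (Qinf a b c) := isS0_smul _ (isS0_outer norm_ez)

lemma frobSq_smul_outer {u : E3} (hu : ‖u‖ = 1) (r : ℝ) :
    frobSq (r • (outer u u - (1 / 3 : ℝ) • (1 : Mat3))) = 2 / 3 * r ^ 2 := by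
  have h := norm_sq_eq_sum u
  rw [hu] at h
  simp [frobSq, Fin.sum_univ_three, outer_apply]
  have h2 : u 2 ^ 2 = 1 - u 0 ^ 2 - u 1 ^ 2 := by linarith
  have h4 : u 2 ^ 4 = (1 - u 0 ^ 2 - u 1 ^ 2) ^ 2 := by rw [← h2]; ring
  ring_nf
  rw [h4, h2]
  ring

lemma gpot_Qinf : gpot a b c (Qinf a b c) = -a * sstar a b c ^ 2 / 3
    - 2 * b * sstar a b c ^ 3 / 27 + c * sstar a b c ^ 4 / 9 := by
  simp [gpot, Qinf, Matrix.trace_fin_three, Matrix.mul_apply, Fin.sum_univ_three, outer_apply, ez]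
  ring

/-- The constant state minimises the bulk potential. -/
lemma gpot_Qinf_le (ha : 0 ≤ a) (hb : 0 < b) (hc : 0 < c) {Q : Mat3} (hQ : isS0 Q) :
    gpot a b c (Qinf a b c) ≤ gpot a b c Q := by
  have h6 := six_trace_cube_sq_le hQ
  have hT : 0 ≤ (Q * Q).trace := by
    have := mnormSq_eq_frobSq hQ.1
    rw [mnormSq] at this
    rw [this]; exact frobSq_nonneg Q
  rw [gpot_Qinf, gpot]
  set T := (Q * Q).trace
  set t := √(3 / 2 * T)
  have ht : 0 ≤ t := Real.sqrt_nonneg _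
  have hTt : T = 2 / 3 * t ^ 2 := by
    rw [Real.sq_sqrt (by positivity)]; ring
  have h3 : (Q * Q * Q).trace ≤ 2 / 9 * t ^ 3 := by
    refine le_of_abs_le (abs_le_of_sq_le_sq ?_ (by positivity))
    rw [hTt] at h6
    nlinarith
  set s := sstar a b c
  have hs : 0 < s := sstar_pos ha hb hc
  have hs2 : 2 * c * s ^ 2 = b * s + 3 * a := sstar_eq ha hc
  have hbs : b ≤ 2 * c * s := by
    by_contra! hlt
    nlinarith
  have key : 0 ≤ 3 * c * (t + s) ^ 2 - b * (2 * t + s) := by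
    have h1 : 0 ≤ 2 * s * (3 * c * (t + s) ^ 2 - b * (2 * t + s)) := by
      have : 0 ≤ (2 * c * s - b) * (3 * (t + s) ^ 2) := by
        apply mul_nonneg <;> [linarith; positivity]
      have : 0 ≤ b * (3 * t ^ 2 + 2 * t * s + s ^ 2) := by positivity
      nlinarith
    exact nonneg_of_mul_nonneg_right h1 (by positivity)
  have h9 := mul_nonneg (sq_nonneg (t - s)) key
  have e : a = (2 * c * s ^ 2 - b * s) / 3 := by linarith
  have h10 := mul_le_mul_of_nonneg_left h3 hb.le
  rw [hTt]
  have : -(a / 2) * (2 / 3 * t ^ 2) - b / 3 * (2 / 9 * t ^ 3) + c / 4 * (2 / 3 * t ^ 2) ^ 2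
      - (-a * s ^ 2 / 3 - 2 * b * s ^ 3 / 27 + c * s ^ 4 / 9)
      = ((t - s) ^ 2 * (3 * c * (t + s) ^ 2 - b * (2 * t + s))) / 27 := by
    rw [e]; ring
  linarith

lemma gradf_Qinf (ha : 0 ≤ a) (hc : 0 < c) : gradf a b c (Qinf a b c) = 0 := by
  have hs2 := sstar_eq (b := b) ha hc
  ext i j
  fin_cases i <;> fin_cases j <;>
    simp [gradf, Qinf, mnormSq, Matrix.trace_fin_three, Matrix.mul_apply, Fin.sum_univ_three,
      outer_apply, ez, Matrix.one_apply]
  all_goals generalize sstar a b c = s at hs2 ⊢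
  · linear_combination (-s / 9) * hs2
  · linear_combination (-s / 9) * hs2
  · linear_combination (2 * s / 9) * hs2

end

lemma second_partial_nonpos_of_isLocalMax {f g : E3 → ℝ} {d : ℝ} {x : E3} {k : Fin 3}
    (hmax : IsLocalMax f x) (hf : ∀ᶠ y in nhds x, HasPartial f (g y) y k)
    (hg : HasPartial g d x k) : d ≤ 0 := by
  by_contra! hd
  set F : ℝ → ℝ := fun t => f (x + t • EuclideanSpace.single k 1) with hF
  set G : ℝ → ℝ := fun t => g (x + t • EuclideanSpace.single k 1) with hG
  have hline : Tendsto (fun t : ℝ => x + t • (EuclideanSpace.single k 1 : E3)) (nhds 0)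
      (nhds x) := by
    have h : Continuous fun t : ℝ => x + t • (EuclideanSpace.single k 1 : E3) := by fun_prop
    simpa using h.tendsto 0
  have hFG : ∀ᶠ t in nhds (0 : ℝ), HasDerivAt F (G t) t := by
    filter_upwards [hline.eventually hf] with t ht using ht.hasDerivAt_line
  have hdF : deriv F =ᶠ[nhds 0] G := hFG.mono fun t ht => ht.deriv
  have hG' : HasDerivAt G d 0 := hg
  have hdd : deriv (deriv F) 0 = d := by rw [hdF.deriv_eq, hG'.deriv]
  have hFmax : IsLocalMax F 0 := by
    have : ∀ᶠ t in nhds (0 : ℝ), f (x + t • EuclideanSpace.single k 1) ≤ f x :=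
      hline.eventually hmax
    filter_upwards [this] with t ht
    simpa [hF] using ht
  have hFmin : IsLocalMin F 0 := isLocalMin_of_deriv_deriv_pos (by rwa [hdd])
    hFmax.deriv_eq_zero hFG.self_of_nhds.continuousAt
  have hconst : F =ᶠ[nhds 0] fun _ => F 0 := by
    filter_upwards [hFmax, hFmin] with t h1 h2 using le_antisymm h1 h2
  have h0 : deriv F =ᶠ[nhds 0] fun _ => 0 := by
    have h := hconst.deriv
    simpa only [deriv_const'] using h
  rw [h0.deriv_eq, deriv_const] at hdd
  exact hd.ne hdd

lemma exists_gt_of_hasDerivWithinAt_pos {F : ℝ → ℝ} {d a b : ℝ} (hab : a < b)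
    (h : HasDerivWithinAt F d (Ici a) a) (hd : 0 < d) : ∃ t ∈ Ioo a b, F a < F t := by
  have h1 := hasDerivWithinAt_iff_tendsto_slope.1 h
  rw [Ici_sdiff_left] at h1
  have h2 := (h1.eventually (lt_mem_nhds hd)).and (Ioo_mem_nhdsGT hab)
  obtain ⟨t, ht, htab⟩ := h2.exists
  refine ⟨t, htab, ?_⟩
  rw [slope_def_field] at ht
  have : 0 < t - a := by linarith [htab.1]
  have := (div_pos_iff_of_pos_right this).1 ht
  linarith

lemma hasPartial_radial {m : ℝ → ℝ} {d : ℝ} {x : E3} (h : HasDerivAt m d (‖x‖ ^ 2)) (k : Fin 3) :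
    HasPartial (fun y => m (‖y‖ ^ 2)) (2 * x k * d) x k :=
  (HasPartial.comp h (hasPartial_norm_sq x k)).congr_deriv (by ring)

lemma hasDerivAt_inv_pow (A : ℝ) (n : ℕ) {s : ℝ} (h : s < A) :
    HasDerivAt (fun z : ℝ => ((A - z) ^ n)⁻¹) (n * ((A - s) ^ (n + 1))⁻¹) s := by
  have h0 : A - s ≠ 0 := by linarith
  have h1 := (((hasDerivAt_id s).const_sub A).pow n).inv (pow_ne_zero n h0)
  refine h1.congr_deriv ?_
  rcases n with _ | n
  · simp
  · simp only [Nat.add_sub_cancel, id, Pi.pow_apply]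
    field_simp
    ring

/-- A priori bound for functions satisfying a superlinear differential inequality in the exterior
domain, with an outward condition on the unit sphere. -/
lemma le_of_lap_ge_sq {v : E3 → ℝ} {m κ σ : ℝ} (hv : ContDiffOn ℝ 2 v OmegaBar) (hm : 0 < m)
    (hκ : 0 < κ) (hσ : 0 < σ) (hInt : ∀ x ∈ Omega, m < v x → κ * v x ^ 2 ≤ lap3 v x)
    (hbd : ∀ x : E3, ‖x‖ = 1 → m < v x → σ ≤ ∑ k, x k * pd v k x) :
    ∀ x ∈ OmegaBar, v x ≤ m := by
  intro x1 hx1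
  by_contra! hvx
  set B : ℝ → ℝ := fun A => 24 / κ * A with hB
  -- choose the squared radius of the ball carrying the barrier
  obtain ⟨A, hA1, hA2, hA3, hA4⟩ : ∃ A : ℝ, 1 < A ∧ ‖x1‖ ^ 2 < A ∧
      B A * ((A - ‖x1‖ ^ 2) ^ 2)⁻¹ < v x1 - m ∧ B A * (4 * ((A - 1) ^ 3)⁻¹) < σ := by
    have hlim (r : ℝ) : Tendsto (fun A : ℝ => A * ((A - r) ^ 2)⁻¹) atTop (nhds 0) := by
      have h1 : Tendsto (fun A : ℝ => (A - r)) atTop atTop :=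
        tendsto_atTop_add_const_right _ _ tendsto_id
      have h2 : Tendsto (fun y : ℝ => y⁻¹ + r * (y⁻¹) ^ 2) atTop (nhds (0 + r * 0 ^ 2)) :=
        tendsto_inv_atTop_zero.add ((tendsto_inv_atTop_zero.pow 2).const_mul r)
      have h3 := h2.comp h1
      simp only [ne_eq, OfNat.ofNat_ne_zero, not_false_eq_true, zero_pow, mul_zero, add_zero] at h3
      refine h3.congr' ?_
      filter_upwards [eventually_gt_atTop r] with A hA
      have : A - r ≠ 0 := by linarith
      simp only [Function.comp]
      field_simp
      ring
    have e1 := ((hlim (‖x1‖ ^ 2)).const_mul (24 / κ)).eventually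
      (gt_mem_nhds (by rw [mul_zero]; linarith : 24 / κ * 0 < v x1 - m))
    have e2 := ((hlim 1).const_mul (24 / κ * 4)).eventually
      (gt_mem_nhds (by rw [mul_zero]; linarith : 24 / κ * 4 * 0 < σ))
    obtain ⟨A, h1, h2, h3, h4⟩ := (e1.and (e2.and ((eventually_gt_atTop 2).and
      (eventually_gt_atTop (‖x1‖ ^ 2))))).exists
    refine ⟨A, by linarith, h4, by rw [hB]; linarith, lt_of_le_of_lt ?_ h2⟩
    have h5 : ((A - 1) ^ 3)⁻¹ ≤ ((A - 1) ^ 2)⁻¹ := by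
      apply inv_anti₀ (by nlinarith)
      exact pow_le_pow_right₀ (by linarith) (by norm_num)
    have h6 : 0 ≤ 24 / κ * 4 * A := by positivity
    have := mul_le_mul_of_nonneg_left h5 h6
    simp only [hB]
    linarith
  have hA0 : 0 < A := by linarith
  have hBpos : 0 < B A := by simp only [hB]; positivity
  -- a slightly smaller ball
  have hcomp (A' : ℝ) : IsCompact {x : E3 | 1 ≤ ‖x‖ ∧ ‖x‖ ^ 2 ≤ A'} := by
    refine (isCompact_closedBall (0 : E3) (√A')).of_isClosed_subset ?_ fun x hx => ?_
    · exact (isClosed_le continuous_const continuous_norm).inter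
        (isClosed_le (continuous_norm.pow 2) continuous_const)
    · rw [mem_closedBall_zero_iff]
      exact Real.le_sqrt_of_sq_le hx.2
  obtain ⟨N, hN⟩ := (hcomp A).bddAbove_image (f := v) (hv.continuousOn.mono fun x hx => hx.1)
  have hN' (x : E3) (h1 : 1 ≤ ‖x‖) (h2 : ‖x‖ ^ 2 ≤ A) : v x ≤ N := hN ⟨x, ⟨h1, h2⟩, rfl⟩
  obtain ⟨η, hη0, hη1, hη2⟩ : ∃ η > 0, η < A - ‖x1‖ ^ 2 ∧ N ≤ m + B A * (η ^ 2)⁻¹ := by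
    have h1 : Tendsto (fun η : ℝ => m + B A * (η ^ 2)⁻¹) (nhdsWithin 0 (Ioi 0)) atTop := by
      refine tendsto_atTop_add_const_left _ _ (Tendsto.const_mul_atTop hBpos ?_)
      have := (tendsto_pow_atTop (two_ne_zero)).comp (tendsto_inv_nhdsGT_zero (𝕜 := ℝ))
      simpa [Function.comp_def] using this
    obtain ⟨η, h2, h3⟩ := ((h1.eventually_ge_atTop N).and
      (Ioo_mem_nhdsGT (show 0 < A - ‖x1‖ ^ 2 by linarith))).exists
    exact ⟨η, h3.1, h3.2, h2⟩
  set U : ℝ → ℝ := fun s => m + B A * ((A - s) ^ 2)⁻¹ with hU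
  have hUcont : ContinuousOn (fun x : E3 => v x - U (‖x‖ ^ 2)) {x | 1 ≤ ‖x‖ ∧ ‖x‖ ^ 2 ≤ A - η} := by
    refine (hv.continuousOn.mono fun x hx => hx.1).sub ?_
    simp only [hU]
    refine continuousOn_const.add (continuousOn_const.mul (ContinuousOn.inv₀ (by fun_prop) ?_))
    intro x hx
    have := hx.2
    exact pow_ne_zero _ (by linarith)
  have hx1K : x1 ∈ {x : E3 | 1 ≤ ‖x‖ ∧ ‖x‖ ^ 2 ≤ A - η} := ⟨hx1, by linarith⟩
  obtain ⟨z, ⟨hz1, hzA⟩, hzmax⟩ := (hcomp (A - η)).exists_isMaxOn ⟨x1, hx1K⟩ hUcont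
  have hzpos : U (‖z‖ ^ 2) < v z := by
    have h1 : v x1 - U (‖x1‖ ^ 2) ≤ v z - U (‖z‖ ^ 2) := hzmax hx1K
    simp only [hU] at h1 ⊢
    linarith
  have hzm : m < v z := by
    refine lt_trans ?_ hzpos
    simp only [hU]
    have : 0 < (A - ‖z‖ ^ 2) ^ 2 := by have : 0 < A - ‖z‖ ^ 2 := by linarith
                                       positivity
    have := mul_pos hBpos (inv_pos.2 this)
    linarith
  have hzA' : ‖z‖ ^ 2 < A - η := by
    refine lt_of_le_of_ne hzA fun he => ?_
    have h1 := hN' z hz1 (by linarith)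
    simp only [hU, he, sub_sub_cancel] at hzpos
    linarith
  rcases eq_or_lt_of_le hz1 with hz | hz
  · -- boundary maximum
    have h1 := hasDerivWithinAt_ray (hv.of_le (by norm_num)) hz.symm
    have h2 : HasDerivAt (fun t : ℝ => U (t ^ 2)) (B A * (4 * ((A - 1) ^ 3)⁻¹)) 1 := by
      have h3 : HasDerivAt (fun t : ℝ => t ^ 2) 2 1 := by simpa using hasDerivAt_pow 2 (1 : ℝ)
      have h4 := hasDerivAt_inv_pow A 2 (s := (1 : ℝ) ^ 2) (by linarith)
      have h5 := ((h4.const_mul (B A)).const_add m).comp (h₂ := U) (h := fun t : ℝ => t ^ 2)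
        (1 : ℝ) h3
      refine h5.congr_deriv ?_
      norm_num
      ring
    have h3 := h1.sub h2.hasDerivWithinAt
    have h4 := hbd z hz.symm hzm
    obtain ⟨t, ht, hlt⟩ := exists_gt_of_hasDerivWithinAt_pos
      (b := √(A - η)) (Real.lt_sqrt_of_sq_lt (by rw [← hz] at hzA'; exact hzA'))
      h3 (by linarith)
    have ht0 : 0 < t := by linarith [ht.1]
    have htn : ‖t • z‖ = t := by
      rw [norm_smul, ← hz, mul_one, Real.norm_eq_abs, abs_of_pos ht0]
    have ht2 : t ^ 2 ≤ A - η := by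
      have h6 := ht.2
      rw [Real.lt_sqrt ht0.le] at h6
      exact h6.le
    have h5 : v (t • z) - U (‖t • z‖ ^ 2) ≤ v z - U (‖z‖ ^ 2) :=
      hzmax ⟨by rw [htn]; exact ht.1.le, by rw [htn]; exact ht2⟩
    rw [htn, ← hz] at h5
    simp only [Pi.sub_apply, one_smul] at hlt
    linarith
  · -- interior maximum
    have hzΩ : z ∈ Omega := hz
    set O : Set E3 := {x | 1 < ‖x‖ ∧ ‖x‖ ^ 2 < A - η}
    have hO : O ∈ nhds z := IsOpen.mem_nhds
      ((isOpen_lt continuous_const continuous_norm).inter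
        (isOpen_lt (continuous_norm.pow 2) continuous_const)) ⟨hz, hzA'⟩
    have hloc : IsLocalMax (fun x : E3 => v x - U (‖x‖ ^ 2)) z := by
      filter_upwards [hO] with y hy using hzmax ⟨hy.1.le, hy.2.le⟩
    have hH := hasHess_pd hv
    have hU1 (s : ℝ) (hs : s < A) : HasDerivAt U (B A * (2 * ((A - s) ^ 3)⁻¹)) s := by
      have := ((hasDerivAt_inv_pow A 2 hs).const_mul (B A)).const_add m
      exact this.congr_deriv (by norm_num)
    have hU2 (s : ℝ) (hs : s < A) : HasDerivAt (fun s => B A * (2 * ((A - s) ^ 3)⁻¹))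
        (B A * (6 * ((A - s) ^ 4)⁻¹)) s := by
      have := ((hasDerivAt_inv_pow A 3 hs).const_mul 2).const_mul (B A)
      exact this.congr_deriv (by push_cast; ring)
    have hk (k : Fin 3) : pd (pd v k) k z ≤ 2 * (B A * (2 * ((A - ‖z‖ ^ 2) ^ 3)⁻¹))
        + 2 * z k * (2 * z k * (B A * (6 * ((A - ‖z‖ ^ 2) ^ 4)⁻¹))) := by
      have h1 := second_partial_nonpos_of_isLocalMax (k := k)
        (g := fun y => pd v k y - 2 * y k * (B A * (2 * ((A - ‖y‖ ^ 2) ^ 3)⁻¹)))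
        hloc ?_ (((hH.hess k).partials z hzΩ k).sub
          (((HasPartial.const 2).mul (HasPartial.coord k)).mul
            (hasPartial_radial (hU2 (‖z‖ ^ 2) (by linarith)) k)))
      · simp only [if_true] at h1
        linarith
      · filter_upwards [hO] with y hy
        exact (hH.grad.partials y hy.1 k).sub
          (hasPartial_radial (hU1 (‖y‖ ^ 2) (by linarith [hy.2])) k)
    have hsum : lap3 v z ≤ B A * (24 * A * ((A - ‖z‖ ^ 2) ^ 4)⁻¹) := by
      have h1 : lap3 v z ≤ _ := Finset.sum_le_sum fun k _ => hk k
      refine h1.trans ?_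
      have h2 : 0 < A - ‖z‖ ^ 2 := by linarith
      have h3 : ((A - ‖z‖ ^ 2) ^ 3)⁻¹ = (A - ‖z‖ ^ 2) * ((A - ‖z‖ ^ 2) ^ 4)⁻¹ := by
        field_simp
      have h4 := norm_sq_eq_sum z
      have h5 : 0 ≤ B A * ((A - ‖z‖ ^ 2) ^ 4)⁻¹ := by positivity
      rw [Fin.sum_univ_three, h3]
      generalize ((A - ‖z‖ ^ 2) ^ 4)⁻¹ = y at h5 ⊢
      rw [h4] at h2 ⊢
      nlinarith [mul_nonneg h5 h2.le]
    have h1 := hInt z hzΩ hzm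
    have h2 : B A * (24 * A * ((A - ‖z‖ ^ 2) ^ 4)⁻¹)
        = κ * (B A * ((A - ‖z‖ ^ 2) ^ 2)⁻¹) ^ 2 := by
      have : A - ‖z‖ ^ 2 ≠ 0 := by linarith
      simp only [hB]
      field_simp
    have h3 : 0 ≤ B A * ((A - ‖z‖ ^ 2) ^ 2)⁻¹ := by positivity
    have h4 : B A * ((A - ‖z‖ ^ 2) ^ 2)⁻¹ < v z := by
      simp only [hU] at hzpos
      linarith
    have h5 : (B A * ((A - ‖z‖ ^ 2) ^ 2)⁻¹) ^ 2 < v z ^ 2 := pow_lt_pow_left₀ h4 h3 two_ne_zero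
    nlinarith

section

variable {f f₂ : E3 → ℝ} {g g₂ : Fin 3 → E3 → ℝ} {h h₂ : Fin 3 → Fin 3 → E3 → ℝ}

lemma HasHess.mul (H : HasHess f g h) (H₂ : HasHess f₂ g₂ h₂) :
    HasHess (fun x => f x * f₂ x) (fun k x => g k x * f₂ x + f x * g₂ k x)
      (fun k l x => h k l x * f₂ x + g k x * g₂ l x + (g l x * g₂ k x + f x * h₂ k l x)) :=
  ⟨H.grad.mul H₂.grad,
    fun k => ((H.hess k).mul H₂.grad).add (H.grad.mul (H₂.hess k))⟩

lemma HasHess.sum {ι : Type*} (s : Finset ι) {f : ι → E3 → ℝ} {g : ι → Fin 3 → E3 → ℝ}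
    {h : ι → Fin 3 → Fin 3 → E3 → ℝ} (H : ∀ i ∈ s, HasHess (f i) (g i) (h i)) :
    HasHess (fun x => ∑ i ∈ s, f i x) (fun k x => ∑ i ∈ s, g i k x)
      (fun k l x => ∑ i ∈ s, h i k l x) :=
  ⟨HasGrad.sum s fun i hi => (H i hi).grad,
    fun k => HasGrad.sum s fun i hi => (H i hi).hess k⟩

lemma HasHess.lap3_eq (hf : ContDiffOn ℝ 2 f OmegaBar) (H : HasHess f g h) :
    ∀ x ∈ OmegaBar, lap3 f x = ∑ k, h k k x := fun x hx =>
  Finset.sum_congr rfl fun k _ => ((hasHess_pd hf).hess k).unique (H.hess k)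
    (fun y hy => (hasHess_pd hf).grad.unique H.grad (fun _ _ => rfl) k y hy) k x hx

lemma HasGrad.pd_eq (hf : ContDiffOn ℝ 2 f OmegaBar) (H : HasGrad f g) (k : Fin 3) :
    ∀ x ∈ OmegaBar, pd f k x = g k x :=
  (hasHess_pd hf).grad.unique H (fun _ _ => rfl) k

end

/-- Solutions of the Euler–Lagrange equation with weak anchoring and finite energy. -/
structure IsSol (a b c L W : ℝ) (Q : E3 → Mat3) : Prop where
  L_pos : 0 < L
  W_pos : 0 < W
  reg : RegC 2 Q
  mem : memH a b c Q
  el : isEL a b c L Q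
  bc : weakAnchor a b c L W Q

namespace IsSol

variable {a b c L W : ℝ} {Q : E3 → Mat3}

lemma hasHess (h : IsSol a b c L W Q) (i j : Fin 3) :
    HasHess (fun x => Q x i j) (pd fun x => Q x i j) (fun k => pd (pd (fun x => Q x i j) k)) :=
  hasHess_pd (h.reg i j)

lemma isS0 (h : IsSol a b c L W Q) {x : E3} (hx : x ∈ OmegaBar) : isS0 (Q x) := h.mem.1 x hx

lemma lap3_eq (h : IsSol a b c L W Q) {x : E3} (hx : x ∈ Omega) (i j : Fin 3) :
    lap3 (fun y => Q y i j) x = gradf a b c (Q x) i j / L := by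
  have h1 := congrFun (congrFun (h.el x hx) i) j
  simp only [Matrix.smul_apply, matLap, Matrix.of_apply, smul_eq_mul] at h1
  rw [← h1]
  field_simp [h.L_pos.ne']

lemma radial (h : IsSol a b c L W Q) {x : E3} (hx : ‖x‖ = 1) (i j : Fin 3) :
    ∑ k, x k * pd (fun y => Q y i j) k x = W / L * (Q x i j - Qsurf a b c x i j) :=
  weakAnchor_radial h.L_pos h.W_pos h.bc hx i j

end IsSol

lemma frobSq_Qsurf {a b c : ℝ} {x : E3} (hx : ‖x‖ = 1) :
    frobSq (Qsurf a b c x) = 2 / 3 * sstar a b c ^ 2 :=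
  frobSq_smul_outer (by rw [er_of_norm_one hx, hx]) _

lemma sum_mul_sq_le_frobSq (A B : Mat3) :
    (∑ i, ∑ j, A i j * B i j) ^ 2 ≤ frobSq A * frobSq B := by
  have h := Finset.sum_mul_sq_le_sq_mul_sq (Finset.univ : Finset (Fin 3 × Fin 3))
    (fun p => A p.1 p.2) (fun p => B p.1 p.2)
  simp only [Fintype.sum_prod_type] at h
  exact h

/-- Solutions are bounded, uniformly with respect to the elastic and anchoring constants. -/
theorem exists_frobSq_le {a b c : ℝ} (ha : 0 ≤ a) (hb : 0 < b) (hc : 0 < c) :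
    ∃ M > 0, ∀ L W Q, IsSol a b c L W Q → ∀ x ∈ OmegaBar, frobSq (Q x) ≤ M ^ 2 := by
  set s := sstar a b c with hs
  set m := 4 * (a + b ^ 2 / c) / c + 4 * (2 / 3 * s ^ 2) + 1 with hm
  have hm0 : 0 < m := by positivity
  refine ⟨√m, Real.sqrt_pos.2 hm0, fun L W Q h => ?_⟩
  rw [Real.sq_sqrt hm0.le]
  have hLc : 0 < c / L := div_pos hc h.L_pos
  have hWL : 0 < W / L := div_pos h.W_pos h.L_pos
  have hv : ContDiffOn ℝ 2 (fun x => frobSq (Q x)) OmegaBar := by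
    unfold frobSq
    exact ContDiffOn.sum fun i _ => ContDiffOn.sum fun j _ => (h.reg i j).pow 2
  have hH := HasHess.sum Finset.univ fun i (_ : i ∈ Finset.univ) =>
    HasHess.sum Finset.univ fun j (_ : j ∈ Finset.univ) => (h.hasHess i j).mul (h.hasHess i j)
  simp only [← pow_two (Q _ _ _)] at hH
  change HasHess (fun x => frobSq (Q x)) _ _ at hH
  refine le_of_lap_ge_sq (κ := c / L) (σ := W / L * m) hv hm0 hLc (by positivity)
    (fun x hx hmx => ?_) (fun x hx hmx => ?_)
  · have hxB := Omega_subset_OmegaBar hx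
    rw [hH.lap3_eq hv x hxB]
    have hS := h.isS0 hxB
    have e1 : ∑ k, ∑ i, ∑ j, (pd (pd (fun x => Q x i j) k) k x * Q x i j
          + pd (fun x => Q x i j) k x * pd (fun x => Q x i j) k x
          + (pd (fun x => Q x i j) k x * pd (fun x => Q x i j) k x
            + Q x i j * pd (pd (fun x => Q x i j) k) k x))
        = 2 * ∑ i, ∑ j, ((∑ k, pd (fun x => Q x i j) k x ^ 2)
          + Q x i j * lap3 (fun y => Q y i j) x) := by
      simp only [lap3, Fin.sum_univ_three]
      ring
    have e2 : ∑ i, ∑ j, Q x i j * lap3 (fun y => Q y i j) x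
        ≤ ∑ i, ∑ j, ((∑ k, pd (fun x => Q x i j) k x ^ 2)
          + Q x i j * lap3 (fun y => Q y i j) x) :=
      Finset.sum_le_sum fun i _ => Finset.sum_le_sum fun j _ =>
        le_add_of_nonneg_left (Finset.sum_nonneg fun _ _ => sq_nonneg _)
    have e3 : ∑ i, ∑ j, Q x i j * lap3 (fun y => Q y i j) x
        = (gradf a b c (Q x) * Q x).trace / L := by
      rw [trace_mul_eq_sum hS.1, Finset.sum_div]
      refine Finset.sum_congr rfl fun i _ => ?_
      rw [Finset.sum_div]
      refine Finset.sum_congr rfl fun j _ => ?_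
      rw [h.lap3_eq hx]
      ring
    rw [e1]
    refine le_trans ?_ (mul_le_mul_of_nonneg_left e2 (by norm_num))
    rw [e3, trace_gradf_mul _ _ _ _ hS.2]
    have hT : (Q x * Q x).trace = frobSq (Q x) := by rw [← mnormSq_eq_frobSq hS.1, mnormSq]
    set v := frobSq (Q x)
    have hv0 : 0 < v := hm0.trans hmx
    have h3 : |(Q x * Q x * Q x).trace| ≤ v * √v := by
      refine (abs_trace_mul_le _ _).trans
        (mul_le_mul_of_nonneg_right ?_ (Real.sqrt_nonneg _))
      refine (sqrt_frobSq_mul_le _ _).trans ?_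
      rw [Real.mul_self_sqrt hv0.le]
    have h4 : b * √v ≤ c * v / 4 + b ^ 2 / c := by
      have h5 : c * (b * √v) ≤ c * (c * v / 4 + b ^ 2 / c) := by
        have h6 := Real.sq_sqrt hv0.le
        have h7 := sq_nonneg (c * √v / 2 - b)
        have h8 : c * (b ^ 2 / c) = b ^ 2 := mul_div_cancel₀ _ hc.ne'
        have h9 : c * (c * v / 4 + b ^ 2 / c) - c * (b * √v) = (c * √v / 2 - b) ^ 2 := by
          linear_combination h8 - c ^ 2 / 4 * h6
        linarith
      exact le_of_mul_le_mul_left h5 hc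
    have h5 : 4 * (a + b ^ 2 / c) ≤ c * v := by
      have h6 : 4 * (a + b ^ 2 / c) / c ≤ v := by
        have : 0 ≤ 4 * (2 / 3 * s ^ 2) := by positivity
        linarith
      rw [div_le_iff₀ hc] at h6
      linarith
    have h6 : b * (Q x * Q x * Q x).trace ≤ v * (b * √v) := by
      have := mul_le_mul_of_nonneg_left ((le_abs_self _).trans h3) hb.le
      linarith
    have h7 : v * (b * √v) ≤ v * (c * v / 4 + b ^ 2 / c) := mul_le_mul_of_nonneg_left h4 hv0.le
    have h8 : v * (a + b ^ 2 / c) ≤ v * (c * v / 4) :=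
      mul_le_mul_of_nonneg_left (by linarith) hv0.le
    have h9 : c * v ^ 2 / 2 ≤ -a * (Q x * Q x).trace - b * (Q x * Q x * Q x).trace
        + c * mnormSq (Q x) * (Q x * Q x).trace := by
      rw [mnormSq_eq_frobSq hS.1, hT]
      linarith
    have := div_le_div_of_nonneg_right h9 h.L_pos.le
    calc c / L * v ^ 2 = 2 * (c * v ^ 2 / 2 / L) := by ring
      _ ≤ _ := mul_le_mul_of_nonneg_left this (by norm_num)
  · have hxB : x ∈ OmegaBar := le_of_eq hx.symm
    have e1 : ∑ k, x k * pd (fun x => frobSq (Q x)) k x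
        = 2 * ∑ i, ∑ j, Q x i j * ∑ k, x k * pd (fun y => Q y i j) k x := by
      simp only [hH.grad.pd_eq hv _ x hxB, Fin.sum_univ_three]
      ring
    rw [e1]
    simp only [h.radial hx]
    have e2 : ∑ i, ∑ j, Q x i j * (W / L * (Q x i j - Qsurf a b c x i j))
        = W / L * (frobSq (Q x) - ∑ i, ∑ j, Q x i j * Qsurf a b c x i j) := by
      simp only [frobSq, Fin.sum_univ_three]
      ring
    have h2 := sum_mul_sq_le_frobSq (Q x) (Qsurf a b c x)
    rw [frobSq_Qsurf hx, ← hs] at h2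
    rw [e2]
    set v := frobSq (Q x)
    set y := ∑ i, ∑ j, Q x i j * Qsurf a b c x i j
    have h3 : y ≤ v / 2 := by
      have : 0 ≤ 4 * (a + b ^ 2 / c) / c := by positivity
      refine le_of_abs_le (abs_le_of_sq_le_sq ?_ (by linarith))
      have : v * (2 / 3 * s ^ 2) ≤ v * (v / 4) :=
        mul_le_mul_of_nonneg_left (by linarith) (by linarith)
      linarith
    have : W / L * (m / 2) ≤ W / L * (v - y) := mul_le_mul_of_nonneg_left (by linarith) hWL.le
    linarith

/-- Divergence of the stress tensor contracted with the position vector. -/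
lemma exists_hasGrad_pohozaev {q : E3 → ℝ} (hq : ContDiffOn ℝ 2 q OmegaBar) :
    ∃ D : Fin 3 → Fin 3 → E3 → ℝ,
      (∀ k, HasGrad (fun x => 1 / 2 * (x k * ∑ l, pd q l x ^ 2)
        - (∑ l, x l * pd q l x) * pd q k x) (D k)) ∧
      ∀ x ∈ Omega, ∑ k, D k k x = 1 / 2 * (∑ l, pd q l x ^ 2)
        - (∑ l, x l * pd q l x) * lap3 q x := by
  have H := hasHess_pd hq
  have hG (k : Fin 3) := (((HasGrad.coord k).mul (HasGrad.sum Finset.univ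
    fun l (_ : l ∈ Finset.univ) => (H.hess l).mul (H.hess l))).const_mul (1 / 2)).sub
    ((HasGrad.sum Finset.univ fun l (_ : l ∈ Finset.univ) =>
      (HasGrad.coord l).mul (H.hess l)).mul (H.hess k))
  refine ⟨_, fun k => by simpa only [pow_two] using hG k, fun x hx => ?_⟩
  simp only [Fin.sum_univ_three, lap3, pd_comm hq hx 1 0, pd_comm hq hx 2 0, pd_comm hq hx 2 1]
  simp
  ring

lemma frobSq_sub_le (A B : Mat3) : frobSq (A - B) ≤ 2 * (frobSq A + frobSq B) := by
  simp only [frobSq, Finset.mul_sum, ← Finset.sum_add_distrib, mul_add]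
  refine Finset.sum_le_sum fun i _ => Finset.sum_le_sum fun j _ => ?_
  rw [Matrix.sub_apply]
  nlinarith [sq_nonneg (A i j + B i j)]

lemma frobSq_Qinf (a b c : ℝ) : frobSq (Qinf a b c) = 2 / 3 * sstar a b c ^ 2 :=
  frobSq_smul_outer norm_ez _

/-- On bounded sets the excess potential is controlled by the squared distance to the constant
state. -/
lemma exists_gpot_sub_le {a b c M : ℝ} (ha : 0 ≤ a) (hb : 0 < b) (hc : 0 < c) :
    ∃ K > 0, ∀ Q : Mat3, isS0 Q → frobSq Q ≤ M ^ 2 →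
      gpot a b c Q - gpot a b c (Qinf a b c) ≤ K * frobSq (Q - Qinf a b c) := by
  set M' := √(2 * (M ^ 2 + 2 / 3 * sstar a b c ^ 2)) with hM'
  have hM2 : M' ^ 2 = 2 * (M ^ 2 + 2 / 3 * sstar a b c ^ 2) := Real.sq_sqrt (by positivity)
  obtain ⟨K, hK, h⟩ := exists_gpot_add_le a b c M' M' ha hb hc (Real.sqrt_nonneg _)
    (Real.sqrt_nonneg _)
  refine ⟨K, hK, fun Q hQ hQM => ?_⟩
  have h1 := h (Qinf a b c) (Q - Qinf a b c) isS0_Qinf (isS0_sub hQ isS0_Qinf)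
    (by rw [hM2, frobSq_Qinf]; nlinarith [sq_nonneg M, sq_nonneg (sstar a b c)])
    (by rw [hM2]
        refine (frobSq_sub_le _ _).trans ?_
        rw [frobSq_Qinf]
        linarith)
  rw [gradf_Qinf ha hc, Matrix.zero_mul, Matrix.trace_zero, add_sub_cancel] at h1
  linarith

namespace IsSol

variable {a b c L W : ℝ} {Q : E3 → Mat3}

lemma matGrad (h : IsSol a b c L W Q) :
    MatGrad Q (fun k x => Matrix.of fun i j => pd (fun y => Q y i j) k x) :=
  fun i j => (h.hasHess i j).grad

lemma hasGrad_potential (h : IsSol a b c L W Q) :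
    HasGrad (fun x => 1 / L * (gpot a b c (Q x) - gpot a b c (Qinf a b c)))
      (fun k x => 1 / L * ((∑ i, ∑ j, gradf a b c (Q x) i j * pd (fun y => Q y i j) k x) - 0)) :=
  ((hasGrad_gpot a b c h.matGrad h.mem.1).sub (HasGrad.const _)).const_mul _

/-- The vector field of the Pohozaev identity. -/
lemma exists_pohozaev (h : IsSol a b c L W Q) :
    ∃ D : Fin 3 → Fin 3 → E3 → ℝ,
      (∀ k, HasGrad (fun x => (∑ i, ∑ j, (1 / 2 * (x k * ∑ l, pd (fun y => Q y i j) l x ^ 2)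
        - (∑ l, x l * pd (fun y => Q y i j) l x) * pd (fun y => Q y i j) k x))
        + x k * (1 / L * (gpot a b c (Q x) - gpot a b c (Qinf a b c)))) (D k)) ∧
      ∀ x ∈ Omega, ∑ k, D k k x = 1 / 2 * gradSq Q x
        + 3 * (1 / L * (gpot a b c (Q x) - gpot a b c (Qinf a b c))) := by
  choose D hD hdiv using fun i j => exists_hasGrad_pohozaev (h.reg i j)
  have hG (k : Fin 3) := (HasGrad.sum Finset.univ fun i (_ : i ∈ Finset.univ) =>
    HasGrad.sum Finset.univ fun j (_ : j ∈ Finset.univ) => hD i j k).add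
      ((HasGrad.coord k).mul h.hasGrad_potential)
  refine ⟨_, hG, fun x hx => ?_⟩
  have e1 : ∑ k, ∑ i, ∑ j, D i j k k x = ∑ i, ∑ j, ∑ k, D i j k k x := by
    rw [Finset.sum_comm]
    exact Finset.sum_congr rfl fun i _ => Finset.sum_comm
  have e2 : ∑ k, x k * (1 / L * ((∑ i, ∑ j, gradf a b c (Q x) i j * pd (fun y => Q y i j) k x) - 0))
      = ∑ i, ∑ j, (∑ l, x l * pd (fun y => Q y i j) l x) * lap3 (fun y => Q y i j) x := by
    simp only [h.lap3_eq hx, Fin.sum_univ_three]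
    ring
  simp only [if_true]
  rw [Finset.sum_add_distrib, Finset.sum_add_distrib, e1, e2, Finset.sum_const]
  simp only [hdiv _ _ x hx, gradSq, Finset.sum_sub_distrib, ← Finset.mul_sum]
  simp

end IsSol

lemma gradSq_nonneg (Q : E3 → Mat3) (x : E3) : 0 ≤ gradSq Q x :=
  Finset.sum_nonneg fun _ _ => Finset.sum_nonneg fun _ _ => Finset.sum_nonneg fun _ _ => sq_nonneg _

/-- Squared norm of `(x · ∇) Q`. -/
def dilSq (Q : E3 → Mat3) (x : E3) : ℝ :=
  ∑ i, ∑ j, (∑ l, x l * pd (fun y => Q y i j) l x) ^ 2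

lemma dilSq_nonneg (Q : E3 → Mat3) (x : E3) : 0 ≤ dilSq Q x :=
  Finset.sum_nonneg fun _ _ => Finset.sum_nonneg fun _ _ => sq_nonneg _

lemma dilSq_le (Q : E3 → Mat3) (x : E3) : dilSq Q x ≤ ‖x‖ ^ 2 * gradSq Q x := by
  simp only [dilSq, gradSq, Finset.mul_sum]
  refine Finset.sum_le_sum fun i _ => Finset.sum_le_sum fun j _ => ?_
  rw [← Finset.mul_sum, EuclideanSpace.real_norm_sq_eq]
  exact Finset.sum_mul_sq_le_sq_mul_sq _ _ _

set_option maxHeartbeats 1000000 in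
/-- Energy bound from the Pohozaev identity, uniform as long as `W / L` is bounded. -/
theorem exists_energy_le {a b c : ℝ} (ha : 0 ≤ a) (hb : 0 < b) (hc : 0 < c) (Λ : ℝ) :
    ∃ C > 0, ∀ L W Q, IsSol a b c L W Q → W / L ≤ Λ →
      ∫ x in Omega, gradSq Q x ≤ C ∧ ∀ ρ : ℝ,
        IntegrableOn (fun x => gpot a b c (Q x) - gpot a b c (Qinf a b c))
          (Omega ∩ closedBall 0 ρ) ∧
        ∫ x in Omega ∩ closedBall 0 ρ, (gpot a b c (Q x) - gpot a b c (Qinf a b c)) ≤ C * L := by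
  obtain ⟨C0, hC0, hgauss⟩ := exists_integral_div_le
  obtain ⟨M, hM, hMb⟩ := exists_frobSq_le ha hb hc
  obtain ⟨K, hK, hKb⟩ := exists_gpot_sub_le (M := M) ha hb hc
  set κ := Λ ^ 2 * (2 * (M ^ 2 + 2 / 3 * sstar a b c ^ 2)) with hκ
  have hκ0 : 0 ≤ κ := by positivity
  refine ⟨2 * (C0 * κ) + 1, by positivity, fun L W Q h hΛ => ?_⟩
  have hL := h.L_pos
  obtain ⟨D, hD, hdiv⟩ := h.exists_pohozaev
  set F : E3 → ℝ := fun x => 1 / L * (gpot a b c (Q x) - gpot a b c (Qinf a b c)) with hF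
  have hFc : ContinuousOn F OmegaBar := h.hasGrad_potential.cont
  have hF0 (x : E3) (hx : x ∈ OmegaBar) : 0 ≤ F x :=
    mul_nonneg (by positivity) (sub_nonneg.2 (gpot_Qinf_le ha hb hc (h.isS0 hx)))
  set P : E3 → ℝ := fun x => mnormSq (Q x - Qinf a b c) / ‖x‖ ^ 2 with hP
  have hFP (x : E3) (hx : x ∈ OmegaBar) : F x ≤ K / L * (‖x‖ ^ 2 * P x) := by
    have hS : isS0 (Q x - Qinf a b c) := isS0_sub (h.isS0 hx) isS0_Qinf
    have h1 := hKb (Q x) (h.isS0 hx) (hMb L W Q h x hx)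
    have h2 : ‖x‖ ^ 2 * P x = frobSq (Q x - Qinf a b c) := by
      simp only [hP]
      rw [mul_div_cancel₀ _ (by linarith [one_le_norm_sq hx]), mnormSq_eq_frobSq hS.1]
    rw [h2, div_mul_eq_mul_div, le_div_iff₀ hL]
    simp only [hF]
    field_simp
    linarith
  have hei : IntegrableOn (gradSq Q) Omega := h.mem.2.1
  have hPi : IntegrableOn P Omega := h.mem.2.2
  set Wf : Fin 3 → E3 → ℝ := fun k x =>
    (∑ i, ∑ j, (1 / 2 * (x k * ∑ l, pd (fun y => Q y i j) l x ^ 2)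
      - (∑ l, x l * pd (fun y => Q y i j) l x) * pd (fun y => Q y i j) k x)) + x k * F x with hW
  have hxW (x : E3) : ∑ k, x k * Wf k x
      = ‖x‖ ^ 2 * (1 / 2 * gradSq Q x) - dilSq Q x + ‖x‖ ^ 2 * F x := by
    simp only [hW, gradSq, dilSq, norm_sq_eq_sum, Fin.sum_univ_three]
    ring
  have hφ (A : ℝ) (hA : 0 < A) : HasGrad (fun x => A * (A + ‖x‖ ^ 2)⁻¹)
      (fun k x => 2 * x k * (-A * ((A + ‖x‖ ^ 2) ^ 2)⁻¹)) := by
    refine HasGrad.radial (m := fun s => A * (A + s)⁻¹) (m' := fun s => -A * ((A + s) ^ 2)⁻¹)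
      (fun s hs => ?_) (continuousOn_const.mul (ContinuousOn.inv₀ (by fun_prop) fun s hs => ?_))
    · have h1 := (((hasDerivAt_id s).const_add A).inv (by simp only [id]; linarith)).const_mul A
      refine h1.congr_deriv ?_
      simp only [id]
      ring
    · have : (1 : ℝ) ≤ s := hs
      positivity
  have hV (A : ℝ) (hA : 0 < A) (k : Fin 3) := (hφ A hA).mul (hD k)
  have hdivV (A : ℝ) (hA : 0 < A) (x : E3) (hx : x ∈ Omega) :
      ∑ k, (2 * x k * (-A * ((A + ‖x‖ ^ 2) ^ 2)⁻¹) * Wf k x + A * (A + ‖x‖ ^ 2)⁻¹ * D k k x)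
      = A * (A + ‖x‖ ^ 2)⁻¹ * ((1 / 2 - ‖x‖ ^ 2 * (A + ‖x‖ ^ 2)⁻¹) * gradSq Q x
        + 2 * (A + ‖x‖ ^ 2)⁻¹ * dilSq Q x + (3 - 2 * (‖x‖ ^ 2 * (A + ‖x‖ ^ 2)⁻¹)) * F x) := by
    have e1 : ∑ k, (2 * x k * (-A * ((A + ‖x‖ ^ 2) ^ 2)⁻¹) * Wf k x
          + A * (A + ‖x‖ ^ 2)⁻¹ * D k k x)
        = 2 * (-A * ((A + ‖x‖ ^ 2) ^ 2)⁻¹) * (∑ k, x k * Wf k x)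
          + A * (A + ‖x‖ ^ 2)⁻¹ * ∑ k, D k k x := by
      simp only [Fin.sum_univ_three]
      ring
    rw [e1, hxW, hdiv x hx, ← inv_pow]
    ring
  have hy (A : ℝ) (hA : 0 < A) (x : E3) : 0 ≤ ‖x‖ ^ 2 * (A + ‖x‖ ^ 2)⁻¹ ∧
      ‖x‖ ^ 2 * (A + ‖x‖ ^ 2)⁻¹ ≤ 1 ∧ 0 < (A + ‖x‖ ^ 2)⁻¹ ∧ A * (A + ‖x‖ ^ 2)⁻¹ ≤ 1 := by
    have h1 : 0 < A + ‖x‖ ^ 2 := by positivity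
    refine ⟨by positivity, ?_, by positivity, ?_⟩ <;>
    · rw [← div_eq_mul_inv, div_le_one h1]
      nlinarith [sq_nonneg ‖x‖]
  have hφF (A : ℝ) (hA : 0 < A) (x : E3) (hx : x ∈ OmegaBar) :
      A * (A + ‖x‖ ^ 2)⁻¹ * F x ≤ A * (K / L) * P x := by
    obtain ⟨h1, h2, h3, h4⟩ := hy A hA x
    have h5 : 0 ≤ P x := by
      have hS : isS0 (Q x - Qinf a b c) := isS0_sub (h.isS0 hx) isS0_Qinf
      simp only [hP]
      rw [mnormSq_eq_frobSq hS.1]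
      exact div_nonneg (frobSq_nonneg _) (sq_nonneg _)
    calc A * (A + ‖x‖ ^ 2)⁻¹ * F x
        ≤ A * (A + ‖x‖ ^ 2)⁻¹ * (K / L * (‖x‖ ^ 2 * P x)) :=
          mul_le_mul_of_nonneg_left (hFP x hx) (by positivity)
      _ = A * (K / L) * P x * (‖x‖ ^ 2 * (A + ‖x‖ ^ 2)⁻¹) := by ring
      _ ≤ _ := mul_le_of_le_one_right (by positivity) h2
  have hbound (A : ℝ) (hA : 0 < A) :
      IntegrableOn (fun x => 4 * gradSq Q x + 6 * (A * (K / L) * P x)) Omega :=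
    (hei.const_mul 4).add ((hPi.const_mul _).const_mul 6)
  have hdi (A : ℝ) (hA : 0 < A) : IntegrableOn (fun x => ∑ k,
      (2 * x k * (-A * ((A + ‖x‖ ^ 2) ^ 2)⁻¹) * Wf k x + A * (A + ‖x‖ ^ 2)⁻¹ * D k k x))
      Omega := by
    refine Integrable.mono' (hbound A hA) (((continuousOn_divergence (hV A hA)).mono
      Omega_subset_OmegaBar).aestronglyMeasurable measurableSet_Omega)
      ((ae_restrict_iff' measurableSet_Omega).2 (Eventually.of_forall fun x hx => ?_))
    have hxB := Omega_subset_OmegaBar hx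
    rw [hdivV A hA x hx, Real.norm_eq_abs]
    obtain ⟨h1, h2, h3, h4⟩ := hy A hA x
    have h5 := hφF A hA x hxB
    have h6 := gradSq_nonneg Q x
    have h7 := mul_nonneg (mul_nonneg hA.le h3.le) (hF0 x hxB)
    have h8 := dilSq_le Q x
    have h9 := dilSq_nonneg Q x
    set y := (A + ‖x‖ ^ 2)⁻¹
    have h10 : y * dilSq Q x ≤ gradSq Q x := by
      calc y * dilSq Q x ≤ y * (‖x‖ ^ 2 * gradSq Q x) := mul_le_mul_of_nonneg_left h8 h3.le
        _ = (‖x‖ ^ 2 * y) * gradSq Q x := by ring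
        _ ≤ _ := mul_le_of_le_one_left h6 h2
    have h11 : 0 ≤ y * dilSq Q x := mul_nonneg h3.le h9
    have h12 : 0 ≤ A * y := by positivity
    have h13 : |(1 / 2 - ‖x‖ ^ 2 * y) * gradSq Q x + 2 * y * dilSq Q x| ≤ 4 * gradSq Q x := by
      have h14 := mul_nonneg h1 h6
      have h15 := mul_le_of_le_one_left h6 h2
      rw [abs_le]; constructor <;> linarith
    have h16 : A * y * |(1 / 2 - ‖x‖ ^ 2 * y) * gradSq Q x + 2 * y * dilSq Q x|
        ≤ 4 * gradSq Q x := (mul_le_of_le_one_left (abs_nonneg _) h4).trans h13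
    calc |A * y * ((1 / 2 - ‖x‖ ^ 2 * y) * gradSq Q x + 2 * y * dilSq Q x
          + (3 - 2 * (‖x‖ ^ 2 * y)) * F x)|
        = |A * y * ((1 / 2 - ‖x‖ ^ 2 * y) * gradSq Q x + 2 * y * dilSq Q x)
          + (3 - 2 * (‖x‖ ^ 2 * y)) * (A * y * F x)| := by congr 1; ring
      _ ≤ _ := abs_add_le _ _
      _ ≤ 4 * gradSq Q x + 6 * (A * (K / L) * P x) := by
        rw [abs_mul, abs_of_nonneg h12, abs_mul, abs_of_nonneg h7]
        refine add_le_add h16 ?_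
        have : |3 - 2 * (‖x‖ ^ 2 * y)| ≤ 6 := by rw [abs_le]; constructor <;> linarith
        exact mul_le_mul this h5 h7 (by norm_num)
  have hfi (A : ℝ) (hA : 0 < A) : IntegrableOn
      (fun x => (∑ k, x k * (A * (A + ‖x‖ ^ 2)⁻¹ * Wf k x)) / ‖x‖ ^ 2) Omega := by
    refine Integrable.mono' (hbound A hA) ((((continuousOn_flux (hV A hA)).mono
      Omega_subset_OmegaBar).div (by fun_prop) fun x hx => by
        linarith [one_lt_norm_sq hx]).aestronglyMeasurable measurableSet_Omega)
      ((ae_restrict_iff' measurableSet_Omega).2 (Eventually.of_forall fun x hx => ?_))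
    have hxB := Omega_subset_OmegaBar hx
    have hs := one_lt_norm_sq hx
    have e1 : ∑ k, x k * (A * (A + ‖x‖ ^ 2)⁻¹ * Wf k x)
        = A * (A + ‖x‖ ^ 2)⁻¹ * ∑ k, x k * Wf k x := by
      rw [Finset.mul_sum]; exact Finset.sum_congr rfl fun k _ => by ring
    rw [e1, hxW, Real.norm_eq_abs, abs_div, abs_of_pos (show 0 < ‖x‖ ^ 2 by linarith),
      div_le_iff₀ (by linarith)]
    obtain ⟨h1, h2, h3, h4⟩ := hy A hA x
    have h5 := hφF A hA x hxB
    have h6 := gradSq_nonneg Q x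
    have h7 := mul_nonneg (mul_nonneg hA.le h3.le) (hF0 x hxB)
    have h8 := dilSq_le Q x
    have h9 := dilSq_nonneg Q x
    set y := (A + ‖x‖ ^ 2)⁻¹
    set s := ‖x‖ ^ 2
    have h12 : 0 ≤ A * y := by positivity
    have h13 : |s * (1 / 2 * gradSq Q x) - dilSq Q x| ≤ 4 * gradSq Q x * s := by
      have : 0 ≤ s * gradSq Q x := by positivity
      rw [abs_le]; constructor <;> linarith
    calc |A * y * (s * (1 / 2 * gradSq Q x) - dilSq Q x + s * F x)|
        = |A * y * (s * (1 / 2 * gradSq Q x) - dilSq Q x) + s * (A * y * F x)| := by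
          congr 1; ring
      _ ≤ _ := abs_add_le _ _
      _ ≤ 4 * gradSq Q x * s + s * (A * (K / L) * P x) := by
        rw [abs_mul, abs_of_nonneg h12, abs_of_nonneg (mul_nonneg (by linarith) h7)]
        exact add_le_add ((mul_le_of_le_one_left (abs_nonneg _) h4).trans h13)
          (mul_le_mul_of_nonneg_left h5 (by linarith))
      _ ≤ _ := by
        have : 0 ≤ s * (A * (K / L) * P x) := mul_nonneg (by linarith) (h7.trans h5)
        linarith
  have hbd (A : ℝ) (hA : 0 < A) (x : E3) (hx : ‖x‖ = 1) :
      -κ ≤ ∑ k, x k * (A * (A + ‖x‖ ^ 2)⁻¹ * Wf k x) := by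
    have hxB : x ∈ OmegaBar := le_of_eq hx.symm
    have e1 : ∑ k, x k * (A * (A + ‖x‖ ^ 2)⁻¹ * Wf k x)
        = A * (A + ‖x‖ ^ 2)⁻¹ * ∑ k, x k * Wf k x := by
      rw [Finset.mul_sum]; exact Finset.sum_congr rfl fun k _ => by ring
    have e2 : dilSq Q x = (W / L) ^ 2 * frobSq (Q x - Qsurf a b c x) := by
      simp only [dilSq, h.radial hx, frobSq, Matrix.sub_apply, Finset.mul_sum, mul_pow]
    have h0 : 0 < W / L := div_pos h.W_pos hL
    have h1 : dilSq Q x ≤ κ := by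
      rw [e2]
      refine mul_le_mul (pow_le_pow_left₀ h0.le hΛ 2) ((frobSq_sub_le _ _).trans ?_)
        (frobSq_nonneg _) (sq_nonneg _)
      rw [frobSq_Qsurf hx]
      linarith [hMb L W Q h x hxB]
    obtain ⟨_, _, h3, h4⟩ := hy A hA x
    have h5 : -κ ≤ ∑ k, x k * Wf k x := by
      rw [hxW, hx]
      linarith [gradSq_nonneg Q x, hF0 x hxB]
    rw [e1]
    have h6 : 0 ≤ A * (A + ‖x‖ ^ 2)⁻¹ := by positivity
    nlinarith
  have hmain (A : ℝ) (hA : 0 < A) := hgauss _ _ κ (hV A hA) (hdi A hA) (hfi A hA) hκ0 (hbd A hA)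
  have key (ρ : ℝ) : IntegrableOn ((closedBall (0 : E3) ρ).indicator F) Omega ∧
      ∫ x in Omega, (1 / 2 * gradSq Q x + (closedBall (0 : E3) ρ).indicator F x) ≤ C0 * κ := by
    have hI0 (x : E3) (hx : x ∈ OmegaBar) : 0 ≤ (closedBall (0 : E3) ρ).indicator F x :=
      Set.indicator_apply_nonneg fun _ => hF0 x hx
    have hIF (x : E3) (hx : x ∈ OmegaBar) : (closedBall (0 : E3) ρ).indicator F x ≤ F x :=
      Set.indicator_apply_le' (fun _ => le_rfl) fun _ => hF0 x hx
    have hFi : IntegrableOn ((closedBall (0 : E3) ρ).indicator F) Omega := by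
      refine Integrable.mono' (hPi.const_mul (K / L * ρ ^ 2))
        (((hFc.mono Omega_subset_OmegaBar).aestronglyMeasurable measurableSet_Omega).indicator
          measurableSet_closedBall)
        ((ae_restrict_iff' measurableSet_Omega).2 (Eventually.of_forall fun x hx => ?_))
      have hxB := Omega_subset_OmegaBar hx
      have hS : isS0 (Q x - Qinf a b c) := isS0_sub (h.isS0 hxB) isS0_Qinf
      have h5 : 0 ≤ P x := by
        simp only [hP]
        rw [mnormSq_eq_frobSq hS.1]
        exact div_nonneg (frobSq_nonneg _) (sq_nonneg _)
      rw [Real.norm_eq_abs, abs_of_nonneg (hI0 x hxB)]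
      refine Set.indicator_apply_le' (fun hxρ => (hFP x hxB).trans ?_) fun _ => by positivity
      have : ‖x‖ ^ 2 ≤ ρ ^ 2 := pow_le_pow_left₀ (norm_nonneg _) (mem_closedBall_zero_iff.1 hxρ) 2
      rw [mul_assoc]
      exact mul_le_mul_of_nonneg_left (mul_le_mul_of_nonneg_right this h5) (by positivity)
    refine ⟨hFi, ?_⟩
    set G : ℕ → E3 → ℝ := fun n x => ((n : ℝ) + 1) * ((n + 1 : ℝ) + ‖x‖ ^ 2)⁻¹ *
      ((1 / 2 - ‖x‖ ^ 2 * ((n + 1 : ℝ) + ‖x‖ ^ 2)⁻¹) * gradSq Q x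
        + (closedBall (0 : E3) ρ).indicator F x) with hG
    have hBi : IntegrableOn (fun x => gradSq Q x + (closedBall (0 : E3) ρ).indicator F x) Omega :=
      hei.add hFi
    have hGm (n : ℕ) : AEStronglyMeasurable (G n) (volume.restrict Omega) := by
      have hA : (0 : ℝ) < n + 1 := by positivity
      have hc1 : Continuous fun x : E3 => ((n + 1 : ℝ) + ‖x‖ ^ 2)⁻¹ :=
        Continuous.inv₀ (by fun_prop) fun x => by positivity
      exact (continuous_const.mul hc1).aestronglyMeasurable.mul
        (((continuous_const.sub ((continuous_norm.pow 2).mul hc1)).aestronglyMeasurable.mul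
          hei.1).add hFi.1)
    have hGb (n : ℕ) : ∀ᵐ x ∂(volume.restrict Omega),
        ‖G n x‖ ≤ gradSq Q x + (closedBall (0 : E3) ρ).indicator F x := by
      refine (ae_restrict_iff' measurableSet_Omega).2 (Eventually.of_forall fun x hx => ?_)
      have hA : (0 : ℝ) < n + 1 := by positivity
      obtain ⟨h1, h2, h3, h4⟩ := hy _ hA x
      have h6 := gradSq_nonneg Q x
      have h7 := hI0 x (Omega_subset_OmegaBar hx)
      simp only [hG, Real.norm_eq_abs]
      rw [abs_mul, abs_of_nonneg (by positivity)]
      refine (mul_le_of_le_one_left (abs_nonneg _) h4).trans ((abs_add_le _ _).trans ?_)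
      rw [abs_mul, abs_of_nonneg h6, abs_of_nonneg h7]
      refine add_le_add (mul_le_of_le_one_left h6 ?_) le_rfl
      rw [abs_le]; constructor <;> linarith
    have hlim : Tendsto (fun n => ∫ x in Omega, G n x) atTop
        (nhds (∫ x in Omega, (1 / 2 * gradSq Q x + (closedBall (0 : E3) ρ).indicator F x))) := by
      refine tendsto_integral_of_dominated_convergence _ hGm hBi hGb (Eventually.of_forall
        fun x => ?_)
      have hn : Tendsto (fun n : ℕ => (n + 1 : ℝ) + ‖x‖ ^ 2) atTop atTop :=
        tendsto_atTop_add_const_right _ _ (tendsto_atTop_add_const_right _ _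
          tendsto_natCast_atTop_atTop)
      have h1 := hn.inv_tendsto_atTop
      have h2 : Tendsto (fun n : ℕ => ((n : ℝ) + 1) * ((n + 1 : ℝ) + ‖x‖ ^ 2)⁻¹) atTop
          (nhds 1) := by
        have h3 : Tendsto (fun n : ℕ => 1 - ‖x‖ ^ 2 * ((n + 1 : ℝ) + ‖x‖ ^ 2)⁻¹) atTop
          (nhds (1 - ‖x‖ ^ 2 * 0)) := (h1.const_mul _).const_sub _
        simp only [mul_zero, sub_zero] at h3
        refine h3.congr fun n => ?_
        have : (n + 1 : ℝ) + ‖x‖ ^ 2 ≠ 0 := by positivity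
        field_simp
        ring
      have h4 := h2.mul ((((h1.const_mul (‖x‖ ^ 2)).const_sub (1 / 2)).mul_const
        (gradSq Q x)).add_const ((closedBall (0 : E3) ρ).indicator F x))
      simpa [hG] using h4
    refine le_of_tendsto hlim (Eventually.of_forall fun n => ?_)
    have hA : (0 : ℝ) < n + 1 := by positivity
    refine le_trans (setIntegral_mono_on (hBi.mono' (hGm n) (hGb n)) (hdi _ hA)
      measurableSet_Omega fun x hx => ?_) (hmain _ hA)
    have hxB := Omega_subset_OmegaBar hx
    rw [hdivV _ hA x hx]
    obtain ⟨h1, h2, h3, h4⟩ := hy _ hA x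
    have h9 := dilSq_nonneg Q x
    refine mul_le_mul_of_nonneg_left ?_ (by positivity)
    have h10 : 0 ≤ 2 * ((n + 1 : ℝ) + ‖x‖ ^ 2)⁻¹ * dilSq Q x :=
      mul_nonneg (by positivity) h9
    have h11 := hIF x hxB
    have h12 := mul_nonneg (sub_nonneg.2 h2) (hF0 x hxB)
    linarith
  have hIF (ρ : ℝ) : 0 ≤ ∫ x in Omega, (closedBall (0 : E3) ρ).indicator F x :=
    setIntegral_nonneg measurableSet_Omega fun x hx =>
      Set.indicator_apply_nonneg fun _ => hF0 x (Omega_subset_OmegaBar hx)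
  have hsplit (ρ : ℝ) : 1 / 2 * (∫ x in Omega, gradSq Q x)
      + ∫ x in Omega, (closedBall (0 : E3) ρ).indicator F x ≤ C0 * κ := by
    have h1 := (key ρ).2
    have h2 := integral_add (hei.const_mul (1 / 2)) (key ρ).1
    have h3 := integral_const_mul (μ := volume.restrict Omega) (1 / 2) (gradSq Q)
    linarith
  have he0 : 0 ≤ ∫ x in Omega, gradSq Q x :=
    setIntegral_nonneg measurableSet_Omega fun x _ => gradSq_nonneg Q x
  have hCκ : 0 ≤ C0 * κ := by positivity
  refine ⟨by linarith [hsplit 0, hIF 0], fun ρ => ?_⟩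
  have hFL : (fun x => gpot a b c (Q x) - gpot a b c (Qinf a b c)) = fun x => L * F x := by
    funext x
    simp only [hF]
    field_simp
  have h1 : IntegrableOn F (Omega ∩ closedBall 0 ρ) := by
    have := (key ρ).1
    rwa [IntegrableOn, integrable_indicator_iff measurableSet_closedBall, IntegrableOn,
      Measure.restrict_restrict measurableSet_closedBall, inter_comm] at this
  have h2 : ∫ x in Omega, (closedBall (0 : E3) ρ).indicator F x
      = ∫ x in Omega ∩ closedBall 0 ρ, F x := setIntegral_indicator measurableSet_closedBall
  rw [hFL]
  refine ⟨h1.const_mul _, ?_⟩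
  rw [integral_const_mul, ← h2]
  nlinarith [hsplit ρ]

/-- Pointwise form of the Cauchy–Schwarz inequality for the radial derivative. -/
lemma radial_sq_le (x : E3) (d : Fin 3 → ℝ) : (∑ k, x k * d k) ^ 2 ≤ ‖x‖ ^ 2 * ∑ k, d k ^ 2 := by
  rw [EuclideanSpace.real_norm_sq_eq]
  exact Finset.sum_mul_sq_le_sq_mul_sq _ _ _

section

variable {p : E3 → ℝ} {dp : Fin 3 → E3 → ℝ} {χ χd : ℝ → ℝ} {ε : ℝ}

/-- Hardy's inequality in the exterior domain with a radial cutoff. -/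
lemma hardy_cutoff (hp : HasGrad p dp) (hpi : IntegrableOn (fun x => p x ^ 2 / ‖x‖ ^ 2) Omega)
    (hdi : IntegrableOn (fun x => ∑ k, dp k x ^ 2) Omega)
    (hχ : ∀ s, 1 ≤ s → HasDerivAt χ (χd s) s) (hχd : ContinuousOn χd (Ici 1))
    (h0 : ∀ s, 1 ≤ s → 0 ≤ χ s) (h1 : ∀ s, 1 ≤ s → χ s ≤ 1)
    (hε : ∀ s, 1 ≤ s → |s * χd s| ≤ ε) :
    ∫ x in Omega, χ (‖x‖ ^ 2) * (p x ^ 2 / ‖x‖ ^ 2)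
      ≤ 4 * (∫ x in Omega, χ (‖x‖ ^ 2) * ∑ k, dp k x ^ 2)
        + 4 * ε * ∫ x in Omega, p x ^ 2 / ‖x‖ ^ 2 := by
  obtain ⟨C0, hC0, hgauss⟩ := exists_integral_div_le
  have hχc : ContinuousOn χ (Ici 1) := fun s hs => (hχ s hs).continuousAt.continuousWithinAt
  have hm : HasGrad (fun x => χ (‖x‖ ^ 2) * (‖x‖ ^ 2)⁻¹) (fun k x => 2 * x k *
      (χd (‖x‖ ^ 2) * (‖x‖ ^ 2)⁻¹ + χ (‖x‖ ^ 2) * (-((‖x‖ ^ 2) ^ 2)⁻¹))) := by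
    refine HasGrad.radial (m := fun s => χ s * s⁻¹)
      (m' := fun s => χd s * s⁻¹ + χ s * (-(s ^ 2)⁻¹)) (fun s hs => ?_) ?_
    · exact (hχ s hs).mul (hasDerivAt_inv (by linarith))
    · have hs0 (s : ℝ) (hs : s ∈ Ici (1 : ℝ)) : s ≠ 0 := by
        have : (1 : ℝ) ≤ s := hs
        linarith
      exact (hχd.mul (continuousOn_id.inv₀ hs0)).add
        (hχc.mul ((continuousOn_id.pow 2).inv₀ fun s hs => pow_ne_zero 2 (hs0 s hs)).neg)
  have hV (k : Fin 3) := hm.mul ((HasGrad.coord k).mul (hp.mul hp))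
  have hmaps : MapsTo (fun x : E3 => ‖x‖ ^ 2) Omega (Ici 1) := fun x hx => (one_lt_norm_sq hx).le
  have hcs : ContinuousOn (fun x : E3 => χ (‖x‖ ^ 2)) Omega :=
    hχc.comp (by fun_prop) hmaps
  have hb (x : E3) (hx : x ∈ Omega) :
      |p x * ∑ k, x k * dp k x| ≤ 1 / 4 * p x ^ 2 + ‖x‖ ^ 2 * ∑ k, dp k x ^ 2 := by
    have h := radial_sq_le x fun k => dp k x
    rw [abs_le]
    constructor <;> nlinarith [sq_nonneg (p x / 2 + ∑ k, x k * dp k x),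
      sq_nonneg (p x / 2 - ∑ k, x k * dp k x)]
  have hdiv (x : E3) (hx : x ∈ Omega) (z : ℝ) (hz : z = ∑ k, x k * dp k x) :
      ∑ k, (2 * x k * (χd (‖x‖ ^ 2) * (‖x‖ ^ 2)⁻¹ + χ (‖x‖ ^ 2) * (-((‖x‖ ^ 2) ^ 2)⁻¹))
          * (x k * (p x * p x)) + χ (‖x‖ ^ 2) * (‖x‖ ^ 2)⁻¹ *
          ((if k = k then 1 else 0) * (p x * p x) + x k * (dp k x * p x + p x * dp k x)))
        = χ (‖x‖ ^ 2) * ((p x ^ 2 + 2 * (p x * z)) / ‖x‖ ^ 2)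
          + 2 * (‖x‖ ^ 2 * χd (‖x‖ ^ 2)) * (p x ^ 2 / ‖x‖ ^ 2) := by
    have hs := one_lt_norm_sq hx
    have hn := norm_sq_eq_sum x
    rw [Fin.sum_univ_three] at hz
    rw [hz]
    generalize χ (‖x‖ ^ 2) = A
    generalize χd (‖x‖ ^ 2) = B
    set s := ‖x‖ ^ 2
    have hs0 : s ≠ 0 := by linarith
    simp only [Fin.sum_univ_three, if_true]
    field_simp
    rw [hn]
    ring
  have hIm : IntegrableOn (fun x => χ (‖x‖ ^ 2) * (p x ^ 2 / ‖x‖ ^ 2)) Omega := by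
    refine hpi.mono' ((hcs.aestronglyMeasurable measurableSet_Omega).mul hpi.1)
      ((ae_restrict_iff' measurableSet_Omega).2 (Eventually.of_forall fun x hx => ?_))
    have hs := (one_lt_norm_sq hx).le
    have h2 : 0 ≤ p x ^ 2 / ‖x‖ ^ 2 := by positivity
    rw [Real.norm_eq_abs, abs_of_nonneg (mul_nonneg (h0 _ hs) h2)]
    exact mul_le_of_le_one_left h2 (h1 _ hs)
  have hId : IntegrableOn (fun x => χ (‖x‖ ^ 2) * ∑ k, dp k x ^ 2) Omega := by
    refine hdi.mono' ((hcs.aestronglyMeasurable measurableSet_Omega).mul hdi.1)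
      ((ae_restrict_iff' measurableSet_Omega).2 (Eventually.of_forall fun x hx => ?_))
    have hs := (one_lt_norm_sq hx).le
    have h2 : 0 ≤ ∑ k, dp k x ^ 2 := Finset.sum_nonneg fun _ _ => sq_nonneg _
    rw [Real.norm_eq_abs, abs_of_nonneg (mul_nonneg (h0 _ hs) h2)]
    exact mul_le_of_le_one_left h2 (h1 _ hs)
  have hquot (x : E3) (hx : x ∈ Omega) : |(p x * ∑ k, x k * dp k x) / ‖x‖ ^ 2|
      ≤ 1 / 4 * (p x ^ 2 / ‖x‖ ^ 2) + ∑ k, dp k x ^ 2 := by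
    have hs : 0 < ‖x‖ ^ 2 := by linarith [one_lt_norm_sq hx]
    rw [abs_div, abs_of_pos hs, div_le_iff₀ hs]
    have h2 : p x ^ 2 / ‖x‖ ^ 2 * ‖x‖ ^ 2 = p x ^ 2 := div_mul_cancel₀ _ hs.ne'
    refine (hb x hx).trans_eq ?_
    linear_combination -(1 / 4) * h2
  have hdiI : IntegrableOn (fun x => ∑ k, (2 * x k * (χd (‖x‖ ^ 2) * (‖x‖ ^ 2)⁻¹
      + χ (‖x‖ ^ 2) * (-((‖x‖ ^ 2) ^ 2)⁻¹)) * (x k * (p x * p x)) + χ (‖x‖ ^ 2) * (‖x‖ ^ 2)⁻¹ *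
      ((if k = k then 1 else 0) * (p x * p x) + x k * (dp k x * p x + p x * dp k x)))) Omega := by
    refine Integrable.mono' ((hpi.const_mul (2 + 2 * ε)).add (hdi.const_mul 2))
      (((continuousOn_divergence hV).mono Omega_subset_OmegaBar).aestronglyMeasurable
        measurableSet_Omega)
      ((ae_restrict_iff' measurableSet_Omega).2 (Eventually.of_forall fun x hx => ?_))
    have hs := (one_lt_norm_sq hx).le
    rw [hdiv x hx _ rfl, Real.norm_eq_abs]
    have h2 : 0 ≤ p x ^ 2 / ‖x‖ ^ 2 := by positivity
    have h3 : 0 ≤ ∑ k, dp k x ^ 2 := Finset.sum_nonneg fun _ _ => sq_nonneg _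
    have h4 := hquot x hx
    refine (abs_add_le _ _).trans ?_
    rw [abs_mul, abs_mul, abs_mul 2, abs_of_nonneg (h0 _ hs), abs_of_nonneg h2, abs_two]
    have h5 : |(p x ^ 2 + 2 * (p x * ∑ k, x k * dp k x)) / ‖x‖ ^ 2|
        ≤ 2 * (p x ^ 2 / ‖x‖ ^ 2) + 2 * ∑ k, dp k x ^ 2 := by
      rw [add_div, mul_div_assoc]
      refine (abs_add_le _ _).trans ?_
      rw [abs_of_nonneg h2, abs_mul, abs_two]
      linarith
    have h6 := (mul_le_of_le_one_left (abs_nonneg _) (h1 _ hs)).trans h5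
    have h7 := mul_le_mul_of_nonneg_right (hε _ hs) h2
    simp only [Pi.add_apply]
    linarith
  have hfI : IntegrableOn (fun x => (∑ k, x k * (χ (‖x‖ ^ 2) * (‖x‖ ^ 2)⁻¹ *
      (x k * (p x * p x)))) / ‖x‖ ^ 2) Omega := by
    refine hIm.congr_fun (fun x hx => ?_) measurableSet_Omega
    have hs : ‖x‖ ^ 2 ≠ 0 := by linarith [one_lt_norm_sq hx]
    have hn := norm_sq_eq_sum x
    simp only [Fin.sum_univ_three] at hn ⊢
    generalize χ (‖x‖ ^ 2) = A
    set s := ‖x‖ ^ 2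
    field_simp
    rw [hn]
  have hmain := hgauss _ _ 0 hV hdiI hfI le_rfl fun x hx => by
    have : ∑ k, x k * (χ (‖x‖ ^ 2) * (‖x‖ ^ 2)⁻¹ * (x k * (p x * p x)))
        = χ (‖x‖ ^ 2) * (p x ^ 2) := by
      have hn := norm_sq_eq_sum x
      rw [hx] at hn ⊢
      simp only [Fin.sum_univ_three] at hn ⊢
      linear_combination -(χ (1 ^ 2) * p x ^ 2) * hn
    rw [this, neg_zero]
    exact mul_nonneg (h0 _ (by rw [hx]; norm_num)) (sq_nonneg _)
  have hlow : ∫ x in Omega, (1 / 2 * (χ (‖x‖ ^ 2) * (p x ^ 2 / ‖x‖ ^ 2))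
      - 2 * (χ (‖x‖ ^ 2) * ∑ k, dp k x ^ 2) - 2 * ε * (p x ^ 2 / ‖x‖ ^ 2)) ≤ C0 * 0 := by
    refine (setIntegral_mono_on (((hIm.const_mul _).sub (hId.const_mul _)).sub (hpi.const_mul _))
      hdiI measurableSet_Omega fun x hx => ?_).trans hmain
    have hs := (one_lt_norm_sq hx).le
    rw [hdiv x hx _ rfl]
    have h2 : 0 ≤ p x ^ 2 / ‖x‖ ^ 2 := by positivity
    have h4 := (abs_le.1 (hquot x hx)).1
    have h7 := mul_le_mul_of_nonneg_right (abs_le.1 (hε _ hs)).1 h2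
    have h8 := mul_le_mul_of_nonneg_left h4 (h0 _ hs)
    rw [add_div, mul_div_assoc 2]
    simp only [Pi.sub_apply]
    generalize p x ^ 2 / ‖x‖ ^ 2 = P at *
    linarith
  have e1 := integral_sub ((hIm.const_mul (1 / 2)).sub (hId.const_mul 2)) (hpi.const_mul (2 * ε))
  have e2 := integral_sub (hIm.const_mul (1 / 2)) (hId.const_mul 2)
  simp only [Pi.sub_apply] at e1
  rw [e1, e2, integral_const_mul, integral_const_mul, integral_const_mul] at hlow
  linarith

end

lemma closedBall_inter_OmegaBar_compact (R : ℝ) : IsCompact (OmegaBar ∩ closedBall (0 : E3) R) :=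
  (isCompact_closedBall _ _).inter_left isClosed_OmegaBar

lemma integrableOn_inter_closedBall {f : E3 → ℝ} (hf : ContinuousOn f OmegaBar) (R : ℝ) :
    IntegrableOn f (Omega ∩ closedBall 0 R) :=
  ((hf.mono inter_subset_left).integrableOn_compact
    (closedBall_inter_OmegaBar_compact R)).mono_set
    (inter_subset_inter_left _ Omega_subset_OmegaBar)

/-- Localised energy estimate for Poisson's equation in the exterior domain. -/
lemma exists_energy_cutoff : ∃ C0 > 0, ∀ (p : E3 → ℝ) (dp : Fin 3 → E3 → ℝ)
    (hp : Fin 3 → Fin 3 → E3 → ℝ) (χ χd : ℝ → ℝ) (ε μ κ R : ℝ), HasHess p dp hp →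
    IntegrableOn (fun x => p x ^ 2 / ‖x‖ ^ 2) Omega →
    IntegrableOn (fun x => ∑ k, dp k x ^ 2) Omega →
    (∀ s, 1 ≤ s → HasDerivAt χ (χd s) s) → ContinuousOn χd (Ici 1) →
    (∀ s, 1 ≤ s → 0 ≤ χ s) → (∀ s, 1 ≤ s → χ s ≤ 1) → (∀ s, 1 ≤ s → |s * χd s| ≤ ε) →
    (∀ s, R ^ 2 < s → χ s = 0) → (∀ s, R ^ 2 < s → χd s = 0) → 0 < R → 0 < μ → 0 ≤ κ →
    (∀ x, ‖x‖ = 1 → -κ ≤ p x * ∑ k, x k * dp k x) →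
    ∫ x in Omega, χ (‖x‖ ^ 2) * ∑ k, dp k x ^ 2
      ≤ C0 * κ + (μ + ε) * (∫ x in Omega, p x ^ 2 / ‖x‖ ^ 2)
        + ε * (∫ x in Omega, ∑ k, dp k x ^ 2)
        + R ^ 2 / (4 * μ) * ∫ x in Omega ∩ closedBall 0 R, (∑ k, hp k k x) ^ 2 := by
  obtain ⟨C0, hC0, hgauss⟩ := exists_integral_div_le_of_compact
  refine ⟨C0, hC0, fun p dp hp χ χd ε μ κ R H hpi hdi hχ hχd h0 h1 hε hR hRd hR0 hμ hκ hb => ?_⟩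
  have hV (k : Fin 3) := (HasGrad.radial hχ hχd).mul (H.grad.mul (H.hess k))
  have hout {x : E3} (hx : R < ‖x‖) : R ^ 2 < ‖x‖ ^ 2 := pow_lt_pow_left₀ hx hR0.le two_ne_zero
  have hGc : ContinuousOn (fun x => (∑ k, hp k k x) ^ 2) OmegaBar :=
    (continuousOn_finsetSum _ fun k _ => (H.hess k).cont_grad k).pow 2
  have hGi : IntegrableOn ((closedBall (0 : E3) R).indicator fun x => (∑ k, hp k k x) ^ 2)
      Omega := by
    rw [IntegrableOn, integrable_indicator_iff measurableSet_closedBall, IntegrableOn,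
      Measure.restrict_restrict measurableSet_closedBall, inter_comm]
    exact integrableOn_inter_closedBall hGc R
  have hcs : ContinuousOn (fun x : E3 => χ (‖x‖ ^ 2)) Omega :=
    (HasGrad.radial hχ hχd).cont.mono Omega_subset_OmegaBar
  have hId : IntegrableOn (fun x => χ (‖x‖ ^ 2) * ∑ k, dp k x ^ 2) Omega := by
    refine hdi.mono' ((hcs.aestronglyMeasurable measurableSet_Omega).mul hdi.1)
      ((ae_restrict_iff' measurableSet_Omega).2 (Eventually.of_forall fun x hx => ?_))
    have hs := (one_lt_norm_sq hx).le
    have h2 : 0 ≤ ∑ k, dp k x ^ 2 := Finset.sum_nonneg fun _ _ => sq_nonneg _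
    rw [Real.norm_eq_abs, abs_of_nonneg (mul_nonneg (h0 _ hs) h2)]
    exact mul_le_of_le_one_left h2 (h1 _ hs)
  have hmain := hgauss _ _ R κ hV
    (fun x hx k => by rw [hR _ (hout hx), zero_mul])
    (fun x hx k => by rw [hR _ (hout hx), hRd _ (hout hx), zero_mul, mul_zero, zero_mul, zero_add])
    hκ fun x hx => by
      have h2 := h0 1 le_rfl
      have h3 := h1 1 le_rfl
      have h4 := hb x hx
      have h5 : ∑ k, x k * (χ (‖x‖ ^ 2) * (p x * dp k x))
          = χ 1 * (p x * ∑ k, x k * dp k x) := by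
        rw [hx, one_pow, Finset.mul_sum, Finset.mul_sum]
        exact Finset.sum_congr rfl fun k _ => by ring
      rw [h5]
      nlinarith
  have hdivI : IntegrableOn (fun x => ∑ k, (2 * x k * χd (‖x‖ ^ 2) * (p x * dp k x)
      + χ (‖x‖ ^ 2) * (dp k x * dp k x + p x * hp k k x))) Omega :=
    integrableOn_of_norm (R := R) (continuousOn_divergence hV) fun x hx =>
      Finset.sum_eq_zero fun k _ => by
        rw [hR _ (hout hx), hRd _ (hout hx), zero_mul, mul_zero, zero_mul, zero_add]
  have hlow : ∫ x in Omega, (χ (‖x‖ ^ 2) * (∑ k, dp k x ^ 2)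
      - ((μ + ε) * (p x ^ 2 / ‖x‖ ^ 2) + ε * (∑ k, dp k x ^ 2) + R ^ 2 / (4 * μ)
        * (closedBall (0 : E3) R).indicator (fun x => (∑ k, hp k k x) ^ 2) x)) ≤ C0 * κ := by
    refine (setIntegral_mono_on (hId.sub (((hpi.const_mul _).add (hdi.const_mul _)).add
      (hGi.const_mul _))) hdivI measurableSet_Omega fun x hx => ?_).trans hmain
    have hs := one_lt_norm_sq hx
    have e1 : ∑ k, (2 * x k * χd (‖x‖ ^ 2) * (p x * dp k x)
        + χ (‖x‖ ^ 2) * (dp k x * dp k x + p x * hp k k x))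
        = χ (‖x‖ ^ 2) * (∑ k, dp k x ^ 2) + χ (‖x‖ ^ 2) * (p x * ∑ k, hp k k x)
          + 2 * χd (‖x‖ ^ 2) * (p x * ∑ k, x k * dp k x) := by
      simp only [Fin.sum_univ_three]
      ring
    rw [e1]
    simp only [Pi.sub_apply, Pi.add_apply]
    have hz := radial_sq_le x fun k => dp k x
    set z := ∑ k, x k * dp k x
    set D := ∑ k, dp k x ^ 2
    set G := ∑ k, hp k k x
    have hP0 : 0 ≤ p x ^ 2 / ‖x‖ ^ 2 := by positivity
    have hPs : p x ^ 2 = p x ^ 2 / ‖x‖ ^ 2 * ‖x‖ ^ 2 := (div_mul_cancel₀ _ (by linarith)).symm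
    have t1 : |2 * χd (‖x‖ ^ 2) * (p x * z)| ≤ ε * (p x ^ 2 / ‖x‖ ^ 2 + D) := by
      have h2 : |p x * z| ≤ (p x ^ 2 + ‖x‖ ^ 2 * D) / 2 := by
        rw [abs_le]
        constructor <;> nlinarith [sq_nonneg (p x + z), sq_nonneg (p x - z)]
      have hD : 0 ≤ D := Finset.sum_nonneg fun _ _ => sq_nonneg _
      calc |2 * χd (‖x‖ ^ 2) * (p x * z)| = 2 * |χd (‖x‖ ^ 2)| * |p x * z| := by
            rw [abs_mul, abs_mul, abs_two]
        _ ≤ 2 * |χd (‖x‖ ^ 2)| * ((p x ^ 2 + ‖x‖ ^ 2 * D) / 2) := by gcongr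
        _ = |‖x‖ ^ 2 * χd (‖x‖ ^ 2)| * (p x ^ 2 / ‖x‖ ^ 2 + D) := by
            rw [abs_mul, abs_of_pos (show 0 < ‖x‖ ^ 2 by linarith)]
            linear_combination |χd (‖x‖ ^ 2)| * hPs
        _ ≤ _ := by
            gcongr
            exact hε _ hs.le
    have t2 : -(μ * (p x ^ 2 / ‖x‖ ^ 2) + R ^ 2 / (4 * μ)
        * (closedBall (0 : E3) R).indicator (fun x => (∑ k, hp k k x) ^ 2) x)
        ≤ χ (‖x‖ ^ 2) * (p x * G) := by
      by_cases hxR : ‖x‖ ≤ R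
      · rw [Set.indicator_of_mem (mem_closedBall_zero_iff.2 hxR)]
        change -(μ * (p x ^ 2 / ‖x‖ ^ 2) + R ^ 2 / (4 * μ) * G ^ 2) ≤ _
        have h2 : ‖x‖ ^ 2 ≤ R ^ 2 := pow_le_pow_left₀ (norm_nonneg _) hxR 2
        have h3 : |p x * G| ≤ μ * (p x ^ 2 / ‖x‖ ^ 2) + ‖x‖ ^ 2 / (4 * μ) * G ^ 2 := by
          have h4 : μ * (p x ^ 2 / ‖x‖ ^ 2) + ‖x‖ ^ 2 / (4 * μ) * G ^ 2 - |p x * G|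
              = (2 * μ * |p x| - ‖x‖ ^ 2 * |G|) ^ 2 / (4 * μ * ‖x‖ ^ 2) := by
            have : ‖x‖ ≠ 0 := fun h => by rw [h] at hs; norm_num at hs
            rw [abs_mul, ← sq_abs (p x), ← sq_abs G]
            field_simp
            ring
          have h5 : 0 ≤ (2 * μ * |p x| - ‖x‖ ^ 2 * |G|) ^ 2 / (4 * μ * ‖x‖ ^ 2) := by positivity
          linarith
        have h4 : ‖x‖ ^ 2 / (4 * μ) * G ^ 2 ≤ R ^ 2 / (4 * μ) * G ^ 2 := by gcongr
        have h5 := h0 _ hs.le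
        have h6 := mul_le_of_le_one_left (abs_nonneg (p x * G)) (h1 _ hs.le)
        have h7 := mul_le_mul_of_nonneg_left (neg_abs_le (p x * G)) h5
        linarith
      · rw [hR _ (hout (not_le.1 hxR)), zero_mul, neg_nonpos]
        have := Set.indicator_nonneg (s := closedBall (0 : E3) R)
          (f := fun x => (∑ k, hp k k x) ^ 2) (fun _ _ => sq_nonneg _) x
        positivity
    have t3 := (abs_le.1 t1).1
    linarith
  have e1 := integral_sub hId (((hpi.const_mul (μ + ε)).add (hdi.const_mul ε)).add
    (hGi.const_mul (R ^ 2 / (4 * μ))))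
  have e2 := integral_add ((hpi.const_mul (μ + ε)).add (hdi.const_mul ε))
    (hGi.const_mul (R ^ 2 / (4 * μ)))
  have e3 := integral_add (hpi.const_mul (μ + ε)) (hdi.const_mul ε)
  simp only [Pi.add_apply] at e1 e2
  rw [e1, e2, e3, integral_const_mul, integral_const_mul, integral_const_mul,
    setIntegral_indicator measurableSet_closedBall] at hlow
  linarith

/-- A solution of Poisson's equation with small right-hand side and almost dissipative boundary
flux is small in `L²` on bounded sets. -/
theorem exists_integral_sq_le {C K η : ℝ} (hC : 0 < C) (hK : 1 ≤ K) (hη : 0 < η) :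
    ∃ δ > 0, ∀ (p : E3 → ℝ) (dp : Fin 3 → E3 → ℝ) (hp : Fin 3 → Fin 3 → E3 → ℝ),
      HasHess p dp hp → IntegrableOn (fun x => p x ^ 2 / ‖x‖ ^ 2) Omega →
      IntegrableOn (fun x => ∑ k, dp k x ^ 2) Omega →
      ∫ x in Omega, ∑ k, dp k x ^ 2 ≤ C →
      (∀ x, ‖x‖ = 1 → -δ ≤ p x * ∑ k, x k * dp k x) →
      (∀ R, ∫ x in Omega ∩ closedBall 0 R, (∑ k, hp k k x) ^ 2 ≤ δ) →
      ∫ x in Omega ∩ closedBall 0 K, p x ^ 2 ≤ η := by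
  obtain ⟨C0, hC0, hen⟩ := exists_energy_cutoff
  set Λ := 208 * C * K ^ 2 / η + K ^ 2 with hΛ
  have hΛ0 : 0 < Λ := by positivity
  set R := Real.exp Λ with hR
  have hR0 : 0 < R := Real.exp_pos _
  set ε := 2 / Λ with hε
  have hε0 : 0 < ε := by positivity
  set δ := η / 2 / (4 * K ^ 2 * (C0 + R ^ 2 / (4 * ε))) with hδ
  have hδ0 : 0 < δ := by positivity
  refine ⟨δ, hδ0, fun p dp hp H hpi hdi hdC hb hG => ?_⟩
  have hardy := hardy_cutoff (χ := fun _ => 1) (χd := fun _ => 0) (ε := 0) H.grad hpi hdi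
    (fun s _ => hasDerivAt_const s 1) continuousOn_const (fun _ _ => zero_le_one)
    (fun _ _ => le_rfl) (fun s _ => by simp)
  simp only [one_mul, mul_zero, zero_mul, add_zero] at hardy
  set χ : ℝ → ℝ := fun s => 1 - step (Real.log s / Λ) with hχ
  set χd : ℝ → ℝ := fun s => -(stepDeriv (Real.log s / Λ) * (s⁻¹ / Λ)) with hχd
  have d1 (s : ℝ) (hs : 1 ≤ s) : HasDerivAt χ (χd s) s :=
    (HasDerivAt.comp s (hasDerivAt_step _)
      ((Real.hasDerivAt_log (by linarith)).div_const Λ)).const_sub 1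
  have d2 : ContinuousOn χd (Ici 1) := by
    have hs0 (s : ℝ) (hs : s ∈ Ici (1 : ℝ)) : s ≠ 0 := by
      have : (1 : ℝ) ≤ s := hs
      linarith
    exact ((continuous_stepDeriv.comp_continuousOn
      ((continuousOn_id.log hs0).div_const Λ)).mul
      ((continuousOn_id.inv₀ hs0).div_const Λ)).neg
  have d3 (s : ℝ) (_ : 1 ≤ s) : 0 ≤ χ s := sub_nonneg.2 (step_le_one _)
  have d4 (s : ℝ) (_ : 1 ≤ s) : χ s ≤ 1 := sub_le_self _ (step_nonneg _)
  have d5 (s : ℝ) (hs : 1 ≤ s) : |s * χd s| ≤ ε := by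
    have e1 : s * χd s = -(stepDeriv (Real.log s / Λ) / Λ) := by
      have : s ≠ 0 := by linarith
      simp only [hχd]
      field_simp
    rw [e1, abs_neg, abs_of_nonneg (div_nonneg (stepDeriv_nonneg _) hΛ0.le)]
    exact div_le_div_of_nonneg_right (stepDeriv_le _) hΛ0.le
  have hlog (s : ℝ) (hs : R ^ 2 < s) : 2 ≤ Real.log s / Λ := by
    rw [le_div_iff₀ hΛ0, Real.le_log_iff_exp_le ((by positivity : 0 < R ^ 2).trans hs), two_mul,
      Real.exp_add, ← pow_two]
    exact hs.le
  have hE := hen p dp hp χ χd ε ε δ R H hpi hdi d1 d2 d3 d4 d5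
    (fun s hs => by simp only [hχ]; rw [step_of_ge (hlog s hs), sub_self])
    (fun s hs => by simp only [hχd]; rw [stepDeriv_of_ge (hlog s hs), zero_mul, neg_zero])
    hR0 hε0 hδ0.le hb
  have hF := hardy_cutoff H.grad hpi hdi d1 d2 d3 d4 d5
  have hGR := hG R
  set IP := ∫ x in Omega, p x ^ 2 / ‖x‖ ^ 2
  set ID := ∫ x in Omega, ∑ k, dp k x ^ 2
  have hIP : IP ≤ 4 * C := by linarith
  have b1 : (ε + ε) * IP ≤ (ε + ε) * (4 * C) := by gcongr
  have b2 : ε * ID ≤ ε * C := by gcongr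
  have b3 : R ^ 2 / (4 * ε) * (∫ x in Omega ∩ closedBall 0 R, (∑ k, hp k k x) ^ 2)
      ≤ R ^ 2 / (4 * ε) * δ := by gcongr
  have b4 : ε * IP ≤ ε * (4 * C) := by gcongr
  have b5 : ∫ x in Omega, χ (‖x‖ ^ 2) * (p x ^ 2 / ‖x‖ ^ 2)
      ≤ 4 * (C0 + R ^ 2 / (4 * ε)) * δ + 52 * ε * C := by linarith
  have hcs : ContinuousOn (fun x : E3 => χ (‖x‖ ^ 2)) Omega :=
    (HasGrad.radial d1 d2).cont.mono Omega_subset_OmegaBar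
  have hIm : IntegrableOn (fun x => χ (‖x‖ ^ 2) * (p x ^ 2 / ‖x‖ ^ 2)) Omega := by
    refine hpi.mono' ((hcs.aestronglyMeasurable measurableSet_Omega).mul hpi.1)
      ((ae_restrict_iff' measurableSet_Omega).2 (Eventually.of_forall fun x hx => ?_))
    have hs := (one_lt_norm_sq hx).le
    have h2 : 0 ≤ p x ^ 2 / ‖x‖ ^ 2 := by positivity
    rw [Real.norm_eq_abs, abs_of_nonneg (mul_nonneg (d3 _ hs) h2)]
    exact mul_le_of_le_one_left h2 (d4 _ hs)
  have b6 : ∫ x in Omega ∩ closedBall 0 K, p x ^ 2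
      ≤ K ^ 2 * ∫ x in Omega, χ (‖x‖ ^ 2) * (p x ^ 2 / ‖x‖ ^ 2) := by
    rw [← integral_const_mul]
    refine (setIntegral_mono_on (integrableOn_inter_closedBall (H.grad.cont.pow 2) K)
      (IntegrableOn.mono_set (hIm.const_mul (K ^ 2)) inter_subset_left)
      (measurableSet_Omega.inter measurableSet_closedBall) fun x hx => ?_).trans
      (setIntegral_mono_set (hIm.const_mul (K ^ 2)) ?_ inter_subset_left.eventuallyLE)
    · have hs := one_lt_norm_sq hx.1
      have hsK : ‖x‖ ^ 2 ≤ K ^ 2 :=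
        pow_le_pow_left₀ (norm_nonneg _) (mem_closedBall_zero_iff.1 hx.2) 2
      have h2 : χ (‖x‖ ^ 2) = 1 := by
        simp only [hχ]
        rw [step_of_le, sub_zero]
        rw [div_le_one hΛ0]
        refine (Real.log_le_sub_one_of_pos (by linarith)).trans ?_
        have : 0 ≤ 208 * C * K ^ 2 / η := by positivity
        linarith
      rw [h2, one_mul, mul_div_assoc', le_div_iff₀ (by linarith), mul_comm]
      exact mul_le_mul_of_nonneg_right hsK (sq_nonneg _)
    · refine (ae_restrict_iff' measurableSet_Omega).2 (Eventually.of_forall fun x hx => ?_)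
      have := d3 _ (one_lt_norm_sq hx).le
      simp only [Pi.zero_apply]
      positivity
  have b7 : K ^ 2 * (4 * (C0 + R ^ 2 / (4 * ε)) * δ) = η / 2 := by
    rw [hδ]
    have : 0 < C0 + R ^ 2 / (4 * ε) := by positivity
    field_simp
  have b8 : K ^ 2 * (52 * ε * C) ≤ η / 2 := by
    have h2 : 208 * C * K ^ 2 ≤ η * Λ := by
      rw [hΛ, mul_add, mul_div_cancel₀ _ hη.ne']
      nlinarith [sq_nonneg K]
    rw [hε, show K ^ 2 * (52 * (2 / Λ) * C) = 104 * C * K ^ 2 / Λ by ring, div_le_iff₀ hΛ0]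
    linarith
  have b9 := mul_le_mul_of_nonneg_left b5 (sq_nonneg K)
  linarith

lemma HasHess.add {f f₂ : E3 → ℝ} {g g₂ : Fin 3 → E3 → ℝ} {h h₂ : Fin 3 → Fin 3 → E3 → ℝ}
    (H : HasHess f g h) (H₂ : HasHess f₂ g₂ h₂) :
    HasHess (fun x => f x + f₂ x) (fun k x => g k x + g₂ k x)
      (fun k l x => h k l x + h₂ k l x) :=
  ⟨H.grad.add H₂.grad, fun k => (H.hess k).add (H₂.hess k)⟩

lemma HasHess.const_mul {f : E3 → ℝ} {g : Fin 3 → E3 → ℝ} {h : Fin 3 → Fin 3 → E3 → ℝ} (c : ℝ)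
    (H : HasHess f g h) :
    HasHess (fun x => c * f x) (fun k x => c * g k x) (fun k l x => c * h k l x) :=
  ⟨H.grad.const_mul c, fun k => (H.hess k).const_mul c⟩

lemma HasHess.const (c : ℝ) : HasHess (fun _ => c) (fun _ _ => 0) (fun _ _ _ => 0) :=
  ⟨HasGrad.const c, fun _ => HasGrad.const 0⟩

lemma HasHess.coord (i : Fin 3) :
    HasHess (fun x => x i) (fun k _ => if i = k then 1 else 0) (fun _ _ _ => 0) :=
  ⟨HasGrad.coord i, fun _ => HasGrad.const _⟩

lemma hasGrad_inv_norm_pow (n : ℕ) :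
    HasGrad (fun x => ‖x‖⁻¹ ^ n) (fun k x => -n * (x k * ‖x‖⁻¹ ^ (n + 2))) := by
  have hs0 (s : ℝ) (hs : s ∈ Ici (1 : ℝ)) : √s ≠ 0 := by
    have : (1 : ℝ) ≤ s := hs
    positivity
  have h := HasGrad.radial (m := fun s => (√s)⁻¹ ^ n)
    (m' := fun s => -(n / 2) * (√s)⁻¹ ^ (n + 2)) (fun s hs => ?_) ?_
  · simp only [Real.sqrt_sq (norm_nonneg _)] at h
    exact h.congr_grad fun k x _ => by ring
  · have h0 := hs0 s hs
    refine (((Real.hasDerivAt_sqrt (by linarith)).inv h0).pow n).congr_deriv ?_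
    rcases n with _ | n
    · simp
    · simp only [Nat.add_sub_cancel, Pi.inv_apply]
      rw [div_eq_mul_inv, ← inv_pow,
        show 1 / (2 * √s) = (√s)⁻¹ / 2 by rw [one_div, mul_inv]; ring]
      push_cast
      ring
  · exact continuousOn_const.mul ((Real.continuous_sqrt.continuousOn.inv₀ hs0).pow _)

lemma hasHess_inv_norm_pow (n : ℕ) :
    HasHess (fun x => ‖x‖⁻¹ ^ n) (fun k x => -n * (x k * ‖x‖⁻¹ ^ (n + 2)))
      (fun k l x => -n * ((if k = l then 1 else 0) * ‖x‖⁻¹ ^ (n + 2)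
        + x k * (-(n + 2 : ℕ) * (x l * ‖x‖⁻¹ ^ (n + 2 + 2))))) :=
  ⟨hasGrad_inv_norm_pow n,
    fun k => ((HasGrad.coord k).mul (hasGrad_inv_norm_pow (n + 2))).const_mul _⟩

/-- The harmonic limit configuration. -/
def harmQ (a b c w : ℝ) (x : E3) : Mat3 := Matrix.of fun i j =>
  sstar a b c * (w / (3 + w) * (‖x‖⁻¹ ^ 5 * (x i * x j) + (-(1 / 3) * (1 : Mat3) i j) * ‖x‖⁻¹ ^ 3)
    + (outer ez ez - (1 / 3 : ℝ) • (1 : Mat3)) i j * (1 + -(w / (1 + w)) * ‖x‖⁻¹ ^ 1))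

lemma norm_inv_sq_mul {x : E3} (hx : x ∈ OmegaBar) :
    ‖x‖⁻¹ ^ 2 * (x 0 ^ 2 + x 1 ^ 2 + x 2 ^ 2) = 1 := by
  have h := norm_sq_eq_sum x
  rw [← h, ← mul_pow, inv_mul_cancel₀ (by have : 1 ≤ ‖x‖ := hx; linarith), one_pow]

lemma abs_coord_mul_inv_norm_le (x : E3) (i : Fin 3) : |x i * ‖x‖⁻¹| ≤ 1 := by
  rw [abs_mul, abs_inv, abs_norm]
  exact mul_inv_le_one_of_le₀ (PiLp.norm_apply_le x i) (norm_nonneg x)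

lemma abs_mul_le_one {x y : ℝ} (hx : |x| ≤ 1) (hy : |y| ≤ 1) : |x * y| ≤ 1 := by
  rw [abs_mul]
  exact mul_le_one₀ hx (abs_nonneg y) hy

lemma inv_norm_le_one {x : E3} (hx : x ∈ OmegaBar) : |‖x‖⁻¹| ≤ 1 := by
  rw [abs_inv, abs_norm]
  exact inv_le_one_of_one_le₀ hx

lemma abs_ez_entry_le (i j : Fin 3) :
    |(outer ez ez - (1 / 3 : ℝ) • (1 : Mat3)) i j| ≤ 1 := by
  have h2 : (ez 0 = 0 ∧ ez 1 = 0) ∧ ez 2 = 1 := by simp [ez]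
  fin_cases i <;> fin_cases j <;> simp [outer_apply, h2] <;>
    norm_num [abs_le]

lemma abs_one_entry_le (i j : Fin 3) : |(1 : Mat3) i j| ≤ 1 := by
  fin_cases i <;> fin_cases j <;> norm_num

set_option maxHeartbeats 1000000 in
lemma exists_hasHess_harmQ (a b c : ℝ) {w : ℝ} (hw : 0 < w) (i j : Fin 3) :
    ∃ (g : Fin 3 → E3 → ℝ) (h : Fin 3 → Fin 3 → E3 → ℝ),
      HasHess (fun x => harmQ a b c w x i j) g h ∧
      (∀ x ∈ OmegaBar, ∑ k, h k k x = 0) ∧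
      (∀ x, ‖x‖ = 1 → ∑ k, x k * g k x = w * (harmQ a b c w x i j - Qsurf a b c x i j)) ∧
      (∀ x ∈ OmegaBar, ∀ k, |g k x| ≤ 10 * |sstar a b c| * ‖x‖⁻¹ ^ 2) ∧
      ∀ x ∈ OmegaBar, |harmQ a b c w x i j - Qinf a b c i j| ≤ 10 * |sstar a b c| * ‖x‖⁻¹ := by
  have hα0 : 0 ≤ w / (3 + w) := by positivity
  have hα1 : w / (3 + w) ≤ 1 := (div_le_one (by positivity)).2 (by linarith)
  have hβ0 : 0 ≤ w / (1 + w) := by positivity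
  have hβ1 : w / (1 + w) ≤ 1 := (div_le_one (by positivity)).2 (by linarith)
  have hα2 : w * (w / (3 + w) - 1) = -3 * (w / (3 + w)) := by field_simp; ring
  have hβ2 : w * (1 - w / (1 + w)) = w / (1 + w) := by field_simp; ring
  have H := (((((hasHess_inv_norm_pow 5).mul ((HasHess.coord i).mul (HasHess.coord j))).add
    ((hasHess_inv_norm_pow 3).const_mul (-(1 / 3) * (1 : Mat3) i j))).const_mul (w / (3 + w))).add
    (((HasHess.const 1).add ((hasHess_inv_norm_pow 1).const_mul (-(w / (1 + w))))).const_mul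
      ((outer ez ez - (1 / 3 : ℝ) • (1 : Mat3)) i j))).const_mul (sstar a b c)
  refine ⟨_, _, H, fun x hx => ?_, fun x hx => ?_, fun x hx k => ?_, fun x hx => ?_⟩
  · have h1 := norm_inv_sq_mul hx
    generalize (outer ez ez - (1 / 3 : ℝ) • (1 : Mat3)) i j = E
    generalize w / (3 + w) = α
    generalize w / (1 + w) = β
    generalize sstar a b c = s
    generalize ‖x‖⁻¹ = u at h1 ⊢
    have h2 : s * α * (35 * x i * x j * u ^ 7 - 5 * (1 : Mat3) i j * u ^ 5)
        * (u ^ 2 * (x 0 ^ 2 + x 1 ^ 2 + x 2 ^ 2) - 1) - s * β * E * (3 * u ^ 3)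
        * (u ^ 2 * (x 0 ^ 2 + x 1 ^ 2 + x 2 ^ 2) - 1) = 0 := by rw [h1]; ring
    refine Eq.trans ?_ h2
    clear h1 h2
    fin_cases i <;> fin_cases j <;> simp [Fin.sum_univ_three] <;> ring
  · have h1 := norm_inv_sq_mul (show x ∈ OmegaBar from hx.ge)
    have e1 : Qsurf a b c x i j = sstar a b c * (x i * x j - 1 / 3 * (1 : Mat3) i j) := by
      simp only [Qsurf, er_of_norm_one hx, Matrix.smul_apply, Matrix.sub_apply, outer_apply,
        smul_eq_mul]
    simp only [e1, harmQ, Matrix.of_apply]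
    generalize (outer ez ez - (1 / 3 : ℝ) • (1 : Mat3)) i j = E
    have h3 : x 0 ^ 2 + x 1 ^ 2 + x 2 ^ 2 = 1 := by simpa [hx] using h1
    simp only [hx, inv_one, one_pow]
    generalize w / (3 + w) = α at hα2 ⊢
    generalize w / (1 + w) = β at hβ2 ⊢
    generalize sstar a b c = s
    have h2 : s * (-3 * α * (x i * x j - 1 / 3 * (1 : Mat3) i j) + E * β)
          + s * (-5 * α * x i * x j + (1 : Mat3) i j * α + E * β) *
            (x 0 ^ 2 + x 1 ^ 2 + x 2 ^ 2 - 1)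
        = w * (s * (α * (1 * (x i * x j) + -(1 / 3) * (1 : Mat3) i j * 1) + E * (1 + -β * 1))
        - s * (x i * x j - 1 / 3 * (1 : Mat3) i j)) := by
      rw [h3]
      linear_combination -s * (x i * x j - 1 / 3 * (1 : Mat3) i j) * hα2 - s * E * hβ2
    refine Eq.trans ?_ h2
    clear h1 h2 h3 hα2 hβ2
    fin_cases i <;> fin_cases j <;> simp [Fin.sum_univ_three] <;> ring
  · have hu := inv_norm_le_one hx
    have hE := abs_ez_entry_le i j
    have hij := abs_one_entry_le i j
    have hik := abs_one_entry_le i k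
    have hjk := abs_one_entry_le j k
    have hi := abs_coord_mul_inv_norm_le x i
    have hj := abs_coord_mul_inv_norm_le x j
    have hk := abs_coord_mul_inv_norm_le x k
    have hα : |w / (3 + w)| ≤ 1 := abs_le.2 ⟨by linarith, hα1⟩
    have hβ : |w / (1 + w)| ≤ 1 := abs_le.2 ⟨by linarith, hβ1⟩
    simp only [Matrix.one_apply] at hij hik hjk ⊢
    generalize (if i = j then (1 : ℝ) else 0) = dij at hij ⊢
    generalize (if i = k then (1 : ℝ) else 0) = dik at hik ⊢
    generalize (if j = k then (1 : ℝ) else 0) = djk at hjk ⊢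
    generalize (outer ez ez - (1 / 3 : ℝ) • (1 : Mat3)) i j = E at hE ⊢
    generalize w / (3 + w) = α at hα ⊢
    generalize w / (1 + w) = β at hβ ⊢
    generalize sstar a b c = s
    generalize ‖x‖⁻¹ = u at *
    have hu2 : |u ^ 2| ≤ 1 := by rw [abs_pow]; exact pow_le_one₀ (abs_nonneg _) hu
    have hα' := abs_mul_le_one hα hu2
    have h1 := abs_mul_le_one hα' (abs_mul_le_one hk (abs_mul_le_one hi hj))
    have h2 := abs_mul_le_one hα' (abs_mul_le_one hik hj)
    have h3 := abs_mul_le_one hα' (abs_mul_le_one hi hjk)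
    have h4 := abs_mul_le_one hα' (abs_mul_le_one hij hk)
    have h5 := abs_mul_le_one (abs_mul_le_one hE hβ) hk
    refine (show ∀ y, y = s * (u ^ 2 * (-5 * (α * u ^ 2 * (x k * u * (x i * u * (x j * u))))
        + α * u ^ 2 * (dik * (x j * u)) + α * u ^ 2 * (x i * u * djk)
        + α * u ^ 2 * (dij * (x k * u)) + E * β * (x k * u))) → |y| ≤ 10 * |s| * u ^ 2 from ?_) _ ?_
    · intro y hy
      rw [hy, abs_mul, abs_mul, abs_of_nonneg (sq_nonneg u)]
      have : |(-5 * (α * u ^ 2 * (x k * u * (x i * u * (x j * u))))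
        + α * u ^ 2 * (dik * (x j * u)) + α * u ^ 2 * (x i * u * djk)
        + α * u ^ 2 * (dij * (x k * u)) + E * β * (x k * u))| ≤ 10 := by
        rw [abs_le] at h1 h2 h3 h4 h5 ⊢
        constructor <;> linarith
      have := mul_le_mul_of_nonneg_left (mul_le_mul_of_nonneg_left this (sq_nonneg u))
        (abs_nonneg s)
      linarith
    · push_cast
      ring
  · have hu := inv_norm_le_one hx
    have hE := abs_ez_entry_le i j
    have hij := abs_one_entry_le i j
    have hi := abs_coord_mul_inv_norm_le x i
    have hj := abs_coord_mul_inv_norm_le x j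
    have hα : |w / (3 + w)| ≤ 1 := abs_le.2 ⟨by linarith, hα1⟩
    have hβ : |w / (1 + w)| ≤ 1 := abs_le.2 ⟨by linarith, hβ1⟩
    have hu0 := inv_nonneg.2 (norm_nonneg x)
    simp only [harmQ, Qinf, Matrix.of_apply, Matrix.smul_apply (sstar a b c),
      smul_eq_mul (sstar a b c)]
    generalize (outer ez ez - (1 / 3 : ℝ) • (1 : Mat3)) i j = E at hE ⊢
    generalize (1 : Mat3) i j = dij at hij ⊢
    generalize w / (3 + w) = α at hα ⊢
    generalize w / (1 + w) = β at hβ ⊢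
    generalize sstar a b c = s
    generalize ‖x‖⁻¹ = u at *
    have hu2 : |u ^ 2| ≤ 1 := by rw [abs_pow]; exact pow_le_one₀ (abs_nonneg _) hu
    have hα' := abs_mul_le_one hα hu2
    have h1 := abs_mul_le_one hα' (abs_mul_le_one hi hj)
    have h4 := abs_mul_le_one hα' hij
    have h5 := abs_mul_le_one hE hβ
    rw [show s * (α * (u ^ 5 * (x i * x j) + -(1 / 3) * dij * u ^ 3) + E * (1 + -β * u ^ 1)) - s * E
      = s * (u * (α * u ^ 2 * (x i * u * (x j * u)) - 1 / 3 * (α * u ^ 2 * dij) - E * β)) by ring,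
      abs_mul, abs_mul, abs_of_nonneg hu0]
    have : |α * u ^ 2 * (x i * u * (x j * u)) - 1 / 3 * (α * u ^ 2 * dij) - E * β| ≤ 10 := by
      rw [abs_le] at h1 h4 h5 ⊢
      constructor <;> linarith
    have := mul_le_mul_of_nonneg_left (mul_le_mul_of_nonneg_left this hu0) (abs_nonneg s)
    linarith

lemma frobSq_add_le (A B : Mat3) : frobSq (A + B) ≤ 2 * (frobSq A + frobSq B) := by
  simp only [frobSq, Finset.mul_sum, ← Finset.sum_add_distrib, mul_add]
  refine Finset.sum_le_sum fun i _ => Finset.sum_le_sum fun j _ => ?_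
  rw [Matrix.add_apply]
  nlinarith [sq_nonneg (A i j - B i j)]

lemma frobSq_smul (r : ℝ) (A : Mat3) : frobSq (r • A) = r ^ 2 * frobSq A := by
  simp only [frobSq, Finset.mul_sum, Matrix.smul_apply, smul_eq_mul, mul_pow]

lemma sq_le_frobSq (A : Mat3) (i j : Fin 3) : A i j ^ 2 ≤ frobSq A :=
  (Finset.single_le_sum (f := fun j => A i j ^ 2) (fun _ _ => sq_nonneg _)
    (Finset.mem_univ j)).trans
    (Finset.single_le_sum (f := fun i => ∑ j, A i j ^ 2)
      (fun _ _ => Finset.sum_nonneg fun _ _ => sq_nonneg _) (Finset.mem_univ i))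

lemma isS0_gradf (a b c : ℝ) {Q : Mat3} (hQ : isS0 Q) : isS0 (gradf a b c Q) := by
  refine ⟨?_, ?_⟩
  · have h : Q.transpose = Q := hQ.1
    simp [Matrix.IsSymm, gradf, h]
  · simp [gradf, hQ.2, mnormSq]

lemma exists_frobSq_gradf_le (a b c M : ℝ) :
    ∃ Γ ≥ 0, ∀ Q : Mat3, isS0 Q → frobSq Q ≤ M ^ 2 → frobSq (gradf a b c Q) ≤ Γ ^ 2 := by
  refine ⟨√(2 * (2 * (a ^ 2 * M ^ 2 + b ^ 2 * (4 * (M ^ 2) ^ 2)) + c ^ 2 * (M ^ 2) ^ 3)),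
    Real.sqrt_nonneg _, fun Q hQ h => ?_⟩
  rw [Real.sq_sqrt (by positivity)]
  have h0 := frobSq_nonneg Q
  have h1 : frobSq (1 : Mat3) = 3 := by
    norm_num [frobSq, Fin.sum_univ_three, Matrix.one_apply]
  have h2 : frobSq (Q * Q - (frobSq Q / 3) • (1 : Mat3)) ≤ 4 * frobSq Q ^ 2 := by
    refine (frobSq_sub_le _ _).trans ?_
    rw [frobSq_smul, h1]
    have := frobSq_mul_le Q Q
    nlinarith
  have e : frobSq (gradf a b c Q) ≤ 2 * (2 * (a ^ 2 * frobSq Q + b ^ 2 * (4 * frobSq Q ^ 2))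
      + c ^ 2 * frobSq Q ^ 3) := by
    rw [gradf, mnormSq_eq_frobSq hQ.1]
    refine (frobSq_add_le _ _).trans ?_
    have h3 := frobSq_sub_le ((-a) • Q) (b • (Q * Q - (frobSq Q / 3) • (1 : Mat3)))
    rw [frobSq_smul, frobSq_smul] at h3
    have h4 := mul_le_mul_of_nonneg_left h2 (sq_nonneg b)
    rw [frobSq_smul (c * frobSq Q)]
    nlinarith
  refine e.trans ?_
  gcongr

lemma exists_frobSq_gradf_le_gpot {a b c : ℝ} (M : ℝ) (ha : 0 ≤ a) (hb : 0 < b) (hc : 0 < c)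
    (hM : 0 ≤ M) :
    ∃ C > 0, ∀ Q : Mat3, isS0 Q → frobSq Q ≤ M ^ 2 →
      frobSq (gradf a b c Q) ≤ C * (gpot a b c Q - gpot a b c (Qinf a b c)) := by
  obtain ⟨Γ, hΓ, hΓb⟩ := exists_frobSq_gradf_le a b c M
  obtain ⟨K, hK, hKb⟩ := exists_gpot_add_le a b c M Γ ha hb hc hM hΓ
  refine ⟨4 * (K + 1), by positivity, fun Q hQ hQM => ?_⟩
  have hG := isS0_gradf a b c hQ
  have hF := hΓb Q hQ hQM
  have hF0 := frobSq_nonneg (gradf a b c Q)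
  set τ := 1 / (2 * (K + 1)) with hτ
  have hτ0 : 0 < τ := by positivity
  have hτ1 : 2 * (K + 1) * τ = 1 := by rw [hτ]; field_simp
  have hτ2 : τ ≤ 1 := by nlinarith
  have h1 := hKb Q (-τ • gradf a b c Q) hQ (isS0_smul _ hG) hQM (by
    rw [frobSq_smul, neg_sq]
    exact (mul_le_of_le_one_left hF0 (pow_le_one₀ hτ0.le hτ2)).trans hF)
  have h2 := gpot_Qinf_le ha hb hc (isS0_add hQ (isS0_smul (-τ) hG))
  have h3 : (gradf a b c Q * (-τ • gradf a b c Q)).trace = -τ * frobSq (gradf a b c Q) := by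
    rw [Matrix.mul_smul, Matrix.trace_smul, ← mnormSq_eq_frobSq hG.1, mnormSq, smul_eq_mul]
  rw [h3, frobSq_smul] at h1
  set F := frobSq (gradf a b c Q)
  have h4 : K * ((-τ) ^ 2 * F) ≤ τ * F / 2 := by
    have h7 : K * τ ≤ 1 / 2 := by linarith
    have := mul_le_mul_of_nonneg_right h7 (mul_nonneg hτ0.le hF0)
    linarith
  have h5 : τ * F / 2 ≤ gpot a b c Q - gpot a b c (Qinf a b c) := by linarith
  have h6 : F = 4 * (K + 1) * (τ * F / 2) := by linear_combination -F * hτ1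
  rw [h6]
  exact mul_le_mul_of_nonneg_left h5 (by positivity)

lemma integrableOn_inv_norm_pow_four : IntegrableOn (fun x : E3 => ‖x‖⁻¹ ^ 4) Omega := by
  have h : Integrable (fun x : E3 => (1 + ‖x‖) ^ (-(4 : ℝ))) volume :=
    integrable_one_add_norm (by rw [finrank_euclideanSpace_fin]; norm_num)
  refine Integrable.mono' (h.integrableOn.const_mul 16) ?_ ?_
  · exact ((ContinuousOn.inv₀ continuous_norm.continuousOn (fun x hx => by
      have : 1 < ‖x‖ := hx
      positivity)).pow 4).aestronglyMeasurable measurableSet_Omega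
  · refine (ae_restrict_iff' measurableSet_Omega).2 (ae_of_all _ fun x hx => ?_)
    have hx1 : 1 < ‖x‖ := hx
    rw [Real.norm_of_nonneg (by positivity), Real.rpow_neg (by positivity),
      show (4 : ℝ) = (4 : ℕ) by norm_num, Real.rpow_natCast, inv_pow,
      inv_le_iff_one_le_mul₀ (by positivity), mul_assoc, inv_mul_eq_div, ← mul_div_assoc,
      one_le_div (by positivity)]
    calc (1 + ‖x‖) ^ 4 ≤ (2 * ‖x‖) ^ 4 := by gcongr; linarith
      _ = 16 * ‖x‖ ^ 4 := by ring

section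

variable {a b c L W : ℝ} {Q : E3 → Mat3}

lemma sum_pd_sq_le_gradSq (Q : E3 → Mat3) (i j : Fin 3) (x : E3) :
    ∑ k, pd (fun y => Q y i j) k x ^ 2 ≤ gradSq Q x :=
  (Finset.single_le_sum (f := fun j => ∑ k, pd (fun y => Q y i j) k x ^ 2)
    (fun _ _ => Finset.sum_nonneg fun _ _ => sq_nonneg _) (Finset.mem_univ j)).trans
    (Finset.single_le_sum (f := fun i => ∑ j, ∑ k, pd (fun y => Q y i j) k x ^ 2)
      (fun _ _ => Finset.sum_nonneg fun _ _ => Finset.sum_nonneg fun _ _ => sq_nonneg _)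
      (Finset.mem_univ i))

lemma abs_Qinf_le (a b c : ℝ) (i j : Fin 3) : |Qinf a b c i j| ≤ |sstar a b c| := by
  rw [Qinf, Matrix.smul_apply, smul_eq_mul, abs_mul]
  exact mul_le_of_le_one_right (abs_nonneg _) (abs_ez_entry_le i j)

lemma abs_Qsurf_le {x : E3} (hx : ‖x‖ = 1) (i j : Fin 3) :
    |Qsurf a b c x i j| ≤ |sstar a b c| := by
  refine abs_le_of_sq_le_sq ?_ (abs_nonneg _)
  have h := sq_le_frobSq (Qsurf a b c x) i j
  rw [frobSq_Qsurf hx] at h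
  rw [sq_abs]
  nlinarith [sq_nonneg (sstar a b c)]

end

lemma continuousOn_of_hasHess_lap {p : E3 → ℝ} {dp : Fin 3 → E3 → ℝ}
    {hp : Fin 3 → Fin 3 → E3 → ℝ} (H : HasHess p dp hp) :
    ContinuousOn (fun x => ∑ k, hp k k x) OmegaBar :=
  continuousOn_finsetSum _ fun k _ => (H.hess k).cont_grad k

lemma abs_div_sub_le {w L W δ : ℝ} (hw : 0 < w) (hL : 0 < L) (hW : 0 < W)
    (h : |L / W - 1 / w| ≤ δ) (hδ : δ ≤ 1 / (2 * w)) : |W / L - w| ≤ 2 * w ^ 2 * δ := by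
  have ht : 1 / (2 * w) ≤ L / W := by
    have h1 := (abs_le.1 (h.trans hδ)).1
    have h2 : 1 / w = 2 * (1 / (2 * w)) := by field_simp
    linarith
  have e : W / L - w = w * (W / L) * (1 / w - L / W) := by field_simp
  have h3 : W / L ≤ 2 * w := by
    rw [show W / L = (L / W)⁻¹ by rw [inv_div], show 2 * w = (1 / (2 * w))⁻¹ by simp]
    exact inv_anti₀ (by positivity) ht
  rw [e, abs_mul, abs_of_pos (by positivity), abs_sub_comm]
  calc w * (W / L) * |L / W - 1 / w| ≤ w * (2 * w) * δ := by gcongr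
    _ = 2 * w ^ 2 * δ := by ring

/-- Solutions are close in `L²` to the harmonic configuration. -/
theorem exists_integral_sub_sq_le {a b c w : ℝ} (ha : 0 ≤ a) (hb : 0 < b) (hc : 0 < c)
    (hw : 0 < w) {K η : ℝ} (hK : 1 ≤ K) (hη : 0 < η) :
    ∃ δ > 0, ∀ L W Q, IsSol a b c L W Q → 1 / L + |L / W - 1 / w| < δ → ∀ i j,
      ∫ x in Omega ∩ closedBall 0 K, (Q x i j - harmQ a b c w x i j) ^ 2 ≤ η := by
  obtain ⟨M, hM, hMb⟩ := exists_frobSq_le ha hb hc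
  obtain ⟨CE, hCE, hen⟩ := exists_energy_le ha hb hc (2 * w)
  obtain ⟨CG, hCG, hgr⟩ := exists_frobSq_gradf_le_gpot M ha hb hc hM.le
  set s := |sstar a b c| with hs
  have hs0 : 0 ≤ s := abs_nonneg _
  set I := ∫ x : E3 in Omega, ‖x‖⁻¹ ^ 4 with hI
  have hI0 : 0 ≤ I := integral_nonneg fun _ => by positivity
  obtain ⟨δ₁, hδ₁, hmain⟩ := exists_integral_sq_le (C := 2 * CE + 600 * s ^ 2 * I) (K := K)
    (η := η) (by positivity) hK hη
  set B := 12 * s * (M + 11 * s) + 1 with hB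
  have hB0 : 0 < B := by positivity
  refine ⟨min (1 / (2 * w)) (min (δ₁ / (2 * w ^ 2 * B)) (δ₁ / (CG * CE))), by positivity,
    fun L W Q h hδ i j => ?_⟩
  have hL := h.L_pos
  have hW := h.W_pos
  have hL1 : 0 < 1 / L := by positivity
  have hd0 := abs_nonneg (L / W - 1 / w)
  obtain ⟨hδa, hδ'⟩ := lt_min_iff.1 hδ
  obtain ⟨hδb, hδc⟩ := lt_min_iff.1 hδ'
  have hWL1 := abs_div_sub_le hw hL hW (by linarith) hδa.le
  have hWL : |W / L - w| * B ≤ δ₁ := by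
    rw [lt_div_iff₀ (by positivity)] at hδb
    nlinarith [mul_le_mul_of_nonneg_right hWL1 hB0.le]
  have hWL2 : W / L ≤ 2 * w := by
    have h1 := mul_lt_mul_of_pos_left hδa (show 0 < 2 * w ^ 2 by positivity)
    have h2 : 2 * w ^ 2 * (1 / (2 * w)) = w := by field_simp
    have := (abs_le.1 hWL1).2
    linarith
  obtain ⟨hE1, hE2⟩ := hen L W Q h hWL2
  obtain ⟨g, hh, HH, hlap, hbc, hg, hdec⟩ := exists_hasHess_harmQ a b c hw i j
  have Hp := (h.hasHess i j).sub HH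
  have hpb : ∀ x ∈ OmegaBar, |Q x i j - harmQ a b c w x i j| ≤ M + 11 * s := by
    intro x hx
    have h1 : |Q x i j| ≤ M :=
      abs_le_of_sq_le_sq ((sq_le_frobSq _ i j).trans (hMb L W Q h x hx)) hM.le
    have h2 := (hdec x hx).trans (mul_le_mul_of_nonneg_left
      ((le_abs_self _).trans (inv_norm_le_one hx)) (by positivity))
    have h3 := abs_Qinf_le a b c i j
    rw [abs_le] at h1 h2 h3 ⊢
    constructor <;> linarith
  have hGi : IntegrableOn (fun x => 2 * gradSq Q x + 600 * s ^ 2 * ‖x‖⁻¹ ^ 4) Omega :=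
    (h.mem.2.1.const_mul 2).add (integrableOn_inv_norm_pow_four.const_mul _)
  have hGb : ∀ x ∈ Omega, ∑ k, (pd (fun x => Q x i j) k x - g k x) ^ 2
      ≤ 2 * gradSq Q x + 600 * s ^ 2 * ‖x‖⁻¹ ^ 4 := by
    intro x hx
    have h1 := sum_pd_sq_le_gradSq Q i j x
    have h2 (k : Fin 3) : g k x ^ 2 ≤ 100 * s ^ 2 * ‖x‖⁻¹ ^ 4 := by
      have := pow_le_pow_left₀ (abs_nonneg _) (hg x (Omega_subset_OmegaBar hx) k) 2
      rw [sq_abs] at this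
      linarith
    have h3 : ∑ k, (pd (fun x => Q x i j) k x - g k x) ^ 2
        ≤ ∑ k, (2 * pd (fun x => Q x i j) k x ^ 2 + 2 * (100 * s ^ 2 * ‖x‖⁻¹ ^ 4)) :=
      Finset.sum_le_sum fun k _ => by
        nlinarith [h2 k, sq_nonneg (pd (fun x => Q x i j) k x + g k x)]
    rw [Finset.sum_add_distrib, ← Finset.mul_sum] at h3
    simp only [Finset.sum_const, Finset.card_univ, Fintype.card_fin, nsmul_eq_mul] at h3
    push_cast at h3
    linarith
  have hGd : IntegrableOn (fun x => ∑ k, (pd (fun x => Q x i j) k x - g k x) ^ 2) Omega := by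
    refine Integrable.mono' hGi ?_ ((ae_restrict_iff' measurableSet_Omega).2 (ae_of_all _
      fun x hx => ?_))
    · exact ((continuousOn_finsetSum _ fun k _ => (Hp.grad.cont_grad k).pow 2).mono
        Omega_subset_OmegaBar).aestronglyMeasurable measurableSet_Omega
    · rw [Real.norm_of_nonneg (Finset.sum_nonneg fun _ _ => sq_nonneg _)]
      exact hGb x hx
  refine hmain _ _ _ Hp ?_ ?_ ?_ (fun x hx => ?_) fun R => ?_
  · refine Integrable.mono' ((h.mem.2.2.const_mul 2).add
      (integrableOn_inv_norm_pow_four.const_mul (200 * s ^ 2))) ?_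
      ((ae_restrict_iff' measurableSet_Omega).2 (ae_of_all _ fun x hx => ?_))
    · refine ContinuousOn.aestronglyMeasurable (ContinuousOn.div ?_ ?_ fun x hx => ?_)
        measurableSet_Omega
      · exact (Hp.grad.cont.mono Omega_subset_OmegaBar).pow 2
      · exact (continuous_norm.pow 2).continuousOn
      · exact (zero_lt_one.trans (one_lt_norm_sq hx)).ne'
    · have hxB := Omega_subset_OmegaBar hx
      have hx2 := zero_lt_one.trans (one_lt_norm_sq hx)
      simp only [Pi.add_apply]
      rw [Real.norm_of_nonneg (by positivity), show ‖x‖⁻¹ ^ 4 = ‖x‖⁻¹ ^ 2 / ‖x‖ ^ 2 by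
        rw [div_eq_mul_inv, ← inv_pow]; ring, ← mul_div_assoc, ← mul_div_assoc, ← add_div]
      refine div_le_div_of_nonneg_right ?_ hx2.le
      have hS := isS0_sub (h.isS0 hxB) (isS0_Qinf (a := a) (b := b) (c := c))
      have h1 := sq_le_frobSq (Q x - Qinf a b c) i j
      have h2 := pow_le_pow_left₀ (abs_nonneg _) (hdec x hxB) 2
      rw [sq_abs] at h2
      rw [mnormSq_eq_frobSq hS.1]
      rw [Matrix.sub_apply] at h1
      nlinarith [sq_nonneg (Q x i j - Qinf a b c i j + (harmQ a b c w x i j - Qinf a b c i j))]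
  · exact hGd
  · refine (setIntegral_mono_on hGd hGi measurableSet_Omega hGb).trans ?_
    rw [integral_add (h.mem.2.1.const_mul 2) (integrableOn_inv_norm_pow_four.const_mul _),
      integral_const_mul, integral_const_mul]
    linarith
  · have hxB : x ∈ OmegaBar := hx.ge
    have e1 : ∑ k, x k * (pd (fun x => Q x i j) k x - g k x)
        = W / L * (Q x i j - Qsurf a b c x i j)
          - w * (harmQ a b c w x i j - Qsurf a b c x i j) := by
      rw [← h.radial hx i j, ← hbc x hx, ← Finset.sum_sub_distrib]
      exact Finset.sum_congr rfl fun k _ => mul_sub _ _ _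
    have hp := hpb x hxB
    have h1 : |harmQ a b c w x i j - Qsurf a b c x i j| ≤ 12 * s := by
      have h2 := hdec x hxB
      rw [hx, inv_one, mul_one] at h2
      have h3 := abs_Qinf_le a b c i j
      have h4 := abs_Qsurf_le (a := a) (b := b) (c := c) hx i j
      rw [abs_le] at h2 h3 h4 ⊢
      constructor <;> linarith
    simp only [e1]
    have h5 : |(W / L - w) * ((harmQ a b c w x i j - Qsurf a b c x i j)
        * (Q x i j - harmQ a b c w x i j))| ≤ δ₁ := by
      rw [abs_mul, abs_mul]
      refine le_trans (mul_le_mul_of_nonneg_left ?_ (abs_nonneg _)) hWL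
      have := mul_le_mul h1 hp (abs_nonneg _) (by positivity)
      linarith
    have h6 : 0 ≤ W / L * (Q x i j - harmQ a b c w x i j) ^ 2 := by positivity
    have h7 := (abs_le.1 h5).1
    linarith
  · have hsub : Omega ∩ closedBall 0 R ⊆ Omega := inter_subset_left
    have hm : MeasurableSet (Omega ∩ closedBall (0 : E3) R) :=
      measurableSet_Omega.inter measurableSet_closedBall
    have h1 : ∫ x in Omega ∩ closedBall 0 R,
          (∑ k, (pd (pd (fun x => Q x i j) k) k x - hh k k x)) ^ 2
        ≤ ∫ x in Omega ∩ closedBall 0 R,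
          CG / L ^ 2 * (gpot a b c (Q x) - gpot a b c (Qinf a b c)) := by
      refine setIntegral_mono_on ?_ ((hE2 R).1.const_mul _) hm fun x hx => ?_
      · exact integrableOn_inter_closedBall ((continuousOn_of_hasHess_lap Hp).pow 2) R
      · have hxB := Omega_subset_OmegaBar hx.1
        have e1 : ∑ k, (pd (pd (fun x => Q x i j) k) k x - hh k k x)
            = gradf a b c (Q x) i j / L := by
          rw [Finset.sum_sub_distrib, hlap x hxB, sub_zero]
          exact h.lap3_eq hx.1 i j
        rw [e1, div_pow, div_mul_eq_mul_div]
        gcongr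
        exact (sq_le_frobSq _ i j).trans (hgr _ (h.isS0 hxB) (hMb L W Q h x hxB))
    refine h1.trans ?_
    rw [integral_const_mul]
    calc CG / L ^ 2 * _ ≤ CG / L ^ 2 * (CE * L) := by gcongr; exact (hE2 R).2
      _ = CG * CE * (1 / L) := by field_simp
      _ ≤ CG * CE * (δ₁ / (CG * CE)) := 
        mul_le_mul_of_nonneg_left (by linarith) (by positivity)
      _ = δ₁ := by field_simp

section

variable {m x : E3} {k l : Fin 3}

/-- Reflection in the hyperplane through `m` orthogonal to the `k`-th axis. -/
def reflectAt (k : Fin 3) (m x : E3) : E3 := x - (2 * (x k - m k)) • EuclideanSpace.single k 1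

lemma reflectAt_add_smul (t : ℝ) :
    reflectAt k m (x + t • EuclideanSpace.single l 1)
      = reflectAt k m x + ((if l = k then -1 else 1) * t) • EuclideanSpace.single l 1 := by
  by_cases h : l = k
  · subst h
    simp only [reflectAt, PiLp.add_apply, PiLp.smul_apply, PiLp.single_apply, if_true,
      smul_eq_mul]
    module
  · simp only [reflectAt, PiLp.add_apply, PiLp.smul_apply, PiLp.single_apply,
      smul_eq_mul, if_neg h, if_neg (Ne.symm h)]
    module

lemma HasPartial.reflect {f : E3 → ℝ} {d : ℝ} (h : HasPartial f d (reflectAt k m x) l) :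
    HasPartial (fun y => f (reflectAt k m y)) ((if l = k then -1 else 1) * d) x l := by
  refine HasPartial.mk ?_
  simp only [reflectAt_add_smul]
  set s : ℝ := if l = k then -1 else 1
  have h1 : HasDerivAt (fun t : ℝ => f (reflectAt k m x + t • EuclideanSpace.single l 1)) d
      (s * 0) := by rw [mul_zero]; exact h
  have h2 := HasDerivAt.comp (0 : ℝ) h1 ((hasDerivAt_id (0 : ℝ)).const_mul s)
  rw [mul_one, mul_comm] at h2
  exact h2

lemma continuous_reflectAt (k : Fin 3) (m : E3) : Continuous (reflectAt k m) := by
  unfold reflectAt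
  fun_prop

lemma norm_reflectAt_sub (k : Fin 3) (m x : E3) : ‖reflectAt k m x - m‖ = ‖x - m‖ := by
  rw [← sq_eq_sq₀ (norm_nonneg _) (norm_nonneg _), norm_sq_eq_sum, norm_sq_eq_sum]
  fin_cases k <;> simp [reflectAt] <;> ring

lemma reflectAt_of_eq (h : x k = m k) : reflectAt k m x = x := by simp [reflectAt, h]

lemma reflectAt_add_self (t : ℝ) :
    reflectAt k m (m + t • EuclideanSpace.single k 1) = m - t • EuclideanSpace.single k 1 := by
  rw [reflectAt_add_smul, reflectAt_of_eq rfl, if_pos rfl]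
  module

lemma hasPartial_dist_sq (m x : E3) (l : Fin 3) :
    HasPartial (fun y => ‖y - m‖ ^ 2) (2 * (x l - m l)) x l := by
  have h := HasPartial.sum Finset.univ fun i (_ : i ∈ Finset.univ) =>
    ((HasPartial.coord (x := x) (k := l) i).sub (HasPartial.const (m i))).mul
      ((HasPartial.coord (x := x) (k := l) i).sub (HasPartial.const (m i)))
  have e : (fun y : E3 => ‖y - m‖ ^ 2) = fun y => ∑ i, (y i - m i) * (y i - m i) := by
    ext y
    rw [norm_sq_eq_sum, Fin.sum_univ_three]
    simp only [PiLp.sub_apply]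
    ring
  rw [e]
  refine h.congr_deriv ?_
  fin_cases l <;> simp [Fin.sum_univ_three] <;> ring

end

/-- A one-sided difference estimate for functions with bounded Laplacian, by reflection. -/
lemma sub_le_of_laplacian_bound {p : E3 → ℝ} {dp : Fin 3 → E3 → ℝ} {hp : Fin 3 → Fin 3 → E3 → ℝ}
    (H : HasHess p dp hp) {m : E3} {ρ M M' : ℝ} (hρ : 0 < ρ) (hsub : closedBall m ρ ⊆ Omega)
    (hM : ∀ x ∈ closedBall m ρ, |p x| ≤ M) (hM' : ∀ x ∈ closedBall m ρ, |∑ l, hp l l x| ≤ M')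
    (k : Fin 3) {t : ℝ} (ht0 : 0 ≤ t) (ht : t ≤ ρ) :
    p (m + t • EuclideanSpace.single k 1) - p (m - t • EuclideanSpace.single k 1)
      ≤ (8 * M / ρ + (M' + 1) * ρ) * t := by
  have hM0 : 0 ≤ M := (abs_nonneg _).trans (hM m (mem_closedBall_self hρ.le))
  set A := 2 * M / ρ ^ 2 with hA
  have hA0 : 0 ≤ A := by positivity
  have hAρ : A * ρ ^ 2 = 2 * M := by rw [hA]; field_simp
  set N := 3 * A + M' + 1 with hN
  have hM'0 : 0 ≤ M' := (abs_nonneg _).trans (hM' m (mem_closedBall_self hρ.le))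
  have hN0 : 0 ≤ N := by positivity
  set f : E3 → ℝ := fun x => p x - p (reflectAt k m x)
    - (A * ‖x - m‖ ^ 2 + N * ((x k - m k) * (ρ - (x k - m k)))) with hf
  have hr {x : E3} (hx : x ∈ closedBall m ρ) : reflectAt k m x ∈ closedBall m ρ := by
    rw [mem_closedBall, dist_eq_norm] at hx ⊢
    rwa [norm_reflectAt_sub]
  have hpc : ContinuousOn p (closedBall m ρ) :=
    H.grad.cont.mono (hsub.trans Omega_subset_OmegaBar)
  have hco (x : E3) (i : Fin 3) : |x i - m i| ≤ ‖x - m‖ := PiLp.norm_apply_le (x - m) i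
  set D := closedBall m ρ ∩ {x | m k ≤ x k} with hD
  have hDc : IsCompact D := (isCompact_closedBall m ρ).inter_right
    (isClosed_le continuous_const (by fun_prop))
  have hfc : ContinuousOn f D := by
    refine ((hpc.mono inter_subset_left).sub ?_).sub (Continuous.continuousOn (by fun_prop))
    exact (hpc.comp (continuous_reflectAt k m).continuousOn fun x hx => hr hx).mono
      inter_subset_left
  have hmD : m ∈ D := ⟨mem_closedBall_self hρ.le, le_refl (m k)⟩
  obtain ⟨y, hyD, hymax⟩ := hDc.exists_isMaxOn ⟨m, hmD⟩ hfc
  have hfy : f y ≤ 0 := by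
    by_contra! hpos
    have hyn : ‖y - m‖ ≤ ρ := by rw [← dist_eq_norm]; exact hyD.1
    have hyk0 : m k ≤ y k := hyD.2
    have hyk : m k < y k := by
      refine lt_of_le_of_ne hyk0 fun h => ?_
      simp only [hf, reflectAt_of_eq h.symm, ← h] at hpos
      have : 0 ≤ A * ‖y - m‖ ^ 2 := by positivity
      linarith
    have hyk1 : y k - m k ≤ ρ := ((le_abs_self _).trans (hco y k)).trans hyn
    have hyρ : ‖y - m‖ < ρ := by
      refine lt_of_le_of_ne hyn fun h => ?_
      simp only [hf, h, hAρ] at hpos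
      have h1 := (abs_le.1 (hM y hyD.1)).2
      have h2 := (abs_le.1 (hM _ (hr hyD.1))).1
      have : 0 ≤ N * ((y k - m k) * (ρ - (y k - m k))) :=
        mul_nonneg hN0 (mul_nonneg (by linarith) (by linarith))
      linarith
    have hO : IsOpen (ball m ρ ∩ {x : E3 | m k < x k}) :=
      isOpen_ball.inter (isOpen_lt continuous_const (by fun_prop))
    have hyO : y ∈ ball m ρ ∩ {x : E3 | m k < x k} := ⟨by rwa [mem_ball, dist_eq_norm], hyk⟩
    have hloc : IsLocalMax f y := by
      filter_upwards [hO.mem_nhds hyO] with z hz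
      exact hymax ⟨ball_subset_closedBall hz.1, le_of_lt (show m k < z k from hz.2)⟩
    have hk (l : Fin 3) : hp l l y - hp l l (reflectAt k m y)
        - (A * 2 - N * (if k = l then 2 else 0)) ≤ 0 := by
      refine second_partial_nonpos_of_isLocalMax (k := l)
        (g := fun x => dp l x - (if l = k then -1 else 1) * dp l (reflectAt k m x)
          - (A * (2 * (x l - m l)) + N * ((if k = l then 1 else 0) * (ρ - (x k - m k))
            + (x k - m k) * (0 - (if k = l then 1 else 0))))) hloc ?_ ?_
      · filter_upwards [hO.mem_nhds hyO] with z hz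
        have hz1 := ball_subset_closedBall hz.1
        have hc := (HasPartial.coord (x := z) (k := l) k).sub (HasPartial.const (m k))
        refine (((H.grad.partials z (hsub hz1) l).sub
          (H.grad.partials _ (hsub (hr hz1)) l).reflect).sub
          (((HasPartial.const A).mul (hasPartial_dist_sq m z l)).add
            ((HasPartial.const N).mul (hc.mul ((HasPartial.const ρ).sub hc))))).congr_deriv ?_
        ring
      · have hc := (HasPartial.coord (x := y) (k := l) k).sub (HasPartial.const (m k))
        have hc' := (HasPartial.coord (x := y) (k := l) l).sub (HasPartial.const (m l))
        refine ((((H.hess l).partials y (hsub hyD.1) l).sub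
          ((HasPartial.const (if l = k then -1 else 1)).mul
            ((H.hess l).partials _ (hsub (hr hyD.1)) l).reflect)).sub
          (((HasPartial.const A).mul ((HasPartial.const 2).mul hc')).add
            ((HasPartial.const N).mul
              (((HasPartial.const (if k = l then 1 else 0)).mul ((HasPartial.const ρ).sub hc)).add
                (hc.mul ((HasPartial.const 0).sub
                  (HasPartial.const (if k = l then 1 else 0)))))))).congr_deriv ?_
        by_cases h : k = l
        · subst h
          simp only [if_true]
          ring
        · simp only [if_neg h, if_neg (Ne.symm h), if_true]
          ring
    have hs := Finset.sum_nonpos fun l (_ : l ∈ Finset.univ) => hk l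
    have e : ∑ l, (hp l l y - hp l l (reflectAt k m y) - (A * 2 - N * (if k = l then 2 else 0)))
        = ∑ l, hp l l y - ∑ l, hp l l (reflectAt k m y) - (6 * A - 2 * N) := by
      fin_cases k <;> simp [Fin.sum_univ_three] <;> ring
    rw [e] at hs
    have h1 := (abs_le.1 (hM' y hyD.1)).1
    have h2 := (abs_le.1 (hM' _ (hr hyD.1))).2
    linarith
  have hn : ‖m + t • (EuclideanSpace.single k 1 : E3) - m‖ = t := by
    rw [add_sub_cancel_left, norm_smul, PiLp.norm_single, norm_one, mul_one,
      Real.norm_of_nonneg ht0]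
  have hzk : (m + t • (EuclideanSpace.single k 1 : E3)) k - m k = t := by simp
  have hzD : m + t • (EuclideanSpace.single k 1 : E3) ∈ D :=
    ⟨by rw [mem_closedBall, dist_eq_norm, hn]; exact ht, by
      change m k ≤ (m + t • (EuclideanSpace.single k 1 : E3)) k
      linarith⟩
  have h3 : f (m + t • (EuclideanSpace.single k 1 : E3)) ≤ 0 := (hymax hzD).trans hfy
  simp only [hf, reflectAt_add_self, hn, hzk] at h3
  have h4 : A * t ^ 2 + N * (t * (ρ - t)) ≤ (A * ρ + N * ρ) * t := by
    have h5 : A * (t * t) ≤ A * (ρ * t) := by gcongr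
    have h6 : 0 ≤ N * (t * t) := by positivity
    linarith
  have h5 : A * ρ + N * ρ = 8 * M / ρ + (M' + 1) * ρ := by
    rw [hN, hA]
    field_simp
    ring
  rw [h5] at h4
  linarith

lemma abs_sub_le_of_laplacian_bound {p : E3 → ℝ} {dp : Fin 3 → E3 → ℝ}
    {hp : Fin 3 → Fin 3 → E3 → ℝ} (H : HasHess p dp hp) {m : E3} {ρ M M' : ℝ} (hρ : 0 < ρ)
    (hsub : closedBall m ρ ⊆ Omega) (hM : ∀ x ∈ closedBall m ρ, |p x| ≤ M)
    (hM' : ∀ x ∈ closedBall m ρ, |∑ l, hp l l x| ≤ M') (k : Fin 3) {t : ℝ} (ht : |t| ≤ ρ) :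
    |p (m + t • EuclideanSpace.single k 1) - p (m - t • EuclideanSpace.single k 1)|
      ≤ (8 * M / ρ + (M' + 1) * ρ) * |t| := by
  have h1 := sub_le_of_laplacian_bound H hρ hsub hM hM' k (abs_nonneg t) ht
  have h2 := sub_le_of_laplacian_bound (H.const_mul (-1)) hρ hsub (M := M) (M' := M')
    (fun x hx => by simpa using hM x hx)
    (fun x hx => by simpa [← Finset.mul_sum] using hM' x hx) k (abs_nonneg t) ht
  rcases abs_choice t with h | h <;> rw [h] at h1 h2 ⊢
  · rw [abs_le]
    constructor <;> linarith
  · rw [neg_smul, ← sub_eq_add_neg, sub_neg_eq_add] at h1 h2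
    rw [abs_le]
    constructor <;> linarith

lemma abs_sub_le_of_mem_closedBall {p : E3 → ℝ} {dp : Fin 3 → E3 → ℝ}
    {hp : Fin 3 → Fin 3 → E3 → ℝ} (H : HasHess p dp hp) {x₀ : E3} {ρ M M' : ℝ} (hρ : 0 < ρ)
    (hsub : closedBall x₀ (2 * ρ) ⊆ Omega) (hM : ∀ x ∈ closedBall x₀ (2 * ρ), |p x| ≤ M)
    (hM' : ∀ x ∈ closedBall x₀ (2 * ρ), |∑ l, hp l l x| ≤ M') {r : ℝ} (hr : 3 * r ≤ ρ)
    {y : E3} (hy : y ∈ closedBall x₀ r) :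
    |p y - p x₀| ≤ 3 * ((8 * M / ρ + (M' + 1) * ρ) * r) := by
  set C := 8 * M / ρ + (M' + 1) * ρ with hC
  have hx0 : x₀ ∈ closedBall x₀ (2 * ρ) := mem_closedBall_self (by linarith)
  have hM0 : 0 ≤ M := (abs_nonneg _).trans (hM _ hx0)
  have hM'0 : 0 ≤ M' := (abs_nonneg _).trans (hM' _ hx0)
  have hC0 : 0 ≤ C := by positivity
  have hyr : ‖y - x₀‖ ≤ r := by rwa [mem_closedBall, dist_eq_norm] at hy
  have ha (i : Fin 3) : |y i - x₀ i| ≤ r := (PiLp.norm_apply_le (y - x₀) i).trans hyr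
  have hr0 : 0 ≤ r := (norm_nonneg _).trans hyr
  have hstep (z : E3) (k : Fin 3) (s : ℝ) (hz : ‖z - x₀‖ ≤ 2 * r) (hs : |s| ≤ r) :
      |p (z + s • EuclideanSpace.single k 1) - p z| ≤ C * r := by
    set m := z + (s / 2) • (EuclideanSpace.single k 1 : E3) with hm
    have hmx : ‖m - x₀‖ ≤ ρ := by
      rw [hm, add_sub_right_comm]
      refine (norm_add_le _ _).trans ?_
      rw [norm_smul, PiLp.norm_single, norm_one, mul_one, Real.norm_eq_abs, abs_div, abs_two]
      linarith [abs_nonneg s]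
    have hB : closedBall m ρ ⊆ closedBall x₀ (2 * ρ) :=
      closedBall_subset_closedBall' (by rw [dist_eq_norm]; linarith)
    have h := abs_sub_le_of_laplacian_bound H hρ (hB.trans hsub) (fun x hx => hM x (hB hx))
      (fun x hx => hM' x (hB hx)) k (t := s / 2) (by
        rw [abs_div, abs_two]
        linarith [abs_nonneg s])
    rw [show m + (s / 2) • (EuclideanSpace.single k 1 : E3) = z + s • EuclideanSpace.single k 1 by
      rw [hm]; module, show m - (s / 2) • (EuclideanSpace.single k 1 : E3) = z by
      rw [hm]; module] at h
    refine h.trans (mul_le_mul_of_nonneg_left ?_ hC0)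
    rw [abs_div, abs_two]
    linarith [abs_nonneg s]
  have hns (k : Fin 3) : ‖(y k - x₀ k) • (EuclideanSpace.single k 1 : E3)‖ ≤ r := by
    rw [norm_smul, PiLp.norm_single, norm_one, mul_one]
    exact ha k
  have h0 := hstep x₀ 0 (y 0 - x₀ 0) (by simpa using hr0) (ha 0)
  have h1 := hstep (x₀ + (y 0 - x₀ 0) • EuclideanSpace.single 0 1) 1 (y 1 - x₀ 1)
    (by rw [add_sub_cancel_left]; linarith [hns 0]) (ha 1)
  have h2 := hstep (x₀ + (y 0 - x₀ 0) • EuclideanSpace.single 0 1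
    + (y 1 - x₀ 1) • EuclideanSpace.single 1 1) 2 (y 2 - x₀ 2)
    (by rw [add_assoc, add_sub_cancel_left]
        exact (norm_add_le _ _).trans (by linarith [hns 0, hns 1])) (ha 2)
  have e : x₀ + (y 0 - x₀ 0) • EuclideanSpace.single 0 1
      + (y 1 - x₀ 1) • EuclideanSpace.single 1 1
      + (y 2 - x₀ 2) • EuclideanSpace.single 2 1 = y := by
    have h := sum_smul_single (y - x₀)
    rw [Fin.sum_univ_three] at h
    simp only [PiLp.sub_apply] at h
    rw [add_assoc, add_assoc, ← add_assoc ((y 0 - x₀ 0) • EuclideanSpace.single 0 1), h]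
    abel
  rw [e] at h2
  rw [abs_le] at *
  constructor <;> linarith [h0.1, h0.2, h1.1, h1.2, h2.1, h2.2]

/-- Smallness in `L²` implies pointwise smallness for functions with bounded Laplacian. -/
lemma exists_abs_le_of_integral_sq_le {ρ M M' ε : ℝ} (hρ : 0 < ρ) (hM0 : 0 ≤ M) (hM'0 : 0 ≤ M')
    (hε : 0 < ε) :
    ∃ η > 0, ∀ (p : E3 → ℝ) (dp : Fin 3 → E3 → ℝ) (hp : Fin 3 → Fin 3 → E3 → ℝ) (x₀ : E3),
      HasHess p dp hp → closedBall x₀ (2 * ρ) ⊆ Omega →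
      (∀ x ∈ closedBall x₀ (2 * ρ), |p x| ≤ M) →
      (∀ x ∈ closedBall x₀ (2 * ρ), |∑ l, hp l l x| ≤ M') →
      ∫ x in closedBall x₀ (2 * ρ), p x ^ 2 ≤ η → |p x₀| ≤ ε := by
  set C := 8 * M / ρ + (M' + 1) * ρ with hC
  have hC0 : 0 < C := by positivity
  set r := min (ρ / 3) (ε / (6 * C)) with hr
  have hr0 : 0 < r := by positivity
  set V := (volume : Measure E3).real (closedBall 0 r) with hV
  have hV0 : 0 < V := ENNReal.toReal_pos (measure_closedBall_pos _ _ hr0).ne'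
    measure_closedBall_lt_top.ne
  refine ⟨ε ^ 2 / 8 * V, by positivity, fun p dp hp x₀ H hsub hM hM' hInt => ?_⟩
  by_contra! hx
  have hr1 : 3 * r ≤ ρ := by linarith [min_le_left (ρ / 3) (ε / (6 * C))]
  have hr2 : 3 * (C * r) ≤ ε / 2 := by
    have h1 : C * r ≤ C * (ε / (6 * C)) :=
      mul_le_mul_of_nonneg_left (min_le_right _ _) hC0.le
    have h2 : C * (ε / (6 * C)) = ε / 6 := by field_simp
    linarith
  have hB : closedBall x₀ r ⊆ closedBall x₀ (2 * ρ) := closedBall_subset_closedBall (by linarith)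
  have hpc : ContinuousOn (fun x => p x ^ 2) (closedBall x₀ (2 * ρ)) :=
    (H.grad.cont.mono (hsub.trans Omega_subset_OmegaBar)).pow 2
  have hpi := hpc.integrableOn_compact (μ := volume) (isCompact_closedBall _ _)
  have h1 : ∫ x in closedBall x₀ r, p x ^ 2 ≤ ∫ x in closedBall x₀ (2 * ρ), p x ^ 2 :=
    setIntegral_mono_set hpi (ae_of_all _ fun _ => sq_nonneg _) hB.eventuallyLE
  have h2 : ∫ x in closedBall x₀ r, ε ^ 2 / 4 ≤ ∫ x in closedBall x₀ r, p x ^ 2 := by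
    refine setIntegral_mono_on (integrableOn_const measure_closedBall_lt_top.ne)
      (hpi.mono_set hB) measurableSet_closedBall fun y hy => ?_
    have h3 := (abs_sub_le_of_mem_closedBall H hρ hsub hM hM' hr1 hy).trans hr2
    have h4 : ε / 2 ≤ |p y| := by
      have := abs_sub_abs_le_abs_sub (p x₀) (p y)
      rw [abs_sub_comm] at this
      linarith
    have h5 := pow_le_pow_left₀ (by linarith) h4 2
    rw [sq_abs] at h5
    linarith
  rw [setIntegral_const, smul_eq_mul, Measure.real,
    Measure.addHaar_closedBall_center volume x₀ r, ← Measure.real, ← hV] at h2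
  nlinarith [sq_pos_of_pos hε]

/-- Solutions converge locally uniformly in the interior to the harmonic configuration. -/
theorem exists_abs_sub_harmQ_le {a b c w : ℝ} (ha : 0 ≤ a) (hb : 0 < b) (hc : 0 < c)
    (hw : 0 < w) {κ K ε : ℝ} (hκ : 0 < κ) (hK : 1 ≤ K) (hε : 0 < ε) :
    ∃ δ > 0, ∀ L W Q, IsSol a b c L W Q → 1 / L + |L / W - 1 / w| < δ →
      ∀ x : E3, 1 + κ ≤ ‖x‖ → ‖x‖ ≤ K → ∀ i j, |Q x i j - harmQ a b c w x i j| ≤ ε := by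
  obtain ⟨M, hM, hMb⟩ := exists_frobSq_le ha hb hc
  obtain ⟨Γ, hΓ, hΓb⟩ := exists_frobSq_gradf_le a b c M
  obtain ⟨η, hη, hpt⟩ := exists_abs_le_of_integral_sq_le (ρ := κ / 4)
    (M := M + 11 * |sstar a b c|) (M' := Γ) (ε := ε) (by positivity) (by positivity) hΓ hε
  obtain ⟨δ, hδ, hInt⟩ := exists_integral_sub_sq_le ha hb hc hw (K := K + κ) (η := η)
    (by linarith) hη
  refine ⟨min δ 1, by positivity, fun L W Q h hd x hx1 hx2 i j => ?_⟩
  obtain ⟨hd1, hd2⟩ := lt_min_iff.1 hd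
  have hL := h.L_pos
  have hL1 : 1 ≤ L := by
    have h1 : 1 / L ≤ 1 := by linarith [abs_nonneg (L / W - 1 / w)]
    rwa [div_le_one hL] at h1
  obtain ⟨g, hh, HH, hlap, -, -, hdec⟩ := exists_hasHess_harmQ a b c hw i j
  have Hp := (h.hasHess i j).sub HH
  have hn {y : E3} (hy : y ∈ closedBall x (2 * (κ / 4))) : ‖y - x‖ ≤ κ / 2 := by
    rw [mem_closedBall, dist_eq_norm] at hy
    linarith
  have hsub : closedBall x (2 * (κ / 4)) ⊆ Omega := fun y hy => by
    have h1 := norm_sub_norm_le x y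
    rw [norm_sub_rev] at h1
    have h2 := hn hy
    change 1 < ‖y‖
    linarith
  refine hpt _ _ _ x Hp hsub (fun y hy => ?_) (fun y hy => ?_) ?_
  · have hyB := Omega_subset_OmegaBar (hsub hy)
    have h1 : |Q y i j| ≤ M :=
      abs_le_of_sq_le_sq ((sq_le_frobSq _ i j).trans (hMb L W Q h y hyB)) hM.le
    have h2 := (hdec y hyB).trans (mul_le_mul_of_nonneg_left
      ((le_abs_self _).trans (inv_norm_le_one hyB)) (by positivity))
    have h3 := abs_Qinf_le a b c i j
    rw [abs_le] at h1 h2 h3 ⊢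
    constructor <;> linarith
  · have hyB := Omega_subset_OmegaBar (hsub hy)
    have e1 : ∑ k, (pd (pd (fun x => Q x i j) k) k y - hh k k y) = gradf a b c (Q y) i j / L := by
      rw [Finset.sum_sub_distrib, hlap y hyB, sub_zero]
      exact h.lap3_eq (hsub hy) i j
    rw [e1, abs_div, abs_of_pos hL, div_le_iff₀ hL]
    refine (abs_le_of_sq_le_sq ((sq_le_frobSq _ i j).trans
      (hΓb _ (h.isS0 hyB) (hMb L W Q h y hyB))) hΓ).trans ?_
    exact le_mul_of_one_le_right hΓ hL1
  · refine (setIntegral_mono_set (integrableOn_inter_closedBall (Hp.grad.cont.pow 2) (K + κ))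
      (ae_of_all _ fun _ => sq_nonneg _) (LE.le.eventuallyLE fun y hy =>
        ⟨hsub hy, ?_⟩)).trans (hInt L W Q h hd1 i j)
    have h1 := norm_sub_norm_le y x
    have h2 := hn hy
    rw [mem_closedBall, dist_eq_norm, sub_zero]
    linarith

lemma mem_Ioo_of_sin_pos {ψ : ℝ → ℝ} (hψ : Continuous ψ) {u v θ s t : ℝ}
    (hs : s ∈ Icc u v) (ht : t ∈ Icc u v) (hpos : ∀ r ∈ Icc u v, 0 < Real.sin (ψ r - θ))
    (h : ψ s ∈ Ioo θ (θ + π)) : ψ t ∈ Ioo θ (θ + π) := by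
  have hz (z : ℝ) (hz : Real.sin (z - θ) = 0) : z ∉ ψ '' Icc u v := by
    rintro ⟨r, hr, rfl⟩
    exact (hpos r hr).ne' hz
  have hc : IsPreconnected (ψ '' Icc u v) := isPreconnected_Icc.image _ hψ.continuousOn
  have hsm := mem_image_of_mem ψ hs
  have htm := mem_image_of_mem ψ ht
  constructor
  · by_contra! hlt
    exact hz θ (by simp) (hc.Icc_subset htm hsm ⟨hlt, h.1.le⟩)
  · by_contra! hlt
    exact hz (θ + π) (by simp) (hc.Icc_subset hsm htm ⟨h.2.le, hlt⟩)

/-- The two-dimensional Poincaré–Miranda theorem (with strict signs). -/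
theorem exists_zero_of_signs {f g : ℝ × ℝ → ℝ} {a b c d : ℝ} (hab : a ≤ b) (hcd : c ≤ d)
    (hf : ContinuousOn f (Icc a b ×ˢ Icc c d)) (hg : ContinuousOn g (Icc a b ×ˢ Icc c d))
    (hfa : ∀ y ∈ Icc c d, f (a, y) < 0) (hfb : ∀ y ∈ Icc c d, 0 < f (b, y))
    (hgc : ∀ x ∈ Icc a b, g (x, c) < 0) (hgd : ∀ x ∈ Icc a b, 0 < g (x, d)) :
    ∃ p ∈ Icc a b ×ˢ Icc c d, f p = 0 ∧ g p = 0 := by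
  by_contra! hne
  set κ : ℝ × ℝ → ℝ × ℝ := fun p => (max a (min b p.1), max c (min d p.2)) with hκ
  have hκc : Continuous κ := by fun_prop
  have hκm (p : ℝ × ℝ) : κ p ∈ Icc a b ×ˢ Icc c d :=
    ⟨⟨le_max_left _ _, max_le hab (min_le_left _ _)⟩, le_max_left _ _,
      max_le hcd (min_le_left _ _)⟩
  have hκid {x y : ℝ} (hx : x ∈ Icc a b) (hy : y ∈ Icc c d) : κ (x, y) = (x, y) := by
    simp [hκ, hx.1, hx.2, hy.1, hy.2]
  set F : ℝ × ℝ → ℂ := fun p => ⟨f (κ p), g (κ p)⟩ with hF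
  have hfc : Continuous fun p => f (κ p) := hf.comp_continuous hκc hκm
  have hgc' : Continuous fun p => g (κ p) := hg.comp_continuous hκc hκm
  have hFc : Continuous F := by
    have : F = fun p => (f (κ p) : ℂ) + (g (κ p) : ℂ) * Complex.I := by
      ext p
      exact (Complex.mk_eq_add_mul_I _ _)
    rw [this]
    exact (Complex.continuous_ofReal.comp hfc).add
      ((Complex.continuous_ofReal.comp hgc').mul continuous_const)
  have hF0 (p : ℝ × ℝ) : F p ≠ 0 := fun h =>
    hne (κ p) (hκm p) (congrArg Complex.re h) (congrArg Complex.im h)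
  obtain ⟨φ, ⟨-, hφ⟩, -⟩ := Complex.isCoveringMap_exp.existsUnique_continuousMap_lifts
    (⟨fun p => ⟨F p, hF0 p⟩, hFc.subtype_mk _⟩ : C(ℝ × ℝ, {z : ℂ // z ≠ 0})) (0, 0)
    (Complex.log (F (0, 0))) (Subtype.ext (Complex.exp_log (hF0 _)))
  have hexp (p : ℝ × ℝ) : Complex.exp (φ p) = F p := congrArg Subtype.val (congrFun hφ p)
  have hre {x y : ℝ} (hx : x ∈ Icc a b) (hy : y ∈ Icc c d) :
      Real.exp (φ (x, y)).re * Real.cos (φ (x, y)).im = f (x, y) := by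
    rw [← Complex.exp_re, hexp, hF]
    simp only [hκid hx hy]
  have him {x y : ℝ} (hx : x ∈ Icc a b) (hy : y ∈ Icc c d) :
      Real.exp (φ (x, y)).re * Real.sin (φ (x, y)).im = g (x, y) := by
    rw [← Complex.exp_im, hexp, hF]
    simp only [hκid hx hy]
  set n : ℤ := toIocDiv Real.two_pi_pos (-π) (φ (b, d)).im with hn
  set ψ : ℝ × ℝ → ℝ := fun p => (φ p).im - n • (2 * π) with hψ
  have hψc : Continuous ψ := (Complex.continuous_im.comp φ.continuous).sub continuous_const
  have hcos {x y : ℝ} (hx : x ∈ Icc a b) (hy : y ∈ Icc c d) :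
      Real.exp (φ (x, y)).re * Real.cos (ψ (x, y)) = f (x, y) := by
    rw [← hre hx hy, hψ]
    simp only [zsmul_eq_mul, Real.cos_sub_int_mul_two_pi]
  have hsin {x y : ℝ} (hx : x ∈ Icc a b) (hy : y ∈ Icc c d) :
      Real.exp (φ (x, y)).re * Real.sin (ψ (x, y)) = g (x, y) := by
    rw [← him hx hy, hψ]
    simp only [zsmul_eq_mul, Real.sin_sub_int_mul_two_pi]
  have hpos (z : ℝ × ℝ) {r : ℝ} (h : 0 < Real.exp (φ z).re * r) : 0 < r :=
    pos_of_mul_pos_right h (Real.exp_pos _).le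
  have ha := left_mem_Icc.2 hab
  have hb := right_mem_Icc.2 hab
  have hc := left_mem_Icc.2 hcd
  have hd := right_mem_Icc.2 hcd
  have hright (y : ℝ) (hy : y ∈ Icc c d) : 0 < Real.sin (ψ (b, y) - (-(π / 2))) := by
    rw [sub_neg_eq_add, Real.sin_add_pi_div_two]
    exact hpos (b, y) (by rw [hcos hb hy]; exact hfb y hy)
  have htop (x : ℝ) (hx : x ∈ Icc a b) : 0 < Real.sin (ψ (x, d) - 0) := by
    rw [sub_zero]
    exact hpos (x, d) (by rw [hsin hx hd]; exact hgd x hx)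
  have hleft (y : ℝ) (hy : y ∈ Icc c d) : 0 < Real.sin (ψ (a, y) - π / 2) := by
    rw [Real.sin_sub_pi_div_two]
    exact hpos (a, y) (by rw [mul_neg, hcos ha hy]; linarith [hfa y hy])
  have hbot (x : ℝ) (hx : x ∈ Icc a b) : 0 < Real.sin (ψ (x, c) - π) := by
    rw [Real.sin_sub_pi]
    exact hpos (x, c) (by rw [mul_neg, hsin hx hc]; linarith [hgc x hx])
  have hright' (y : ℝ) (hy : y ∈ Icc c d) : 0 < Real.sin (ψ (b, y) - 3 * π / 2) := by
    rw [show ψ (b, y) - 3 * π / 2 = ψ (b, y) - (-(π / 2)) - 2 * π by ring, Real.sin_sub_two_pi]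
    exact hright y hy
  have hx (y : ℝ) : Continuous fun x => ψ (x, y) := hψc.comp (by fun_prop)
  have hy (x : ℝ) : Continuous fun y => ψ (x, y) := hψc.comp (by fun_prop)
  have hπ := Real.pi_pos
  have hsub (v θ : ℝ) (hv : 0 < Real.sin (v - θ)) (h1 : θ - π ≤ v) (h2 : v ≤ θ + π) : θ < v := by
    by_contra! h
    have := Real.sin_nonpos_of_nonpos_of_neg_pi_le (x := v - θ) (by linarith) (by linarith)
    linarith
  have hsub' (v θ : ℝ) (hv : 0 < Real.sin (v - θ)) (h1 : θ ≤ v) (h2 : v ≤ θ + 2 * π) :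
      v < θ + π := by
    by_contra! h
    have := Real.sin_nonpos_of_nonpos_of_neg_pi_le (x := v - θ - 2 * π) (by linarith)
      (by linarith)
    rw [Real.sin_sub_two_pi] at this
    linarith
  have h0 : ψ (b, d) ∈ Ioc (-π) π := by
    have h := sub_toIocDiv_zsmul_mem_Ioc Real.two_pi_pos (-π) (φ (b, d)).im
    rw [show -π + 2 * π = π by ring] at h
    exact h
  have h1 : ψ (b, d) ∈ Ioo 0 (0 + π) := by
    have h2 := hsub _ 0 (htop b hb) (by linarith [h0.1]) (by linarith [h0.2])
    exact ⟨h2, hsub' _ 0 (htop b hb) h2.le (by linarith [h0.2])⟩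
  have h1' : ψ (b, d) < π / 2 := by
    have := hsub' _ _ (hright d hd) (by linarith [h1.1]) (by linarith [h1.2])
    linarith
  have h2 : ψ (a, d) ∈ Ioo 0 (0 + π) := mem_Ioo_of_sin_pos (hx d) hb ha htop h1
  have h3 : ψ (a, d) ∈ Ioo (π / 2) (π / 2 + π) :=
    ⟨hsub _ _ (hleft d hd) (by linarith [h2.1]) (by linarith [h2.2]), by linarith [h2.2]⟩
  have h4 : ψ (a, c) ∈ Ioo (π / 2) (π / 2 + π) := mem_Ioo_of_sin_pos (hy a) hd hc hleft h3
  have h5 : ψ (a, c) ∈ Ioo π (π + π) :=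
    ⟨hsub _ _ (hbot a ha) (by linarith [h4.1]) (by linarith [h4.2]), by linarith [h4.2]⟩
  have h6 : ψ (b, c) ∈ Ioo π (π + π) := mem_Ioo_of_sin_pos (hx c) ha hb hbot h5
  have h7 : ψ (b, c) ∈ Ioo (3 * π / 2) (3 * π / 2 + π) :=
    ⟨hsub _ _ (hright' c hc) (by linarith [h6.1]) (by linarith [h6.2]), by linarith [h6.2]⟩
  have h8 : ψ (b, d) ∈ Ioo (3 * π / 2) (3 * π / 2 + π) :=
    mem_Ioo_of_sin_pos (hy b) hc hd hright' h7
  linarith [h8.1]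

lemma repeatedEig_of_eq_sub_vecMulVec {M : Mat3} {μ : ℝ} {u v : Fin 3 → ℝ}
    (h : M = μ • (1 : Mat3) - Matrix.vecMulVec u v) : repeatedEig M := by
  refine ⟨μ, ?_⟩
  rw [Polynomial.le_rootMultiplicity_iff (Matrix.charpoly_monic M).ne_zero]
  refine ⟨Polynomial.X - Polynomial.C (μ - (u 0 * v 0 + u 1 * v 1 + u 2 * v 2)), ?_⟩
  subst h
  rw [Matrix.charpoly, Matrix.det_fin_three]
  simp [Matrix.vecMulVec_apply]
  ring

lemma repeatedEig_of_mul_mul {Q R : Mat3} (hR : R * R.transpose = 1)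
    (h : repeatedEig (R.transpose * Q * R)) : repeatedEig Q := by
  obtain ⟨μ, hμ⟩ := h
  refine ⟨μ, ?_⟩
  rwa [Matrix.mul_assoc, Matrix.charpoly_mul_comm, Matrix.mul_assoc, hR, Matrix.mul_one] at hμ

/-- The larger root of `Y ^ 2 = (A - B) * Y + p ^ 2` for the upper left block of `M`. -/
def blockRoot (M : Mat3) : ℝ := ((M 0 0 - M 1 1) + √((M 0 0 - M 1 1) ^ 2 + 4 * M 0 1 ^ 2)) / 2

lemma blockRoot_sq (M : Mat3) :
    blockRoot M ^ 2 = (M 0 0 - M 1 1) * blockRoot M + M 0 1 ^ 2 := by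
  have h := Real.sq_sqrt (show 0 ≤ (M 0 0 - M 1 1) ^ 2 + 4 * M 0 1 ^ 2 by positivity)
  rw [blockRoot]
  linear_combination h / 4

lemma le_blockRoot (M : Mat3) : M 0 0 - M 1 1 ≤ blockRoot M := by
  have h : M 0 0 - M 1 1 ≤ √((M 0 0 - M 1 1) ^ 2 + 4 * M 0 1 ^ 2) :=
    Real.le_sqrt_of_sq_le (by nlinarith [sq_nonneg (M 0 1)])
  rw [blockRoot]
  linarith

lemma repeatedEig_of_blockRoot {M : Mat3} (hM : M.IsSymm) (hy : 0 < blockRoot M)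
    (h1 : M 0 2 * blockRoot M + M 0 1 * M 1 2 = 0)
    (h2 : (M 0 0 - M 2 2) * blockRoot M + M 0 1 ^ 2 - M 1 2 ^ 2 = 0) : repeatedEig M := by
  have hsq := blockRoot_sq M
  set y := blockRoot M
  refine repeatedEig_of_eq_sub_vecMulVec (μ := M 1 1 + y) (u := ![M 0 1 / y, -1, M 1 2 / y])
    (v := ![M 0 1, -y, M 1 2]) ?_
  have h10 : M 1 0 = M 0 1 := hM.apply 0 1
  have h20 : M 2 0 = M 0 2 := hM.apply 0 2
  have h21 : M 2 1 = M 1 2 := hM.apply 1 2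
  ext i j
  fin_cases i <;> fin_cases j <;> simp [h10, h20, h21] <;> field_simp <;>
    linarith

/-- The frame `e_ρ, e_θ, e_z` of cylindrical coordinates. -/
def cylFrame (θ : ℝ) : Mat3 := !![cos θ, -sin θ, 0; sin θ, cos θ, 0; 0, 0, 1]

lemma cylFrame_mul_transpose (θ : ℝ) : cylFrame θ * (cylFrame θ).transpose = 1 := by
  have h := Real.sin_sq_add_cos_sq θ
  ext i j
  fin_cases i <;> fin_cases j <;>
    simp [cylFrame, Matrix.mul_apply, Fin.sum_univ_three] <;> linarith

lemma abs_cylFrame_le (θ : ℝ) (i j : Fin 3) : |cylFrame θ i j| ≤ 1 := by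
  fin_cases i <;> fin_cases j <;> simp [cylFrame, Real.abs_cos_le_one, Real.abs_sin_le_one]

lemma abs_conj_le {R D : Mat3} {ε : ℝ} (hR : ∀ i j, |R i j| ≤ 1) (hD : ∀ i j, |D i j| ≤ ε)
    (i j : Fin 3) : |(R.transpose * D * R) i j| ≤ 9 * ε := by
  have hε : 0 ≤ ε := (abs_nonneg _).trans (hD 0 0)
  have h (k l : Fin 3) : |R k i * D k l * R l j| ≤ ε := by
    rw [abs_mul, abs_mul]
    calc |R k i| * |D k l| * |R l j| ≤ 1 * ε * 1 := by
          gcongr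
          exacts [hR k i, hD k l, hR l j]
      _ = ε := by ring
  have e : (R.transpose * D * R) i j = ∑ l, ∑ k, R k i * D k l * R l j := by
    simp only [Matrix.mul_apply, Matrix.transpose_apply, Finset.sum_mul]
  rw [e]
  calc |∑ l, ∑ k, R k i * D k l * R l j| ≤ ∑ l : Fin 3, ∑ k : Fin 3, ε :=
        (Finset.abs_sum_le_sum_abs _ _).trans (Finset.sum_le_sum fun l _ =>
          (Finset.abs_sum_le_sum_abs _ _).trans (Finset.sum_le_sum fun k _ => h k l))
    _ = 9 * ε := by simp; ring

lemma vec3_apply (p q r : ℝ) : vec3 p q r 0 = p ∧ vec3 p q r 1 = q ∧ vec3 p q r 2 = r :=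
  ⟨rfl, rfl, rfl⟩

lemma norm_vec3_sq (p q r : ℝ) : ‖vec3 p q r‖ ^ 2 = p ^ 2 + q ^ 2 + r ^ 2 := norm_sq_eq_sum _

lemma norm_cyl_sq (ρ z θ : ℝ) : ‖vec3 (ρ * cos θ) (ρ * sin θ) z‖ ^ 2 = ρ ^ 2 + z ^ 2 := by
  rw [norm_vec3_sq]
  linear_combination ρ ^ 2 * Real.sin_sq_add_cos_sq θ

lemma norm_cyl (ρ z θ : ℝ) : ‖vec3 (ρ * cos θ) (ρ * sin θ) z‖ = √(ρ ^ 2 + z ^ 2) := by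
  rw [← norm_cyl_sq ρ z θ, Real.sqrt_sq (norm_nonneg _)]

lemma continuous_vec3 : Continuous fun p : ℝ × ℝ × ℝ => vec3 p.1 p.2.1 p.2.2 := by
  refine (PiLp.continuous_toLp 2 _).comp (continuous_pi fun i => ?_)
  fin_cases i <;> simp <;> fun_prop

/-- The harmonic configuration in the cylindrical frame is independent of the angle. -/
lemma conj_harmQ (a b c w ρ z θ : ℝ) :
    (cylFrame θ).transpose * harmQ a b c w (vec3 (ρ * cos θ) (ρ * sin θ) z) * cylFrame θ
      = harmQ a b c w (vec3 ρ 0 z) := by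
  have hn : ‖vec3 ρ 0 z‖ = √(ρ ^ 2 + z ^ 2) := by simpa using norm_cyl ρ z 0
  have h := Real.sin_sq_add_cos_sq θ
  have hz : (ez 0 = 0 ∧ ez 1 = 0) ∧ ez 2 = 1 := by simp [ez]
  ext i j
  simp only [Matrix.mul_apply, Fin.sum_univ_three, Matrix.transpose_apply, harmQ, Matrix.of_apply,
    norm_cyl, hn, vec3_apply, outer_apply, Matrix.sub_apply, Matrix.smul_apply, hz]
  generalize (√(ρ ^ 2 + z ^ 2))⁻¹ = u
  generalize w / (3 + w) = α
  generalize w / (1 + w) = β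
  generalize sstar a b c = s
  clear hn
  fin_cases i <;> fin_cases j <;> simp [cylFrame, vec3_apply, hz] <;> grind

lemma harmQ_vec3_apply (a b c w ρ z : ℝ) :
    harmQ a b c w (vec3 ρ 0 z) 0 1 = 0 ∧ harmQ a b c w (vec3 ρ 0 z) 1 2 = 0 ∧
    harmQ a b c w (vec3 ρ 0 z) 0 0 - harmQ a b c w (vec3 ρ 0 z) 1 1
      = sstar a b c * (w / (3 + w)) * (√(ρ ^ 2 + z ^ 2))⁻¹ ^ 5 * ρ ^ 2 ∧
    harmQ a b c w (vec3 ρ 0 z) 0 2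
      = sstar a b c * (w / (3 + w)) * (√(ρ ^ 2 + z ^ 2))⁻¹ ^ 5 * ρ * z ∧
    harmQ a b c w (vec3 ρ 0 z) 0 0 - harmQ a b c w (vec3 ρ 0 z) 2 2
      = sstar a b c * (w / (3 + w) * (√(ρ ^ 2 + z ^ 2))⁻¹ ^ 5 * (ρ ^ 2 - z ^ 2)
          - (1 - w / (1 + w) * (√(ρ ^ 2 + z ^ 2))⁻¹)) := by
  have hn : ‖vec3 ρ 0 z‖ = √(ρ ^ 2 + z ^ 2) := by simpa using norm_cyl ρ z 0
  have hz : (ez 0 = 0 ∧ ez 1 = 0) ∧ ez 2 = 1 := by simp [ez]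
  simp only [harmQ, Matrix.of_apply, hn, vec3_apply, outer_apply, Matrix.sub_apply,
    Matrix.smul_apply, hz]
  generalize (√(ρ ^ 2 + z ^ 2))⁻¹ = u
  refine ⟨?_, ?_, ?_, ?_, ?_⟩ <;> simp <;> ring

/-- Sign pattern of the harmonic configuration around its uniaxial ring. -/
lemma exists_harmQ_signs {a b c w r : ℝ} (ha : 0 ≤ a) (hb : 0 < b) (hc : 0 < c) (hw : 0 < w)
    (hr : 1 < r) (hrw : r ^ 3 - w / (1 + w) * r ^ 2 - w / (3 + w) = 0) {τ : ℝ} (hτ : 0 < τ) :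
    ∃ σ σ' m : ℝ, 0 < σ ∧ 0 < σ' ∧ 0 < m ∧ σ + σ' ≤ τ ∧ σ ≤ (r - 1) / 2 ∧ σ ≤ 1 ∧ σ' ≤ 1 ∧
      ∀ ρ z, |ρ - r| ≤ σ → |z| ≤ σ' →
        m ≤ harmQ a b c w (vec3 ρ 0 z) 0 0 - harmQ a b c w (vec3 ρ 0 z) 1 1 ∧
        (z = σ' → m ≤ harmQ a b c w (vec3 ρ 0 z) 0 2) ∧
        (z = -σ' → harmQ a b c w (vec3 ρ 0 z) 0 2 ≤ -m) ∧
        (ρ = r - σ →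
          m ≤ harmQ a b c w (vec3 ρ 0 z) 0 0 - harmQ a b c w (vec3 ρ 0 z) 2 2) ∧
        (ρ = r + σ →
          harmQ a b c w (vec3 ρ 0 z) 0 0 - harmQ a b c w (vec3 ρ 0 z) 2 2 ≤ -m) := by
  have hs : 0 < sstar a b c := sstar_pos ha hb hc
  have hα : 0 < w / (3 + w) := by positivity
  have hβ : w / (1 + w) < 1 := (div_lt_one (by positivity)).2 (by linarith)
  simp only [(harmQ_vec3_apply a b c w _ _).2.2]
  generalize w / (3 + w) = α at *
  generalize w / (1 + w) = β at *
  generalize sstar a b c = s at *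
  let F : ℝ → ℝ → ℝ := fun ρ z => s * (α * (√(ρ ^ 2 + z ^ 2))⁻¹ ^ 5 * (ρ ^ 2 - z ^ 2)
    - (1 - β * (√(ρ ^ 2 + z ^ 2))⁻¹))
  have hF0 (ρ : ℝ) (hρ : 0 < ρ) :
      F ρ 0 = -(s * ρ⁻¹ ^ 3) * ((ρ - r) * (ρ ^ 2 + ρ * r + r ^ 2 - β * (ρ + r))) := by
    have e : √(ρ ^ 2 + 0 ^ 2) = ρ := by
      rw [zero_pow two_ne_zero, add_zero, Real.sqrt_sq hρ.le]
    have e' : (ρ - r) * (ρ ^ 2 + ρ * r + r ^ 2 - β * (ρ + r)) = ρ ^ 3 - β * ρ ^ 2 - α := by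
      linear_combination -hrw
    rw [e']
    simp only [F, e]
    field_simp
    ring
  have hFc (ρ : ℝ) (hρ : 0 < ρ) : ContinuousAt (F ρ) 0 := by
    have h0 : √(ρ ^ 2 + 0 ^ 2) ≠ 0 := by positivity
    have h1 : ContinuousAt (fun z : ℝ => (√(ρ ^ 2 + z ^ 2))⁻¹) 0 :=
      ContinuousAt.inv₀ (by fun_prop) h0
    simp only [F]
    fun_prop
  have hfac (ρ : ℝ) (hρ : 1 < ρ) : 0 < ρ ^ 2 + ρ * r + r ^ 2 - β * (ρ + r) := by
    nlinarith [mul_pos (sub_pos.2 hρ) (sub_pos.2 hr)]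
  obtain ⟨σ, hσ, hσ1, hσ2, hσ3⟩ : ∃ σ > 0, σ ≤ τ / 2 ∧ σ ≤ (r - 1) / 2 ∧ σ ≤ 1 :=
    ⟨min (τ / 2) (min ((r - 1) / 2) 1),
      lt_min (by linarith) (lt_min (by linarith) one_pos), min_le_left _ _,
      (min_le_right _ _).trans (min_le_left _ _), (min_le_right _ _).trans (min_le_right _ _)⟩
  have hm1 : 0 < F (r - σ) 0 := by
    have hp : 0 < r - σ := by linarith
    have := hfac (r - σ) (by linarith)
    rw [hF0 _ hp]
    have h2 : 0 < s * (r - σ)⁻¹ ^ 3 * (σ * ((r - σ) ^ 2 + (r - σ) * r + r ^ 2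
      - β * (r - σ + r))) := by positivity
    linarith
  have hm2 : F (r + σ) 0 < 0 := by
    have hp : 0 < r + σ := by linarith
    have := hfac (r + σ) (by linarith)
    rw [hF0 _ hp]
    have h2 : 0 < s * (r + σ)⁻¹ ^ 3 * (σ * ((r + σ) ^ 2 + (r + σ) * r + r ^ 2
      - β * (r + σ + r))) := by positivity
    linarith
  have hev1 := (hFc (r - σ) (by linarith)).eventually (lt_mem_nhds (half_lt_self hm1))
  have hev2 := (hFc (r + σ) (by linarith)).eventually
    (gt_mem_nhds (show F (r + σ) 0 < F (r + σ) 0 / 2 by linarith))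
  obtain ⟨η, hη, hball⟩ := Metric.eventually_nhds_iff.1 (hev1.and hev2)
  obtain ⟨σ', hσ', hσ1', hσ2', hσ3'⟩ : ∃ σ' > 0, σ' ≤ τ / 2 ∧ σ' < η ∧ σ' ≤ 1 :=
    ⟨min (τ / 2) (min (η / 2) 1),
      lt_min (by linarith) (lt_min (by linarith) one_pos), min_le_left _ _,
      ((min_le_right _ _).trans (min_le_left _ _)).trans_lt (by linarith),
      (min_le_right _ _).trans (min_le_right _ _)⟩
  have hK : 0 < (r + 2)⁻¹ ^ 5 := by positivity
  refine ⟨σ, σ', min (min (F (r - σ) 0 / 2) (-(F (r + σ) 0 / 2))) (s * α * (r + 2)⁻¹ ^ 5 * σ'),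
    hσ, hσ', lt_min (lt_min (by linarith) (by linarith)) (by positivity), by linarith, hσ2, hσ3,
    hσ3', fun ρ z hρ hz => ?_⟩
  set m := min (min (F (r - σ) 0 / 2) (-(F (r + σ) 0 / 2))) (s * α * (r + 2)⁻¹ ^ 5 * σ')
  have hmA : m ≤ F (r - σ) 0 / 2 := (min_le_left _ _).trans (min_le_left _ _)
  have hmB : m ≤ -(F (r + σ) 0 / 2) := (min_le_left _ _).trans (min_le_right _ _)
  have hmC : m ≤ s * α * (r + 2)⁻¹ ^ 5 * σ' := min_le_right _ _
  have hρ1 : 1 ≤ ρ := by linarith [(abs_le.1 hρ).1]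
  have hρ2 : ρ ≤ r + 1 := by linarith [(abs_le.1 hρ).2]
  have hu : (r + 2)⁻¹ ^ 5 ≤ (√(ρ ^ 2 + z ^ 2))⁻¹ ^ 5 := by
    have hpos : 0 < √(ρ ^ 2 + z ^ 2) := by positivity
    have hle : √(ρ ^ 2 + z ^ 2) ≤ r + 2 := by
      rw [Real.sqrt_le_left (by linarith)]
      nlinarith [sq_abs z, abs_nonneg z]
    gcongr
  have hsα : 0 < s * α := mul_pos hs hα
  have hmain : m ≤ s * α * (√(ρ ^ 2 + z ^ 2))⁻¹ ^ 5 * ρ * σ' := by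
    refine hmC.trans (mul_le_mul_of_nonneg_right ?_ hσ'.le)
    calc s * α * (r + 2)⁻¹ ^ 5 ≤ s * α * (√(ρ ^ 2 + z ^ 2))⁻¹ ^ 5 := by gcongr
      _ ≤ _ := le_mul_of_one_le_right (by positivity) hρ1
  have hz' : dist z 0 < η := by simpa using hz.trans_lt hσ2'
  refine ⟨hmain.trans ?_, ?_, ?_, ?_, ?_⟩
  · rw [pow_two, ← mul_assoc]
    gcongr
    linarith
  · rintro rfl
    exact hmain
  · rintro rfl
    linarith
  · rintro rfl
    exact hmA.trans (hball hz').1.le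
  · rintro rfl
    have := (hball hz').2
    simp only [F] at this hmB ⊢
    linarith

/-- A solution close to the harmonic configuration has a point with a repeated eigenvalue near
the ring on every meridian half-plane. -/
lemma IsSol.exists_repeatedEig {a b c w r τ : ℝ} (ha : 0 ≤ a) (hb : 0 < b) (hc : 0 < c)
    (hw : 0 < w) (hr : 1 < r) (hrw : r ^ 3 - w / (1 + w) * r ^ 2 - w / (3 + w) = 0)
    (hτ : 0 < τ) :
    ∃ δ > 0, ∀ L W Q, IsSol a b c L W Q → 1 / L + |L / W - 1 / w| < δ → ∀ θ, ∃ ρ z : ℝ,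
      repeatedEig (Q (vec3 (ρ * cos θ) (ρ * sin θ) z)) ∧ |ρ - r| + |z| ≤ τ := by
  obtain ⟨σ, σ', m, hσ, hσ', hm, hστ, hσr, hσ1, hσ'1, hN⟩ :=
    exists_harmQ_signs ha hb hc hw hr hrw hτ
  obtain ⟨δ, hδ, H⟩ := exists_abs_sub_harmQ_le (κ := (r - 1) / 2) (K := r + 2) (ε := m / 36)
    ha hb hc hw (by linarith) (by linarith) (by linarith)
  refine ⟨δ, hδ, fun L W Q hQ hLW θ => ?_⟩
  let M : ℝ × ℝ → Mat3 := fun p =>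
    (cylFrame θ).transpose * Q (vec3 (p.1 * cos θ) (p.1 * sin θ) p.2) * cylFrame θ
  let S := Icc (r - σ) (r + σ) ×ˢ Icc (-σ') σ'
  have hnorm (p) (hp : p ∈ S) : 1 + (r - 1) / 2 ≤ ‖vec3 (p.1 * cos θ) (p.1 * sin θ) p.2‖ ∧
      ‖vec3 (p.1 * cos θ) (p.1 * sin θ) p.2‖ ≤ r + 2 := by
    obtain ⟨⟨h1, h2⟩, h3, h4⟩ := hp
    rw [norm_cyl]
    constructor
    · apply Real.le_sqrt_of_sq_le
      nlinarith [sq_nonneg p.2]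
    · rw [Real.sqrt_le_left (by linarith)]
      nlinarith
  have hbar (p) (hp : p ∈ S) : vec3 (p.1 * cos θ) (p.1 * sin θ) p.2 ∈ OmegaBar := by
    have := (hnorm p hp).1
    exact (by linarith : (1 : ℝ) ≤ _)
  have hM (p) (hp : p ∈ S) (i j : Fin 3) :
      |M p i j - harmQ a b c w (vec3 p.1 0 p.2) i j| ≤ m / 4 := by
    rw [← conj_harmQ a b c w p.1 p.2 θ, ← Matrix.sub_apply, ← Matrix.sub_mul, ← Matrix.mul_sub]
    refine (abs_conj_le (ε := m / 36) (abs_cylFrame_le θ)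
      (fun k l => H L W Q hQ hLW _ (hnorm p hp).1 (hnorm p hp).2 k l) i j).trans ?_
    linarith
  have hsymm (p) (hp : p ∈ S) : (M p).IsSymm := by
    have := (hQ.isS0 (hbar p hp)).1
    simp only [M, Matrix.IsSymm, Matrix.transpose_mul, Matrix.transpose_transpose, this.eq,
      Matrix.mul_assoc]
  have hcont (i j : Fin 3) : ContinuousOn (fun p => M p i j) S := by
    have hv : Continuous fun p : ℝ × ℝ => vec3 (p.1 * cos θ) (p.1 * sin θ) p.2 :=
      continuous_vec3.comp (by fun_prop : Continuous fun p : ℝ × ℝ =>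
        (p.1 * cos θ, p.1 * sin θ, p.2))
    have hq (k l : Fin 3) : ContinuousOn
        (fun p : ℝ × ℝ => Q (vec3 (p.1 * cos θ) (p.1 * sin θ) p.2) k l) S :=
      (hQ.reg k l).continuousOn.comp hv.continuousOn fun p hp => hbar p hp
    simp only [M, Matrix.mul_apply]
    exact continuousOn_finsetSum _ fun l _ => (continuousOn_finsetSum _ fun k _ =>
      continuousOn_const.mul (hq k l)).mul continuousOn_const
  have hy : ContinuousOn (fun p => blockRoot (M p)) S := by
    have h00 := hcont 0 0
    have h11 := hcont 1 1
    have h01 := hcont 0 1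
    unfold blockRoot
    fun_prop
  have hest (p) (hp : p ∈ S) : |M p 0 1| ≤ m / 4 ∧ |M p 1 2| ≤ m / 4 ∧
      m / 2 ≤ blockRoot (M p) := by
    obtain ⟨e1, e2, -⟩ := harmQ_vec3_apply a b c w p.1 p.2
    have h1 := hM p hp 0 1
    have h2 := hM p hp 1 2
    rw [e1, sub_zero] at h1
    rw [e2, sub_zero] at h2
    refine ⟨h1, h2, ?_⟩
    have h3 := (hN p.1 p.2 (abs_le.2 ⟨by linarith [hp.1.1], by linarith [hp.1.2]⟩)
      (abs_le.2 hp.2)).1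
    have := le_blockRoot (M p)
    linarith [(abs_le.1 (hM p hp 0 0)).1, (abs_le.1 (hM p hp 1 1)).2]
  have hsq (p) (hp : p ∈ S) : |M p 0 1 ^ 2 - M p 1 2 ^ 2| ≤ m ^ 2 / 16 := by
    obtain ⟨h1, h2, -⟩ := hest p hp
    have h1' := sq_le_sq' (abs_le.1 h1).1 (abs_le.1 h1).2
    have h2' := sq_le_sq' (abs_le.1 h2).1 (abs_le.1 h2).2
    exact abs_le.2 ⟨by nlinarith [sq_nonneg (M p 0 1)], by nlinarith [sq_nonneg (M p 1 2)]⟩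
  have hmul (p) (hp : p ∈ S) : |M p 0 1 * M p 1 2| ≤ m ^ 2 / 16 := by
    obtain ⟨h1, h2, -⟩ := hest p hp
    rw [abs_mul]
    calc |M p 0 1| * |M p 1 2| ≤ m / 4 * (m / 4) := by gcongr
      _ = m ^ 2 / 16 := by ring
  have hσmem : r - σ ≤ r + σ ∧ -σ' ≤ σ' := ⟨by linarith, by linarith⟩
  suffices key : ∃ p ∈ S,
      -((M p 0 0 - M p 2 2) * blockRoot (M p) + M p 0 1 ^ 2 - M p 1 2 ^ 2) = 0 ∧
        M p 0 2 * blockRoot (M p) + M p 0 1 * M p 1 2 = 0 by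
    obtain ⟨p, hp, hf, hg⟩ := key
    refine ⟨p.1, p.2, repeatedEig_of_mul_mul (cylFrame_mul_transpose θ)
      (repeatedEig_of_blockRoot (M := M p) (hsymm p hp) (by linarith [(hest p hp).2.2]) hg
        (neg_eq_zero.1 hf)), ?_⟩
    have h1 : |p.1 - r| ≤ σ := abs_le.2 ⟨by linarith [hp.1.1], by linarith [hp.1.2]⟩
    have h2 : |p.2| ≤ σ' := abs_le.2 hp.2
    linarith
  refine exists_zero_of_signs
    (f := fun p => -((M p 0 0 - M p 2 2) * blockRoot (M p) + M p 0 1 ^ 2 - M p 1 2 ^ 2))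
    (g := fun p => M p 0 2 * blockRoot (M p) + M p 0 1 * M p 1 2)
    hσmem.1 hσmem.2 ?_ ?_ ?_ ?_ ?_ ?_
  · have h00 := hcont 0 0
    have h22 := hcont 2 2
    have h01 := hcont 0 1
    have h12 := hcont 1 2
    exact (((h00.sub h22).mul hy).add (h01.pow 2)).sub (h12.pow 2) |>.neg
  · exact ((hcont 0 2).mul hy).add ((hcont 0 1).mul (hcont 1 2))
  · intro z hz
    have hp : (r - σ, z) ∈ S := ⟨⟨le_rfl, hσmem.1⟩, hz⟩
    have h := (hN (r - σ) z (by simp [abs_of_pos hσ]) (abs_le.2 hz)).2.2.2.1 rfl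
    have h' : m / 2 ≤ M (r - σ, z) 0 0 - M (r - σ, z) 2 2 := by
      linarith [(abs_le.1 (hM _ hp 0 0)).1, (abs_le.1 (hM _ hp 2 2)).2]
    have := mul_le_mul h' (hest _ hp).2.2 (by linarith) (by linarith)
    nlinarith [(abs_le.1 (hsq _ hp)).1]
  · intro z hz
    have hp : (r + σ, z) ∈ S := ⟨⟨hσmem.1, le_rfl⟩, hz⟩
    have h := (hN (r + σ) z (by simp [abs_of_pos hσ]) (abs_le.2 hz)).2.2.2.2 rfl
    have h' : m / 2 ≤ -(M (r + σ, z) 0 0 - M (r + σ, z) 2 2) := by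
      linarith [(abs_le.1 (hM _ hp 0 0)).2, (abs_le.1 (hM _ hp 2 2)).1]
    have := mul_le_mul h' (hest _ hp).2.2 (by linarith) (by linarith)
    nlinarith [(abs_le.1 (hsq _ hp)).2]
  · intro ρ hρ
    have hp : (ρ, -σ') ∈ S := ⟨hρ, ⟨le_rfl, hσmem.2⟩⟩
    have h := (hN ρ (-σ') (abs_le.2 ⟨by linarith [hρ.1], by linarith [hρ.2]⟩)
      (by simp [abs_of_pos hσ'])).2.2.1 rfl
    have h' : m / 2 ≤ -M (ρ, -σ') 0 2 := by linarith [(abs_le.1 (hM _ hp 0 2)).2]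
    have := mul_le_mul h' (hest _ hp).2.2 (by linarith) (by linarith)
    nlinarith [(abs_le.1 (hmul _ hp)).2]
  · intro ρ hρ
    have hp : (ρ, σ') ∈ S := ⟨hρ, ⟨hσmem.2, le_rfl⟩⟩
    have h := (hN ρ σ' (abs_le.2 ⟨by linarith [hρ.1], by linarith [hρ.2]⟩)
      (by simp [abs_of_pos hσ'])).2.1 rfl
    have h' : m / 2 ≤ M (ρ, σ') 0 2 := by linarith [(abs_le.1 (hM _ hp 0 2)).1]
    have := mul_le_mul h' (hest _ hp).2.2 (by linarith) (by linarith)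
    nlinarith [(abs_le.1 (hmul _ hp)).1]

/-- A property holding with every tolerance for small parameters holds with a tolerance tending
to zero with the parameter. -/
lemma exists_tendsto_modulus {P : ℝ → ℝ → Prop} (hmono : ∀ d, ∀ s t, s ≤ t → P s d → P t d)
    (h : ∀ τ > 0, ∃ δ > 0, ∀ d < δ, P τ d) :
    ∃ δ > 0, ∃ eps : ℝ → ℝ, Tendsto eps (nhdsWithin 0 (Ioi 0)) (nhds 0) ∧
      ∀ d, 0 < d → d < δ → P (eps d) d := by
  obtain ⟨δ, hδ, h1⟩ := h 1 one_pos
  let A : ℝ → Set ℝ := fun d => {τ | 0 < τ ∧ P τ d}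
  have hbdd (d) : BddBelow (A d) := ⟨0, fun τ hτ => hτ.1.le⟩
  have h0 (d) : 0 ≤ sInf (A d) := Real.sInf_nonneg fun τ hτ => hτ.1.le
  refine ⟨δ, hδ, fun d => sInf (A d) + d, ?_, fun d hd hdδ => ?_⟩
  · rw [Metric.tendsto_nhdsWithin_nhds]
    intro τ hτ
    obtain ⟨δ', hδ', h2⟩ := h (τ / 2) (half_pos hτ)
    refine ⟨min δ' (τ / 2), lt_min hδ' (half_pos hτ), fun {d} hd hdist => ?_⟩
    have hd' : 0 < d := hd
    rw [Real.dist_eq, sub_zero, abs_of_pos hd', lt_min_iff] at hdist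
    have h3 : sInf (A d) ≤ τ / 2 := csInf_le (hbdd d) ⟨half_pos hτ, h2 d hdist.1⟩
    rw [Real.dist_eq, sub_zero, abs_of_nonneg (by linarith [h0 d])]
    linarith
  · obtain ⟨τ, hτ, hlt⟩ := exists_lt_of_csInf_lt (s := A d) ⟨1, one_pos, h1 d hdδ⟩
      (lt_add_of_pos_right (sInf (A d)) hd)
    exact hmono d _ _ hlt.le hτ.2

lemma exists_uniaxial_ring {a b c w r : ℝ} (ha : 0 ≤ a) (hb : 0 < b) (hc : 0 < c)
    (hw : 0 < w) (hr : 1 < r) (hrw : r ^ 3 - w / (1 + w) * r ^ 2 - w / (3 + w) = 0) :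
    ∃ δ > 0, ∃ eps : ℝ → ℝ, Tendsto eps (nhdsWithin 0 (Ioi 0)) (nhds 0) ∧
      ∀ L W Q, IsSol a b c L W Q → 1 / L + |L / W - 1 / w| < δ → ∀ θ, ∃ ρ z : ℝ,
        repeatedEig (Q (vec3 (ρ * cos θ) (ρ * sin θ) z)) ∧
          |ρ - r| + |z| ≤ eps (1 / L + |L / W - 1 / w|) := by
  obtain ⟨δ, hδ, eps, heps, h⟩ := exists_tendsto_modulus
    (P := fun τ d => ∀ L W Q, IsSol a b c L W Q → 1 / L + |L / W - 1 / w| = d → ∀ θ,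
      ∃ ρ z : ℝ, repeatedEig (Q (vec3 (ρ * cos θ) (ρ * sin θ) z)) ∧ |ρ - r| + |z| ≤ τ)
    (fun d s t hst hP L W Q hQ hd θ =>
      let ⟨ρ, z, h1, h2⟩ := hP L W Q hQ hd θ
      ⟨ρ, z, h1, h2.trans hst⟩)
    (fun τ hτ =>
      let ⟨δ, hδ, H⟩ := IsSol.exists_repeatedEig ha hb hc hw hr hrw hτ
      ⟨δ, hδ, fun d hd L W Q hQ hLW => H L W Q hQ (hLW ▸ hd)⟩)
  refine ⟨δ, hδ, eps, heps, fun L W Q hQ hLW => h _ ?_ hLW L W Q hQ rfl⟩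
  have := hQ.L_pos
  positivity

/-- Corollary 3.3: for `w > √3`, with `r_w > 1` the root of the ring
equation, there is `δ₀ > 0` so that whenever `δ = 1/L + |L/W − 1/w| < δ₀`, any solution of
the Euler–Lagrange equations with weak anchoring admits a uniaxial ring: a closed curve
`θ ↦ (ρ_u(θ)cos θ, ρ_u(θ)sin θ, z_u(θ))` of points where `Q` has a repeated eigenvalue,
with `|ρ_u(θ) − r_w| + |z_u(θ)| ≤ ε(δ) → 0` as `δ → 0`. -/
theorem uniaxial_ring_persistence
    (a b c : ℝ) (ha : 0 ≤ a) (hb : 0 < b) (hc : 0 < c)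
    (w : ℝ) (hw : Real.sqrt 3 < w)
    (rw : ℝ) (hrw1 : 1 < rw) (hrw : rw ^ 3 - w / (1 + w) * rw ^ 2 - w / (3 + w) = 0) :
    ∃ δ0 : ℝ, 0 < δ0 ∧ ∃ eps : ℝ → ℝ,
      Filter.Tendsto eps (nhdsWithin 0 (Set.Ioi 0)) (nhds 0) ∧
      ∀ (L W : ℝ), 0 < L → 0 < W →
        1 / L + |L / W - 1 / w| < δ0 →
        ∀ Q : E3 → Mat3, RegC 2 Q → memH a b c Q → isEL a b c L Q →
          weakAnchor a b c L W Q →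
          ∃ ρu zu : ℝ → ℝ,
            (∀ θ : ℝ, repeatedEig
              (Q (vec3 (ρu θ * Real.cos θ) (ρu θ * Real.sin θ) (zu θ)))) ∧
            (∀ θ : ℝ, |ρu θ - rw| + |zu θ| ≤ eps (1 / L + |L / W - 1 / w|)) := by
  obtain ⟨δ, hδ, eps, heps, h⟩ :=
    exists_uniaxial_ring ha hb hc ((Real.sqrt_nonneg 3).trans_lt hw) hrw1 hrw
  refine ⟨δ, hδ, eps, heps, fun L W hL hW hLW Q hreg hmem hel hbc => ?_⟩
  choose ρu zu hring using h L W Q ⟨hL, hW, hreg, hmem, hel, hbc⟩ hLW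
  exact ⟨ρu, zu, fun θ => (hring θ).1, fun θ => (hring θ).2⟩
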